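/- Let m ≥ 2 be an integer and let L_1, …, L_m be linearly independent linear forms in m variables whose coefficients are algebraic complex numbers. Let ε > 0. Then the set of points x = (x_1, …, x_m) ∈ ℤ^m with |L_1(x) ⋯ L_m(x)| ≤ |x|^{−ε}, where |x| = max_i |x_i|, is contained in the union of finitely many proper linear subspaces of ℚ^m. -/

import Mathlib

namespace SubspaceThm

section LOneNorm

variable {σ τ R : Type*} [CommRing R]

/-- The sum of the sizes of the coefficients of a polynomial. -/
noncomputable def lOne (ν : RingSeminorm R) (f : MvPolynomial σ R) : ℝ :=
  ∑ e ∈ f.support, ν (f.coeff e)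

variable (ν : RingSeminorm R)

lemma lOne_nonneg (f : MvPolynomial σ R) : 0 ≤ lOne ν f :=
  Finset.sum_nonneg fun _ _ => apply_nonneg ν _

lemma lOne_eq_sum {f : MvPolynomial σ R} {s : Finset (σ →₀ ℕ)} (h : f.support ⊆ s) :
    lOne ν f = ∑ e ∈ s, ν (f.coeff e) := by
  refine Finset.sum_subset h fun e _ he => ?_
  rw [MvPolynomial.notMem_support_iff.mp he, map_zero]

lemma coeff_le_lOne (f : MvPolynomial σ R) (e : σ →₀ ℕ) : ν (f.coeff e) ≤ lOne ν f := by
  classical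
  rw [lOne_eq_sum ν (Finset.subset_insert e f.support)]
  exact Finset.single_le_sum (f := fun e => ν (f.coeff e)) (fun _ _ => apply_nonneg ν _)
    (Finset.mem_insert_self _ _)

lemma lOne_zero : lOne ν (0 : MvPolynomial σ R) = 0 := by simp [lOne]

lemma lOne_add_le (f g : MvPolynomial σ R) : lOne ν (f + g) ≤ lOne ν f + lOne ν g := by
  classical
  rw [lOne_eq_sum ν (MvPolynomial.support_add (p := f) (q := g)),
    lOne_eq_sum ν (Finset.subset_union_left (s₁ := f.support) (s₂ := g.support)),
    lOne_eq_sum ν (Finset.subset_union_right (s₁ := f.support) (s₂ := g.support)),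
    ← Finset.sum_add_distrib]
  exact Finset.sum_le_sum fun e _ => by rw [MvPolynomial.coeff_add]; exact map_add_le_add ν _ _

lemma lOne_sum_le {ι : Type*} (s : Finset ι) (f : ι → MvPolynomial σ R) :
    lOne ν (∑ i ∈ s, f i) ≤ ∑ i ∈ s, lOne ν (f i) := by
  classical
  induction s using Finset.induction_on with
  | empty => simp [lOne_zero]
  | insert a s ha ih =>
    rw [Finset.sum_insert ha, Finset.sum_insert ha]
    exact (lOne_add_le ν _ _).trans (by linarith)

lemma lOne_monomial (e : σ →₀ ℕ) (a : R) : lOne ν (MvPolynomial.monomial e a) = ν a := by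
  classical
  rw [lOne_eq_sum ν (MvPolynomial.support_monomial_subset), Finset.sum_singleton,
    MvPolynomial.coeff_monomial, if_pos rfl]

lemma lOne_C (a : R) : lOne ν (MvPolynomial.C a : MvPolynomial σ R) = ν a :=
  lOne_monomial ν 0 a

lemma lOne_X (i : σ) : lOne ν (MvPolynomial.X i : MvPolynomial σ R) = ν 1 :=
  lOne_monomial ν _ 1

lemma lOne_mul_le (f g : MvPolynomial σ R) : lOne ν (f * g) ≤ lOne ν f * lOne ν g := by
  classical
  have h : lOne ν f * lOne ν g = ∑ a ∈ f.support, ∑ b ∈ g.support,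
      ν (f.coeff a) * ν (g.coeff b) := by rw [lOne, lOne, Finset.sum_mul_sum]
  rw [h, MvPolynomial.mul_def, Finsupp.sum]
  refine (lOne_sum_le ν _ _).trans (Finset.sum_le_sum fun a _ => ?_)
  rw [Finsupp.sum]
  refine (lOne_sum_le ν _ _).trans (Finset.sum_le_sum fun b _ => ?_)
  rw [lOne_monomial]
  exact map_mul_le_mul ν _ _

lemma lOne_prod_le (h1 : ν 1 ≤ 1) {ι : Type*} (s : Finset ι) (f : ι → MvPolynomial σ R) :
    lOne ν (∏ i ∈ s, f i) ≤ ∏ i ∈ s, lOne ν (f i) := by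
  classical
  induction s using Finset.induction_on with
  | empty =>
    rw [Finset.prod_empty, Finset.prod_empty, ← MvPolynomial.C_1, lOne_C]
    exact h1
  | insert a s ha ih =>
    rw [Finset.prod_insert ha, Finset.prod_insert ha]
    exact (lOne_mul_le ν _ _).trans (mul_le_mul_of_nonneg_left ih (lOne_nonneg ν _))

lemma lOne_pow_le (h1 : ν 1 ≤ 1) (f : MvPolynomial σ R) (n : ℕ) :
    lOne ν (f ^ n) ≤ lOne ν f ^ n := by
  simpa using lOne_prod_le ν h1 (Finset.range n) fun _ => f

lemma lOne_bind₁_le (h1 : ν 1 ≤ 1) (s : σ → MvPolynomial τ R) (f : MvPolynomial σ R) :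
    lOne ν (MvPolynomial.bind₁ s f) ≤
      ∑ e ∈ f.support, ν (f.coeff e) * ∏ i ∈ e.support, lOne ν (s i) ^ e i := by
  rw [MvPolynomial.bind₁, MvPolynomial.aeval_def, MvPolynomial.eval₂_eq]
  refine (lOne_sum_le ν _ _).trans (Finset.sum_le_sum fun e _ => ?_)
  refine (lOne_mul_le ν _ _).trans ?_
  rw [MvPolynomial.algebraMap_eq, lOne_C]
  refine mul_le_mul_of_nonneg_left ?_ (apply_nonneg ν _)
  exact (lOne_prod_le ν h1 _ _).trans
    (Finset.prod_le_prod (fun _ _ => lOne_nonneg ν _) fun i _ => lOne_pow_le ν h1 _ _)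

lemma lOne_bind₁_le_pow (h1 : ν 1 ≤ 1) (s : σ → MvPolynomial τ R) (f : MvPolynomial σ R)
    {B : ℝ} (hB : 1 ≤ B) (hs : ∀ i, lOne ν (s i) ≤ B) {d : ℕ} (hd : f.totalDegree ≤ d) :
    lOne ν (MvPolynomial.bind₁ s f) ≤ lOne ν f * B ^ d := by
  refine (lOne_bind₁_le ν h1 s f).trans ?_
  rw [lOne, Finset.sum_mul]
  refine Finset.sum_le_sum fun e he => mul_le_mul_of_nonneg_left ?_ (apply_nonneg ν _)
  calc ∏ i ∈ e.support, lOne ν (s i) ^ e i ≤ ∏ i ∈ e.support, B ^ e i :=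
        Finset.prod_le_prod (fun _ _ => pow_nonneg (lOne_nonneg ν _) _) fun i _ =>
          pow_le_pow_left₀ (lOne_nonneg ν _) (hs i) _
    _ = B ^ (e.sum fun _ k => k) := by rw [Finset.prod_pow_eq_pow_sum]; rfl
    _ ≤ B ^ d := pow_le_pow_right₀ hB ((MvPolynomial.le_totalDegree he).trans hd)

/-- The absolute value on `ℤ`, as a ring seminorm. -/
noncomputable abbrev intAbs : RingSeminorm ℤ := normRingSeminorm ℤ

/-- The absolute value on `ℝ`, as a ring seminorm. -/
noncomputable abbrev realAbs : RingSeminorm ℝ := normRingSeminorm ℝ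

lemma intAbs_apply (a : ℤ) : intAbs a = |(a : ℝ)| := by
  change ‖a‖ = _; rw [Int.norm_eq_abs]

lemma realAbs_apply (a : ℝ) : realAbs a = |a| := rfl

end LOneNorm

end SubspaceThm

namespace SubspaceThm

open MvPolynomial

section Interpolation

variable {σ : Type*} [Fintype σ]

/-- The product of the binomial coefficients `(α s).choose (e s)`. -/
def multiChoose (α e : σ →₀ ℕ) : ℕ := ∏ s, (α s).choose (e s)

lemma mul_multiChoose (α e : σ →₀ ℕ) (s : σ) :
    (α s : ℚ) * multiChoose α e =
      (e s + 1) * multiChoose α (e + Finsupp.single s 1) + e s * multiChoose α e := by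
  classical
  have h1 : ∀ e' : σ →₀ ℕ, (multiChoose α e' : ℚ) =
      (α s).choose (e' s) * ∏ t ∈ Finset.univ.erase s, ((α t).choose (e' t) : ℚ) := by
    intro e'
    rw [multiChoose, Nat.cast_prod]
    exact (Finset.mul_prod_erase Finset.univ (fun t => ((α t).choose (e' t) : ℚ))
      (Finset.mem_univ s)).symm
  have h2 : ∏ t ∈ Finset.univ.erase s, ((α t).choose ((e + Finsupp.single s 1 : σ →₀ ℕ) t) : ℚ) =
      ∏ t ∈ Finset.univ.erase s, ((α t).choose (e t) : ℚ) := by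
    refine Finset.prod_congr rfl fun t ht => ?_
    simp [(Finset.ne_of_mem_erase ht).symm]
  rw [h1 e, h1 (e + Finsupp.single s 1), h2]
  have h3 : (α s : ℚ) * (α s).choose (e s) =
      (e s + 1) * (α s).choose (e s + 1) + e s * (α s).choose (e s) := by
    have := Nat.choose_succ_right_eq (α s) (e s)
    rcases le_or_gt (e s) (α s) with h | h
    · have h4 : ((α s).choose (e s + 1) : ℚ) * (e s + 1) = (α s).choose (e s) * (α s - e s) := by
        rw [← Nat.cast_sub h]; exact_mod_cast this
      linear_combination -h4
    · simp [Nat.choose_eq_zero_of_lt h, Nat.choose_eq_zero_of_lt (h.trans (Nat.lt_succ_self _))]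
  simp only [Finsupp.add_apply, Finsupp.single_eq_same]
  linear_combination (∏ t ∈ Finset.univ.erase s, ((α t).choose (e t) : ℚ)) * h3

variable {k : ℕ} (α : Fin k → σ →₀ ℕ)

/-- Values at the points `α j` of the binomial products of degree at most `d`. -/
def interpSpan (d : ℕ) : Submodule ℚ (Fin k → ℚ) :=
  Submodule.span ℚ {v | ∃ e : σ →₀ ℕ, e.degree ≤ d ∧ v = fun j => (multiChoose (α j) e : ℚ)}

lemma interpSpan_mono {d d' : ℕ} (h : d ≤ d') : interpSpan α d ≤ interpSpan α d' :=
  Submodule.span_mono fun _ ⟨e, he, hv⟩ => ⟨e, he.trans h, hv⟩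

lemma coord_mul_mem_interpSpan (s : σ) {d : ℕ} {v : Fin k → ℚ} (hv : v ∈ interpSpan α d) :
    (fun j => (α j s : ℚ) * v j) ∈ interpSpan α (d + 1) := by
  induction hv using Submodule.span_induction with
  | mem v hv =>
    obtain ⟨e, he, rfl⟩ := hv
    have : (fun j => (α j s : ℚ) * multiChoose (α j) e) =
        ((e s : ℚ) + 1) • (fun j => (multiChoose (α j) (e + Finsupp.single s 1) : ℚ)) +
        (e s : ℚ) • fun j => (multiChoose (α j) e : ℚ) := by
      funext j; simpa using mul_multiChoose (α j) e s
    rw [this]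
    refine Submodule.add_mem _ (Submodule.smul_mem _ _ (Submodule.subset_span ⟨_, ?_, rfl⟩))
      (Submodule.smul_mem _ _ (Submodule.subset_span ⟨_, he.trans (Nat.le_succ d), rfl⟩))
    rw [map_add, Finsupp.degree_single]; omega
  | zero =>
    convert (interpSpan α (d + 1)).zero_mem using 1
    funext j; simp
  | add v w _ _ hv hw =>
    convert Submodule.add_mem _ hv hw using 1
    funext j; simp [mul_add]
  | smul a v _ hv =>
    have := Submodule.smul_mem _ a hv
    convert this using 1
    funext j; simp; ring

lemma prod_sub_mem_interpSpan {ι : Type*} (t : Finset ι) (s : ι → σ) (c : ι → ℚ) :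
    (fun j => ∏ l ∈ t, ((α j (s l) : ℚ) - c l)) ∈ interpSpan α t.card := by
  classical
  induction t using Finset.induction_on with
  | empty =>
    exact Submodule.subset_span ⟨0, by simp, by funext j; simp [multiChoose]⟩
  | insert a t ha ih =>
    rw [Finset.card_insert_of_notMem ha]
    have := Submodule.sub_mem _ (coord_mul_mem_interpSpan α (s a) ih)
      (Submodule.smul_mem _ (c a) (interpSpan_mono α (Nat.le_succ _) ih))
    convert this using 1
    funext j
    simp [Finset.prod_insert ha]; ring

lemma interpSpan_eq_top (hα : Function.Injective α) : interpSpan α (k - 1) = ⊤ := by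
  classical
  rw [eq_top_iff, ← (Pi.basisFun ℚ (Fin k)).span_eq, Submodule.span_le]
  rintro _ ⟨j, rfl⟩
  have hs : ∀ l : Fin k, l ≠ j → ∃ s, α j s ≠ α l s := by
    intro l hl
    by_contra! h
    exact hl (hα (Finsupp.ext fun s => (h s).symm))
  by_cases hσ : Nonempty σ
  swap
  · have : ∀ l, l = j := fun l => by
      by_contra h
      obtain ⟨s, -⟩ := hs l h
      exact hσ ⟨s⟩
    refine Submodule.subset_span ⟨0, by simp, ?_⟩
    funext l
    simp [this l, multiChoose]
  have : Nonempty σ := hσ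
  choose! s hs using hs
  have h1 := prod_sub_mem_interpSpan α (Finset.univ.erase j) s (fun l => (α l (s l) : ℚ))
  rw [Finset.card_erase_of_mem (Finset.mem_univ j), Finset.card_univ, Fintype.card_fin] at h1
  set N : ℚ := ∏ l ∈ Finset.univ.erase j, ((α j (s l) : ℚ) - α l (s l)) with hN
  have hN0 : N ≠ 0 := by
    refine Finset.prod_ne_zero_iff.mpr fun l hl => sub_ne_zero.mpr ?_
    exact_mod_cast hs l (Finset.ne_of_mem_erase hl)
  have h2 : Pi.basisFun ℚ (Fin k) j = N⁻¹ • fun i =>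
      ∏ l ∈ Finset.univ.erase j, ((α i (s l) : ℚ) - α l (s l)) := by
    funext i
    by_cases hij : i = j
    · subst hij
      simp [← hN, hN0]
    · rw [Pi.smul_apply, Finset.prod_eq_zero (i := i) (by simp [hij]) (by simp)]
      simp [hij]
  rw [h2]
  exact Submodule.smul_mem _ _ h1

lemma exists_multiChoose_det_ne_zero (hα : Function.Injective α) :
    ∃ e : Fin k → σ →₀ ℕ, (∀ i, (e i).degree ≤ k - 1) ∧
      (Matrix.of fun i j => (multiChoose (α j) (e i) : ℚ)).det ≠ 0 := by
  obtain ⟨f, hf, -, hli⟩ := Submodule.exists_fun_fin_finrank_span_eq ℚ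
    {v : Fin k → ℚ | ∃ e : σ →₀ ℕ, e.degree ≤ k - 1 ∧ v = fun j => (multiChoose (α j) e : ℚ)}
  have hd : Module.finrank ℚ (interpSpan α (k - 1)) = k := by
    rw [interpSpan_eq_top α hα, finrank_top, Module.finrank_fin_fun]
  choose e he hfe using hf
  let c : Fin k ≃ Fin (Module.finrank ℚ (interpSpan α (k - 1))) := finCongr hd.symm
  refine ⟨fun i => e (c i), fun i => he _, ?_⟩
  have h2 : LinearIndependent ℚ (fun i => f (c i)) := hli.comp _ c.injective
  have h3 : (Matrix.of fun i j => (multiChoose (α j) (e (c i)) : ℚ)) =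
      Matrix.of fun i => f (c i) := by
    ext i j; exact (congrFun (hfe (c i)) j).symm
  rw [h3]
  have h4 := (Matrix.linearIndependent_rows_iff_isUnit (A := Matrix.of fun i => f (c i))).mp h2
  exact ((Matrix.isUnit_iff_isUnit_det _).mp h4).ne_zero

end Interpolation

end SubspaceThm

namespace SubspaceThm

open MvPolynomial

section Hasse

variable {σ R S : Type*} [CommRing R] [CommRing S]

/-- The Taylor expansion `f(x + y)`, as a polynomial in `y` over polynomials in `x`. -/
noncomputable def taylorHom : MvPolynomial σ R →ₐ[R] MvPolynomial σ (MvPolynomial σ R) :=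
  aeval fun s => C (X s) + X s

/-- The Hasse derivative of order `e`. -/
noncomputable def hasse (e : σ →₀ ℕ) (f : MvPolynomial σ R) : MvPolynomial σ R :=
  coeff e (taylorHom f)

/-- The translate `f(x + ξ)`. -/
noncomputable def shift (ξ : σ → R) : MvPolynomial σ R →ₐ[R] MvPolynomial σ R :=
  aeval fun s => X s + C (ξ s)

lemma hasse_add (e : σ →₀ ℕ) (f g : MvPolynomial σ R) :
    hasse e (f + g) = hasse e f + hasse e g := by simp [hasse]

lemma hasse_C_mul (e : σ →₀ ℕ) (a : R) (f : MvPolynomial σ R) :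
    hasse e (C a * f) = C a * hasse e f := by
  have : taylorHom (C a : MvPolynomial σ R) = C (C a) := by
    simp [taylorHom, MvPolynomial.algebraMap_eq, IsScalarTower.algebraMap_apply R (MvPolynomial σ R) (MvPolynomial σ (MvPolynomial σ R))]
  rw [hasse, map_mul, this, coeff_C_mul, hasse]

lemma hasse_sum {ι : Type*} (e : σ →₀ ℕ) (t : Finset ι) (f : ι → MvPolynomial σ R) :
    hasse e (∑ i ∈ t, f i) = ∑ i ∈ t, hasse e (f i) := by
  simp [hasse, coeff_sum]

lemma hasse_shift (e : σ →₀ ℕ) (ξ : σ → R) (f : MvPolynomial σ R) :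
    hasse e (shift ξ f) = shift ξ (hasse e f) := by
  have h : (taylorHom (σ := σ) (R := R)).toRingHom.comp (shift ξ).toRingHom =
      (MvPolynomial.map (shift ξ).toRingHom).comp (taylorHom (σ := σ) (R := R)).toRingHom := by
    refine MvPolynomial.ringHom_ext (fun a => ?_) (fun s => ?_)
    · simp [taylorHom, shift, MvPolynomial.algebraMap_eq, IsScalarTower.algebraMap_apply R (MvPolynomial σ R) (MvPolynomial σ (MvPolynomial σ R))]
    · simp [taylorHom, shift, MvPolynomial.algebraMap_eq, IsScalarTower.algebraMap_apply R (MvPolynomial σ R) (MvPolynomial σ (MvPolynomial σ R))]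
      ring
  have := congrArg (coeff e) (RingHom.congr_fun h f)
  simpa [hasse, coeff_map] using this

lemma hasse_monomial [Fintype σ] (e α : σ →₀ ℕ) (a : R) :
    hasse e (monomial α a) = monomial (α - e) (multiChoose α e * a) := by
  classical
  have h1 : taylorHom (monomial α a) = C (C a) * ∏ s, (C (X s) + X s) ^ α s := by
    rw [taylorHom, aeval_monomial, Finsupp.prod_fintype _ _ (fun _ => pow_zero _)]
    simp [MvPolynomial.algebraMap_eq, IsScalarTower.algebraMap_apply R (MvPolynomial σ R) (MvPolynomial σ (MvPolynomial σ R))]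
  have h2 : ∀ s : σ, (C (X s) + X s : MvPolynomial σ (MvPolynomial σ R)) ^ α s =
      ∑ j ∈ Finset.range (α s + 1), monomial (Finsupp.single s j)
        ((X s) ^ (α s - j) * ((α s).choose j : MvPolynomial σ R)) := by
    intro s
    rw [add_comm, add_pow]
    refine Finset.sum_congr rfl fun j _ => ?_
    rw [← C_mul_X_pow_eq_monomial, C_mul, C_pow, map_natCast]; ring
  rw [hasse, h1, coeff_C_mul, Finset.prod_congr rfl fun s _ => h2 s, Finset.prod_univ_sum, coeff_sum]
  have h3 : ∀ p : σ → ℕ, coeff e (∏ s, monomial (Finsupp.single s (p s))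
        ((X s) ^ (α s - p s) * ((α s).choose (p s) : MvPolynomial σ R))) =
      if p = e then ∏ s, ((X s) ^ (α s - p s) * ((α s).choose (p s) : MvPolynomial σ R))
        else 0 := by
    intro p
    rw [← monomial_sum_prod, coeff_monomial]
    refine if_congr ?_ rfl rfl
    rw [show p = ⇑(Finsupp.equivFunOnFinite.symm p) from rfl, Finsupp.univ_sum_single,
      DFunLike.coe_fn_eq]
  rw [Finset.sum_congr rfl fun p _ => h3 p]
  have h4 : (monomial (α - e) ((multiChoose α e : R) * a) : MvPolynomial σ R) =
      C a * ∏ s, ((X s) ^ (α s - e s) * ((α s).choose (e s) : MvPolynomial σ R)) := by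
    rw [Finset.prod_mul_distrib, multiChoose, monomial_eq,
      Finsupp.prod_fintype _ _ (fun _ => pow_zero _), C_mul, map_natCast]
    push_cast
    simp only [Pi.sub_apply]
    ring
  rw [h4, Finset.sum_ite_eq' (Fintype.piFinset _) (⇑e)]
  split_ifs with h
  · rfl
  · have : ∃ s, α s < e s := by
      by_contra! h'
      exact h (Fintype.mem_piFinset.mpr fun s => Finset.mem_range.mpr (Nat.lt_succ_of_le (h' s)))
    obtain ⟨s, hs⟩ := this
    rw [Finset.prod_eq_zero (Finset.mem_univ s) (by simp [Nat.choose_eq_zero_of_lt hs])]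

variable [Fintype σ]

lemma multiChoose_eq_zero {α e : σ →₀ ℕ} (h : ¬ e ≤ α) : multiChoose α e = 0 := by
  obtain ⟨s, hs⟩ : ∃ s, α s < e s := by
    by_contra! h'
    exact h h'
  exact Finset.prod_eq_zero (Finset.mem_univ s) (Nat.choose_eq_zero_of_lt hs)

lemma coeff_hasse (e β : σ →₀ ℕ) (f : MvPolynomial σ R) :
    coeff β (hasse e f) = multiChoose (β + e) e * coeff (β + e) f := by
  classical
  induction f using MvPolynomial.induction_on' with
  | monomial α a =>
    rw [hasse_monomial, coeff_monomial, coeff_monomial]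
    by_cases he : e ≤ α
    · by_cases hβ : α = β + e
      · rw [if_pos hβ, if_pos (by rw [hβ, add_tsub_cancel_right]), hβ]
      · rw [if_neg hβ, if_neg (fun h => hβ (by rw [← h, tsub_add_cancel_of_le he])), mul_zero]
    · rw [if_neg (fun h : α = β + e => he (h.symm ▸ le_add_self)), mul_zero, multiChoose_eq_zero he]
      simp
  | add f g hf hg => rw [hasse_add, coeff_add, hf, hg, coeff_add]; ring

lemma hasse_map (φ : R →+* S) (e : σ →₀ ℕ) (f : MvPolynomial σ R) :
    hasse e (map φ f) = map φ (hasse e f) := by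
  ext β
  simp [coeff_hasse, coeff_map]

lemma degreeOf_hasse_le (e : σ →₀ ℕ) (f : MvPolynomial σ R) (s : σ) :
    degreeOf s (hasse e f) ≤ degreeOf s f := by
  rw [degreeOf_le_iff]
  intro β hβ
  rw [mem_support_iff, coeff_hasse] at hβ
  have h : β + e ∈ f.support := mem_support_iff.mpr (right_ne_zero_of_mul hβ)
  have := degreeOf_le_iff.mp (le_refl (degreeOf s f)) _ h
  exact le_trans (by simp) this

lemma multiChoose_le (α e : σ →₀ ℕ) {r : σ → ℕ} (h : ∀ s, α s ≤ r s) :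
    multiChoose α e ≤ 2 ^ ∑ s, r s := by
  rw [multiChoose, ← Finset.prod_pow_eq_pow_sum]
  exact Finset.prod_le_prod' fun s _ => (Nat.choose_le_two_pow _ _).trans
    (Nat.pow_le_pow_right two_pos (h s))

lemma lOne_hasse_le (e : σ →₀ ℕ) (f : MvPolynomial σ ℤ) {r : σ → ℕ}
    (h : ∀ s, degreeOf s f ≤ r s) :
    lOne intAbs (hasse e f) ≤ 2 ^ (∑ s, r s) * lOne intAbs f := by
  classical
  have h1 : (hasse e f).support ⊆ f.support.preimage (· + e) (add_left_injective e).injOn := by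
    intro β hβ
    rw [mem_support_iff, coeff_hasse] at hβ
    exact Finset.mem_preimage.mpr (mem_support_iff.mpr (right_ne_zero_of_mul hβ))
  rw [lOne_eq_sum _ h1]
  have h2 : ∀ β ∈ f.support.preimage (· + e) (add_left_injective e).injOn,
      intAbs (coeff β (hasse e f)) ≤ 2 ^ (∑ s, r s) * intAbs (coeff (β + e) f) := by
    intro β hβ
    have hβ' : β + e ∈ f.support := Finset.mem_preimage (f := (· + e)).mp hβ
    rw [coeff_hasse, intAbs_apply, intAbs_apply]
    push_cast
    rw [abs_mul, Nat.abs_cast]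
    refine mul_le_mul_of_nonneg_right ?_ (abs_nonneg _)
    exact_mod_cast multiChoose_le (β + e) e fun s =>
      (degreeOf_le_iff.mp (le_refl (degreeOf s f)) _ hβ').trans (h s)
  refine (Finset.sum_le_sum h2).trans ?_
  rw [← Finset.mul_sum, lOne]
  refine mul_le_mul_of_nonneg_left ?_ (by positivity)
  calc _ = ∑ γ ∈ (f.support.preimage (· + e) (add_left_injective e).injOn).image (· + e),
        intAbs (coeff γ f) := (Finset.sum_image (add_left_injective e).injOn).symm
    _ ≤ _ := Finset.sum_le_sum_of_subset_of_nonneg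
      (Finset.image_subset_iff.mpr fun β hβ => Finset.mem_preimage (f := (· + e)).mp hβ)
      fun _ _ _ => apply_nonneg _ _

end Hasse
end SubspaceThm

namespace SubspaceThm

open MvPolynomial

section Wronskian

variable {σ : Type*}

lemma coeff_sum_prod_of_degree_le (m : MonomialOrder σ) {R ι : Type*} [CommRing R]
    (s : Finset ι) (f : ι → MvPolynomial σ R) (α : ι → σ →₀ ℕ)
    (h : ∀ i, m.toSyn (m.degree (f i)) ≤ m.toSyn (α i)) :
    m.toSyn (m.degree (∏ i ∈ s, f i)) ≤ m.toSyn (∑ i ∈ s, α i) ∧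
      coeff (∑ i ∈ s, α i) (∏ i ∈ s, f i) = ∏ i ∈ s, coeff (α i) (f i) := by
  classical
  induction s using Finset.induction_on with
  | empty => simp
  | insert a s ha ih =>
    rw [Finset.prod_insert ha, Finset.sum_insert ha, Finset.prod_insert ha]
    refine ⟨m.degree_mul_le.trans ?_, ?_⟩
    · rw [map_add, map_add]; exact add_le_add (h a) ih.1
    · rw [m.coeff_mul_of_add_of_degree_le (h a) ih.1, ih.2]

lemma exists_injective_degree (m : MonomialOrder σ) {k : ℕ} {φ : Fin k → MvPolynomial σ ℚ}
    (hφ : LinearIndependent ℚ φ) :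
    ∃ v : Fin k → MvPolynomial σ ℚ, (∀ j, v j ∈ Submodule.span ℚ (Set.range φ)) ∧
      (∀ j, v j ≠ 0) ∧ Function.Injective fun j => m.degree (v j) := by
  classical
  set V := Submodule.span ℚ (Set.range φ) with hV
  let D : Set (σ →₀ ℕ) := {α | ∃ v ∈ V, v ≠ 0 ∧ m.degree v = α}
  have hsupp : ∀ v ∈ V, v.support ⊆ Finset.univ.biUnion fun j => (φ j).support := by
    intro v hv
    induction hv using Submodule.span_induction with
    | mem v hv =>
      obtain ⟨j, rfl⟩ := hv
      exact Finset.subset_biUnion_of_mem (fun j => (φ j).support) (Finset.mem_univ j)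
    | zero => simp
    | add v w _ _ h1 h2 => exact support_add.trans (Finset.union_subset h1 h2)
    | smul a v _ h => exact support_smul.trans h
  have hD : D.Finite := by
    refine (Finset.univ.biUnion fun j => (φ j).support).finite_toSet.subset ?_
    rintro _ ⟨v, hv, h0, rfl⟩
    exact hsupp v hv ((m.degree_mem_support_iff v).mpr h0)
  have : Fintype D := hD.fintype
  let T : V →ₗ[ℚ] (D → ℚ) := LinearMap.pi fun α => (lcoeff ℚ (α : σ →₀ ℕ)).comp V.subtype
  have hT : Function.Injective T := by
    rw [← LinearMap.ker_eq_bot, LinearMap.ker_eq_bot']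
    intro v hv
    by_contra h0
    have h0' : (v : MvPolynomial σ ℚ) ≠ 0 := by simpa using h0
    have := congrFun hv ⟨m.degree v.1, ⟨v.1, v.2, h0', rfl⟩⟩
    exact m.coeff_degree_ne_zero_iff.mpr h0' this
  have hk : k ≤ Fintype.card D := by
    have h1 := LinearMap.finrank_le_finrank_of_injective hT
    rw [Module.finrank_fintype_fun_eq_card, finrank_span_eq_card hφ, Fintype.card_fin] at h1
    exact h1
  obtain ⟨ι⟩ : Nonempty (Fin k ↪ D) := Function.Embedding.nonempty_of_card_le (by simpa using hk)
  choose v hv h0 hd using fun j => (ι j).2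
  refine ⟨v, hv, h0, fun i j hij => ι.injective (Subtype.ext ?_)⟩
  rw [← hd i, ← hd j]; exact hij

lemma exists_wronskian_ne_zero [Fintype σ] (m : MonomialOrder σ) {k : ℕ} {φ : Fin k → MvPolynomial σ ℚ}
    (hφ : LinearIndependent ℚ φ) :
    ∃ e : Fin k → σ →₀ ℕ, (∀ i, (e i).degree ≤ k - 1) ∧
      (Matrix.of fun i j => hasse (e i) (φ j)).det ≠ 0 := by
  classical
  obtain ⟨v, hv, h0, hinj⟩ := exists_injective_degree m hφ
  obtain ⟨e, he, hdet⟩ := exists_multiChoose_det_ne_zero _ hinj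
  refine ⟨e, he, fun hφ0 => ?_⟩
  choose B hB using fun j => (Submodule.mem_span_range_iff_exists_fun ℚ).mp (hv j)
  have hM : (Matrix.of fun i j => hasse (e i) (v j)) =
      (Matrix.of fun i j => hasse (e i) (φ j)) * Matrix.of fun l j => C (B j l) := by
    ext1 i j
    simp only [Matrix.of_apply, Matrix.mul_apply]
    rw [← hB j, hasse_sum]
    refine Finset.sum_congr rfl fun l _ => ?_
    rw [smul_eq_C_mul, hasse_C_mul, mul_comm]
  have hM0 : (Matrix.of fun i j => hasse (e i) (v j)).det = 0 := by
    rw [hM, Matrix.det_mul, hφ0, zero_mul]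
  have hN0 : (Matrix.of fun i j => monomial (e i) (1 : ℚ) * hasse (e i) (v j)).det = 0 := by
    have := Matrix.det_mul_column (fun i => monomial (e i) (1 : ℚ))
      (Matrix.of fun i j => hasse (e i) (v j))
    rw [hM0, mul_zero] at this
    exact this
  have hco : ∀ i j γ, coeff γ (monomial (e i) (1 : ℚ) * hasse (e i) (v j)) =
      multiChoose γ (e i) * coeff γ (v j) := by
    intro i j γ
    rw [coeff_monomial_mul', one_mul]
    split_ifs with h
    · rw [coeff_hasse, tsub_add_cancel_of_le h]
    · rw [multiChoose_eq_zero h]; simp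
  have hdeg : ∀ i j, m.toSyn (m.degree (monomial (e i) (1 : ℚ) * hasse (e i) (v j))) ≤
      m.toSyn (m.degree (v j)) := by
    intro i j
    rw [m.degree_le_iff]
    intro γ hγ
    rw [mem_support_iff, hco] at hγ
    exact m.le_degree (mem_support_iff.mpr (right_ne_zero_of_mul hγ))
  have hc := congrArg (coeff (∑ j, m.degree (v j))) hN0
  rw [Matrix.det_apply, coeff_sum, coeff_zero] at hc
  have h1 : ∀ π : Equiv.Perm (Fin k), coeff (∑ j, m.degree (v j))
      (Equiv.Perm.sign π • ∏ j, Matrix.of (fun i j => monomial (e i) (1 : ℚ) * hasse (e i) (v j))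
        (π j) j) =
      (∏ j, m.leadingCoeff (v j)) * (Equiv.Perm.sign π • ∏ j,
        Matrix.of (fun i j => (multiChoose (m.degree (v j)) (e i) : ℚ)) (π j) j) := by
    intro π
    simp only [Matrix.of_apply]
    rw [Units.smul_def, Units.smul_def, coeff_smul,
      (coeff_sum_prod_of_degree_le m Finset.univ _ _ fun j => hdeg (π j) j).2,
      mul_smul_comm, ← Finset.prod_mul_distrib]
    congr 1
    refine Finset.prod_congr rfl fun j _ => ?_
    rw [hco, mul_comm]; rfl
  rw [Finset.sum_congr rfl fun π _ => h1 π, ← Finset.mul_sum, ← Matrix.det_apply] at hc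
  refine hdet ((mul_eq_zero.mp hc).resolve_left (Finset.prod_ne_zero_iff.mpr fun j _ => ?_))
  exact m.leadingCoeff_ne_zero_iff.mpr (h0 j)

end Wronskian
end SubspaceThm

namespace SubspaceThm

open MvPolynomial

section Split

variable {R : Type*} [CommRing R] {M : ℕ}

/-- Polynomials in the variables of index at least one. -/
noncomputable abbrev inSucc : MvPolynomial (Fin M) R →ₐ[R] MvPolynomial (Fin (M + 1)) R :=
  rename Fin.succ

/-- Polynomials in the variable of index zero. -/
noncomputable abbrev inZero : MvPolynomial (Fin 1) R →ₐ[R] MvPolynomial (Fin (M + 1)) R :=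
  rename fun _ => 0

lemma coeff_inSucc_mul_inZero (A : MvPolynomial (Fin M) R) (B : MvPolynomial (Fin 1) R)
    (γ : Fin (M + 1) →₀ ℕ) :
    coeff γ (inSucc A * inZero B) = coeff γ.tail A * coeff (Finsupp.single 0 (γ 0)) B := by
  have hA : finSuccEquiv R M (inSucc A) = Polynomial.C A := by
    have : (finSuccEquiv R M).toAlgHom.comp inSucc =
        IsScalarTower.toAlgHom R (MvPolynomial (Fin M) R) (Polynomial (MvPolynomial (Fin M) R)) :=
      MvPolynomial.algHom_ext fun s => by simp [finSuccEquiv_X_succ]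
    exact AlgHom.congr_fun this A
  have hB : finSuccEquiv R M (inZero B) = (uniqueAlgEquiv R (Fin 1) B).map C := by
    have : (finSuccEquiv R M).toAlgHom.toRingHom.comp inZero.toRingHom =
        (Polynomial.mapRingHom C).comp (uniqueAlgEquiv R (Fin 1)).toAlgHom.toRingHom :=
      MvPolynomial.ringHom_ext (fun a => by
          simp [uniqueAlgEquiv, finSuccEquiv_apply])
        fun s => by simp [finSuccEquiv_X_zero, uniqueAlgEquiv]
    exact RingHom.congr_fun this B
  rw [← Finsupp.cons_tail γ, ← finSuccEquiv_coeff_coeff, map_mul, hA, hB,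
    Polynomial.coeff_C_mul, Polynomial.coeff_map, mul_comm, coeff_C_mul, coeff_uniqueAlgEquiv,
    mul_comm, Finsupp.tail_cons, Finsupp.cons_zero]
  rfl

lemma hasse_inSucc_mul_inZero (A : MvPolynomial (Fin M) R) (B : MvPolynomial (Fin 1) R)
    (e : Fin (M + 1) →₀ ℕ) :
    hasse e (inSucc A * inZero B) =
      inSucc (hasse e.tail A) * inZero (hasse (Finsupp.single 0 (e 0)) B) := by
  ext γ
  rw [coeff_hasse, coeff_inSucc_mul_inZero, coeff_inSucc_mul_inZero, coeff_hasse, coeff_hasse]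
  have h : multiChoose (γ + e) e = multiChoose (γ.tail + e.tail) e.tail *
      multiChoose (Finsupp.single 0 (γ 0) + Finsupp.single 0 (e 0) : Fin 1 →₀ ℕ)
        (Finsupp.single 0 (e 0)) := by
    simp [multiChoose, Fin.prod_univ_succ, Finsupp.tail_apply, mul_comm]
  rw [h, ← Finsupp.single_add]
  have h2 : (γ + e).tail = γ.tail + e.tail := by ext; simp [Finsupp.tail_apply]
  rw [h2, Finsupp.add_apply]
  push_cast
  ring

lemma shift_inSucc (ξ : Fin (M + 1) → R) (A : MvPolynomial (Fin M) R) :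
    shift ξ (inSucc A) = inSucc (shift (fun h => ξ h.succ) A) := by
  have : (shift ξ).comp inSucc = inSucc.comp (shift fun h => ξ h.succ) :=
    MvPolynomial.algHom_ext fun s => by simp [shift]
  exact AlgHom.congr_fun this A

lemma shift_inZero (ξ : Fin (M + 1) → R) (B : MvPolynomial (Fin 1) R) :
    shift ξ (inZero B : MvPolynomial (Fin (M + 1)) R) = inZero (shift (fun _ => ξ 0) B) := by
  have : (shift ξ).comp (inZero (M := M)) = inZero.comp (shift fun _ => ξ 0) :=
    MvPolynomial.algHom_ext fun s => by simp [shift]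
  exact AlgHom.congr_fun this B

end Split

lemma exists_order_of_one_variable (f : MvPolynomial (Fin 1) ℤ) (hf : f ≠ 0) {a b : ℤ}
    (ha : 0 < a) (hab : IsCoprime a b) :
    ∃ t : ℕ, (a : ℝ) ^ t ≤ lOne intAbs f ∧
      coeff (Finsupp.single 0 t) (shift (fun _ => -(b / a : ℚ))
        (map (Int.castRingHom ℚ) f)) ≠ 0 := by
  set g := uniqueAlgEquiv ℤ (Fin 1) f with hg
  have hg0 : g ≠ 0 := (map_ne_zero_iff _ (uniqueAlgEquiv ℤ (Fin 1)).injective).mpr hf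
  set G := g.map (Int.castRingHom ℚ) with hG
  have hG0 : G ≠ 0 := (Polynomial.map_ne_zero_iff (Int.castRingHom ℚ).injective_int).mpr hg0
  set ξ : ℚ := -(b / a) with hξ
  have haQ : (a : ℚ) ≠ 0 := by exact_mod_cast ha.ne'
  obtain ⟨q, hq, hnd⟩ := Polynomial.exists_eq_pow_rootMultiplicity_mul_and_not_dvd G hG0 ξ
  generalize G.rootMultiplicity ξ = t at hq
  refine ⟨t, ?_, ?_⟩
  · let l : Polynomial ℤ := Polynomial.C a * Polynomial.X + Polynomial.C b
    have hl : l.IsPrimitive := by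
      intro c hc
      rw [Polynomial.C_dvd_iff_dvd_coeff] at hc
      have h0 := hc 0
      have h1 := hc 1
      simp only [l, Polynomial.coeff_add, Polynomial.coeff_C_mul, Polynomial.coeff_X_zero,
        Polynomial.coeff_X_one, Polynomial.coeff_C_zero, mul_zero, mul_one, zero_add,
        Polynomial.coeff_C_of_ne_zero one_ne_zero, add_zero] at h0 h1
      exact hab.isUnit_of_dvd' h1 h0
    have hlm : l.map (Int.castRingHom ℚ) = Polynomial.C (a : ℚ) * (Polynomial.X - Polynomial.C ξ) := by
      simp only [l, hξ, Polynomial.map_add, Polynomial.map_mul, Polynomial.map_C,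
        Polynomial.map_X, mul_sub, ← Polynomial.C_mul, Int.coe_castRingHom]
      rw [show (a : ℚ) * -(b / a) = -b by field_simp, Polynomial.C_neg, sub_neg_eq_add]
    have hlt : (l ^ t).IsPrimitive := by
      clear hq
      induction t with
      | zero => rw [pow_zero]; exact Polynomial.isPrimitive_one
      | succ t ih => rw [pow_succ]; exact ih.mul hl
    have hdvd : l ^ t ∣ g := by
      rw [Polynomial.IsPrimitive.Int.dvd_iff_map_cast_dvd_map_cast _ _ hlt, Polynomial.map_pow, hlm, mul_pow,
        ← Polynomial.C_pow]
      refine (Polynomial.isUnit_C.mpr (pow_ne_zero t haQ).isUnit).mul_left_dvd.mpr ?_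
      exact ⟨q, hq⟩
    have hlc : a ^ t ∣ g.leadingCoeff := by
      have := Polynomial.leadingCoeff_dvd_leadingCoeff hdvd
      rwa [Polynomial.leadingCoeff_pow, Polynomial.leadingCoeff_linear ha.ne'] at this
    have h1 : a ^ t ≤ |g.leadingCoeff| := Int.le_of_dvd
      (abs_pos.mpr (Polynomial.leadingCoeff_ne_zero.mpr hg0)) ((dvd_abs _ _).mpr hlc)
    have h2 : ((a : ℝ)) ^ t ≤ |(g.leadingCoeff : ℝ)| := by exact_mod_cast h1
    refine h2.trans ?_
    rw [Polynomial.leadingCoeff, hg, coeff_uniqueAlgEquiv, ← intAbs_apply]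
    exact coeff_le_lOne _ _ _
  · have h1 : uniqueAlgEquiv ℚ (Fin 1) (shift (fun _ => ξ) (map (Int.castRingHom ℚ) f)) =
        G.comp (Polynomial.X + Polynomial.C ξ) := by
      have : (uniqueAlgEquiv ℚ (Fin 1)).toAlgHom.toRingHom.comp ((shift (fun _ : Fin 1 => ξ)).toRingHom.comp
          (map (Int.castRingHom ℚ))) = (Polynomial.compRingHom (Polynomial.X + Polynomial.C ξ)).comp
          ((Polynomial.mapRingHom (Int.castRingHom ℚ)).comp (uniqueAlgEquiv ℤ (Fin 1)).toAlgHom.toRingHom) :=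
        MvPolynomial.ringHom_ext (fun a => by simp [uniqueAlgEquiv])
          fun s => by simp [uniqueAlgEquiv, shift]
      exact RingHom.congr_fun this f
    have h2 := coeff_uniqueAlgEquiv (R := ℚ) (shift (fun _ : Fin 1 => ξ) (map (Int.castRingHom ℚ) f)) t
    rw [h1, hq] at h2
    rw [show (0 : Fin 1) = default from rfl, ← h2, Polynomial.mul_comp, Polynomial.pow_comp]
    simp only [Polynomial.sub_comp, Polynomial.X_comp, Polynomial.C_comp, add_sub_cancel_right]
    rw [Polynomial.coeff_X_pow_mul', if_pos le_rfl, Nat.sub_self, Polynomial.coeff_zero_eq_eval_zero,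
      Polynomial.eval_comp]
    simp only [Polynomial.eval_add, Polynomial.eval_X, Polynomial.eval_C, zero_add]
    rwa [Polynomial.dvd_iff_isRoot] at hnd

end SubspaceThm

namespace SubspaceThm

open MvPolynomial

lemma exists_separated_sum {M r : ℕ} (P : MvPolynomial (Fin (M + 1)) ℚ) (hP : P ≠ 0)
    (hr : degreeOf 0 P ≤ r) :
    ∃ (k : ℕ) (φ : Fin k → MvPolynomial (Fin M) ℚ) (ψ : Fin k → MvPolynomial (Fin 1) ℚ),
      0 < k ∧ k ≤ r + 1 ∧ LinearIndependent ℚ φ ∧ LinearIndependent ℚ ψ ∧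
      P = ∑ j, inSucc (φ j) * inZero (ψ j) := by
  classical
  let c : Fin (r + 1) → MvPolynomial (Fin M) ℚ := fun t => (finSuccEquiv ℚ M P).coeff t
  let V := Submodule.span ℚ (Set.range c)
  have hcV : ∀ t, c t ∈ V := fun t => Submodule.subset_span ⟨t, rfl⟩
  have : Module.Finite ℚ V := Module.Finite.span_of_finite ℚ (Set.finite_range c)
  let β := Module.finBasis ℚ V
  let B : Fin (r + 1) → Fin (Module.finrank ℚ V) → ℚ := fun t j => β.repr ⟨c t, hcV t⟩ j
  have hcB : ∀ t, c t = ∑ j, B t j • (β j : MvPolynomial (Fin M) ℚ) := by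
    intro t
    have := congrArg Subtype.val (β.sum_repr ⟨c t, hcV t⟩)
    rw [Submodule.coe_sum] at this
    exact this.symm
  let ψ : Fin (Module.finrank ℚ V) → MvPolynomial (Fin 1) ℚ :=
    fun j => ∑ t : Fin (r + 1), monomial (Finsupp.single 0 (t : ℕ)) (B t j)
  have hψ : ∀ j (t : Fin (r + 1)), coeff (Finsupp.single 0 (t : ℕ)) (ψ j) = B t j := by
    intro j t
    simp only [ψ, coeff_sum, coeff_monomial]
    rw [Finset.sum_eq_single t]
    · simp
    · intro u _ hu
      rw [if_neg]
      intro h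
      exact hu (Fin.ext (by simpa using h))
    · simp
  have hψ' : ∀ j (t : ℕ), r < t → coeff (Finsupp.single 0 t) (ψ j) = 0 := by
    intro j t ht
    simp only [ψ, coeff_sum, coeff_monomial]
    refine Finset.sum_eq_zero fun u _ => if_neg fun h => ?_
    have : (u : ℕ) = t := by simpa using h
    omega
  have hsum : P = ∑ j, inSucc (β j : MvPolynomial (Fin M) ℚ) * inZero (ψ j) := by
    ext γ
    rw [coeff_sum]
    simp_rw [coeff_inSucc_mul_inZero]
    rcases le_or_gt (γ 0) r with h | h
    · have h1 : coeff γ P = coeff γ.tail (c ⟨γ 0, Nat.lt_succ_of_le h⟩) := by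
        simp only [c]
        rw [finSuccEquiv_coeff_coeff, Finsupp.cons_tail]
      rw [h1, hcB, coeff_sum]
      refine Finset.sum_congr rfl fun j _ => ?_
      rw [coeff_smul, ← hψ, smul_eq_mul, mul_comm]
    · rw [Finset.sum_eq_zero fun j _ => by rw [hψ' j _ h, mul_zero]]
      by_contra h0
      have := degreeOf_le_iff.mp hr γ (mem_support_iff.mpr h0)
      omega
  refine ⟨Module.finrank ℚ V, fun j => (β j : MvPolynomial (Fin M) ℚ), ψ, ?_, ?_, ?_, ?_, hsum⟩
  · refine Nat.pos_of_ne_zero fun h => hP ?_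
    rw [hsum]
    refine Finset.sum_eq_zero fun j _ => ?_
    have := j.2
    omega
  · exact (finrank_range_le_card (R := ℚ) c).trans_eq (Fintype.card_fin _)
  · exact β.linearIndependent.map' V.subtype (Submodule.ker_subtype V)
  · rw [Fintype.linearIndependent_iff]
    intro d hd
    let D : V →ₗ[ℚ] ℚ := ∑ j, d j • β.coord j
    have hDc : ∀ t, D ⟨c t, hcV t⟩ = 0 := by
      intro t
      have := congrArg (coeff (Finsupp.single 0 (t : ℕ))) hd
      rw [coeff_sum, coeff_zero] at this
      simp_rw [coeff_smul, hψ] at this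
      simpa [D, B] using this
    have hD : ∀ v (hv : v ∈ V), D ⟨v, hv⟩ = 0 := by
      intro v hv
      induction hv using Submodule.span_induction with
      | mem v hv => obtain ⟨t, rfl⟩ := hv; exact hDc t
      | zero => exact map_zero D
      | add v w hv hw h1 h2 =>
        have := map_add D ⟨v, hv⟩ ⟨w, hw⟩
        rw [h1, h2, add_zero] at this; exact this
      | smul a v hv h =>
        have := map_smul D a ⟨v, hv⟩
        rw [h, smul_zero] at this; exact this
    intro j
    have := hD _ (β j).2
    simpa [D, Finsupp.single_apply] using this

section Index

variable {σ R : Type*} [Fintype σ] [CommRing R]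

/-- Every monomial of `f` has weight at least `θ`. -/
def IndexGE (w : σ → ℝ) (θ : ℝ) (f : MvPolynomial σ R) : Prop :=
  ∀ e, coeff e f ≠ 0 → θ ≤ ∑ s, w s * e s

lemma IndexGE.mono {w : σ → ℝ} {θ θ' : ℝ} {f : MvPolynomial σ R} (h : IndexGE w θ f)
    (hθ : θ' ≤ θ) : IndexGE w θ' f := fun e he => hθ.trans (h e he)

lemma indexGE_zero_of_nonneg {w : σ → ℝ} (hw : ∀ s, 0 ≤ w s) (f : MvPolynomial σ R) :
    IndexGE w 0 f :=
  fun _ _ => Finset.sum_nonneg fun s _ => mul_nonneg (hw s) (Nat.cast_nonneg _)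

lemma IndexGE.sum {w : σ → ℝ} {θ : ℝ} {ι : Type*} (t : Finset ι) {f : ι → MvPolynomial σ R}
    (h : ∀ i ∈ t, IndexGE w θ (f i)) : IndexGE w θ (∑ i ∈ t, f i) := by
  intro e he
  rw [coeff_sum] at he
  obtain ⟨i, hi, h0⟩ := Finset.exists_ne_zero_of_sum_ne_zero he
  exact h i hi e h0

lemma IndexGE.mul {w : σ → ℝ} {θ θ' : ℝ} {f g : MvPolynomial σ R} (hf : IndexGE w θ f)
    (hg : IndexGE w θ' g) : IndexGE w (θ + θ') (f * g) := by
  classical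
  intro e he
  rw [coeff_mul] at he
  obtain ⟨⟨a, b⟩, hi, h0⟩ := Finset.exists_ne_zero_of_sum_ne_zero he
  have h1 := hf a (left_ne_zero_of_mul h0)
  have h2 := hg b (right_ne_zero_of_mul h0)
  rw [← Finset.HasAntidiagonal.mem_antidiagonal.mp hi]
  simp only [Finsupp.add_apply, Nat.cast_add, mul_add, Finset.sum_add_distrib]
  exact add_le_add h1 h2

lemma IndexGE.prod {w : σ → ℝ} {ι : Type*} (t : Finset ι) {θ : ι → ℝ}
    {f : ι → MvPolynomial σ R} (h : ∀ i, IndexGE w (θ i) (f i)) :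
    IndexGE w (∑ i ∈ t, θ i) (∏ i ∈ t, f i) := by
  classical
  induction t using Finset.induction_on with
  | empty =>
    intro e he
    rw [Finset.prod_empty, coeff_one] at he
    have : e = 0 := by by_contra h; exact he (if_neg (Ne.symm h))
    simp [this]
  | insert a t ha ih =>
    rw [Finset.prod_insert ha, Finset.sum_insert ha]
    exact (h a).mul ih

lemma IndexGE.det {w : σ → ℝ} {k : ℕ} {θ : Fin k → ℝ} {A : Matrix (Fin k) (Fin k) (MvPolynomial σ R)}
    (h : ∀ i j, IndexGE w (θ j) (A i j)) : IndexGE w (∑ j, θ j) A.det := by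
  rw [Matrix.det_apply]
  refine IndexGE.sum _ fun π _ => ?_
  intro e he
  refine IndexGE.prod Finset.univ (fun j => h (π j) j) e fun h0 => he ?_
  rw [Units.smul_def, coeff_smul, h0, smul_zero]

lemma IndexGE.hasse {w : σ → ℝ} {θ : ℝ} {f : MvPolynomial σ R} (h : IndexGE w θ f) (e : σ →₀ ℕ) :
    IndexGE w (θ - ∑ s, w s * e s) (hasse e f) := by
  intro β hβ
  rw [coeff_hasse] at hβ
  have := h _ (right_ne_zero_of_mul hβ)
  simp only [Finsupp.add_apply, Nat.cast_add, mul_add, Finset.sum_add_distrib] at this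
  linarith

end Index

end SubspaceThm

namespace SubspaceThm

open MvPolynomial

section Extract

variable {σ τ R : Type*} [CommRing R]

/-- The polynomial whose coefficient at `α` is the coefficient of `f` at `j α`. -/
noncomputable def extract (j : (τ →₀ ℕ) ↪ (σ →₀ ℕ)) (f : MvPolynomial σ R) : MvPolynomial τ R :=
  ∑ α ∈ f.support.preimage j j.injective.injOn, monomial α (coeff (j α) f)

lemma coeff_extract (j : (τ →₀ ℕ) ↪ (σ →₀ ℕ)) (f : MvPolynomial σ R) (α : τ →₀ ℕ) :
    coeff α (extract j f) = coeff (j α) f := by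
  classical
  rw [extract, coeff_sum]
  simp_rw [coeff_monomial]
  rw [Finset.sum_ite_eq']
  split_ifs with h
  · rfl
  · by_contra h0
    exact h (Finset.mem_preimage.mpr (mem_support_iff.mpr (Ne.symm h0)))

lemma lOne_extract_le (ν : RingSeminorm R) (j : (τ →₀ ℕ) ↪ (σ →₀ ℕ)) (f : MvPolynomial σ R) :
    lOne ν (extract j f) ≤ lOne ν f := by
  classical
  rw [extract]
  refine (lOne_sum_le ν _ _).trans ?_
  simp_rw [lOne_monomial]
  calc _ = ∑ γ ∈ (f.support.preimage j j.injective.injOn).image j, ν (coeff γ f) :=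
        (Finset.sum_image j.injective.injOn).symm
    _ ≤ _ := Finset.sum_le_sum_of_subset_of_nonneg
      (Finset.image_subset_iff.mpr fun β hβ => Finset.mem_preimage.mp hβ)
      fun _ _ _ => apply_nonneg _ _

end Extract

lemma le_sum_max_sub {k r : ℕ} (hr : 0 < r) (hk : k ≤ r + 1) {θ : ℝ} (h0 : 0 < θ) (h1 : θ ≤ 1) :
    (k : ℝ) * θ ^ 2 / 8 ≤ ∑ l : Fin k, max 0 (θ - (l : ℕ) / r) := by
  rw [Fin.sum_univ_eq_sum_range (fun l : ℕ => max 0 (θ - (l : ℝ) / r))]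
  have hr' : (0 : ℝ) < r := by exact_mod_cast hr
  set n := min k ⌈θ * r / 2⌉₊ with hn
  have h2 : (k : ℝ) * θ / 4 ≤ n := by
    have hk' : (k : ℝ) ≤ 2 * r := by
      have : k ≤ 2 * r := by omega
      exact_mod_cast this
    rw [hn, Nat.cast_min]
    refine le_min ?_ ((?_ : _ ≤ θ * r / 2).trans (Nat.le_ceil _))
    · have : (0 : ℝ) ≤ k := Nat.cast_nonneg k
      nlinarith
    · nlinarith
  calc (k : ℝ) * θ ^ 2 / 8 ≤ n * (θ / 2) := by nlinarith
    _ = ∑ l ∈ Finset.range n, θ / 2 := by simp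
    _ ≤ ∑ l ∈ Finset.range n, max 0 (θ - (l : ℝ) / r) := by
      refine Finset.sum_le_sum fun l hl => le_max_of_le_right ?_
      have hl' : l < ⌈θ * r / 2⌉₊ := (Finset.mem_range.mp hl).trans_le (min_le_right _ _)
      have : (l : ℝ) < θ * r / 2 := Nat.lt_ceil.mp hl'
      have : (l : ℝ) / r ≤ θ / 2 := by rw [div_le_iff₀ hr']; linarith
      linarith
    _ ≤ _ := Finset.sum_le_sum_of_subset_of_nonneg
      (Finset.range_mono (min_le_left _ _)) fun _ _ _ => le_max_left _ _

lemma lOne_det_le {σ : Type*} {k : ℕ} (A : Matrix (Fin k) (Fin k) (MvPolynomial σ ℤ)) {B : ℝ}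
    (hB : ∀ i j, lOne intAbs (A i j) ≤ B) : lOne intAbs A.det ≤ (k * B) ^ k := by
  rcases Nat.eq_zero_or_pos k with rfl | hk
  · rw [Matrix.det_isEmpty, ← C_1, lOne_C, intAbs_apply]; simp
  have hB0 : 0 ≤ B := (lOne_nonneg _ _).trans (hB ⟨0, hk⟩ ⟨0, hk⟩)
  rw [Matrix.det_apply]
  refine (lOne_sum_le _ _ _).trans ?_
  have h1 : ∀ π : Equiv.Perm (Fin k),
      lOne intAbs (Equiv.Perm.sign π • ∏ i, A (π i) i) ≤ B ^ k := by
    intro π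
    have h2 : lOne intAbs (∏ i, A (π i) i) ≤ B ^ k := by
      refine (lOne_prod_le _ (by rw [intAbs_apply]; simp) _ _).trans ?_
      calc ∏ i, lOne intAbs (A (π i) i) ≤ ∏ _i : Fin k, B :=
            Finset.prod_le_prod (fun _ _ => lOne_nonneg _ _) fun i _ => hB _ _
        _ = B ^ k := by simp
    have h3 : (Equiv.Perm.sign π • ∏ i, A (π i) i) =
        C ((Equiv.Perm.sign π : ℤˣ) : ℤ) * ∏ i, A (π i) i := by
      rw [Units.smul_def, smul_eq_C_mul]
    rw [h3]
    refine (lOne_mul_le _ _ _).trans ?_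
    rw [lOne_C, intAbs_apply]
    have h4 : |(((Equiv.Perm.sign π : ℤˣ) : ℤ) : ℝ)| = 1 := by
      rcases Int.units_eq_one_or (Equiv.Perm.sign π) with h | h <;> simp [h]
    rw [h4, one_mul]; exact h2
  refine (Finset.sum_le_sum fun π _ => h1 π).trans ?_
  rw [Finset.sum_const, Finset.card_univ, Fintype.card_perm, Fintype.card_fin, nsmul_eq_mul, mul_pow]
  refine mul_le_mul_of_nonneg_right ?_ (by positivity)
  exact_mod_cast Nat.factorial_le_pow k

lemma degreeOf_det_le {σ R : Type*} [CommRing R] {k : ℕ}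
    (A : Matrix (Fin k) (Fin k) (MvPolynomial σ R)) (s : σ) {d : ℕ}
    (h : ∀ i j, degreeOf s (A i j) ≤ d) : degreeOf s A.det ≤ k * d := by
  rw [Matrix.det_apply]
  refine (degreeOf_sum_le s _ _).trans (Finset.sup_le fun π _ => ?_)
  rw [Units.smul_def]
  refine (?_ : _ ≤ degreeOf s (∏ i, A (π i) i)).trans ?_
  · rw [zsmul_eq_mul, ← map_intCast (C : R →+* MvPolynomial σ R)]
    exact degreeOf_C_mul_le _ _ _
  · refine (degreeOf_prod_le s _ _).trans ?_
    calc ∑ i, degreeOf s (A (π i) i) ≤ ∑ _i : Fin k, d := Finset.sum_le_sum fun i _ => h _ _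
      _ = k * d := by simp

lemma one_le_lOne {σ : Type*} {f : MvPolynomial σ ℤ} (hf : f ≠ 0) : 1 ≤ lOne intAbs f := by
  obtain ⟨e, he⟩ := MvPolynomial.ne_zero_iff.mp hf
  refine le_trans ?_ (coeff_le_lOne intAbs f e)
  rw [intAbs_apply]
  exact_mod_cast Int.one_le_abs he

end SubspaceThm

namespace SubspaceThm

open MvPolynomial

/-- The determinant of the Hasse derivatives of `P`, split into its two factors. -/
lemma exists_split_wronskian {M r : ℕ} (P : MvPolynomial (Fin (M + 1)) ℤ) (hP : P ≠ 0)
    (hr : degreeOf 0 P ≤ r) :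
    ∃ (k : ℕ) (e : Fin k → Fin M →₀ ℕ) (l : Fin k → ℕ) (U : MvPolynomial (Fin M) ℚ)
      (V : MvPolynomial (Fin 1) ℚ), 0 < k ∧ k ≤ r + 1 ∧ (∀ i, (e i).degree ≤ k - 1) ∧
      (∀ j, l j < k) ∧ Function.Injective l ∧ U ≠ 0 ∧ V ≠ 0 ∧
      map (Int.castRingHom ℚ) (Matrix.of fun i j => hasse ((e i).cons (l j)) P).det =
        inSucc U * inZero V := by
  set Q := map (Int.castRingHom ℚ) P with hQ
  have hQ0 : Q ≠ 0 := (map_ne_zero_iff _ (map_injective _ (Int.castRingHom ℚ).injective_int)).mpr hP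
  have hQr : degreeOf 0 Q ≤ r := by
    refine le_trans (degreeOf_le_iff.mpr fun e he => ?_) hr
    exact degreeOf_le_iff.mp le_rfl e (support_map_subset _ _ he)
  obtain ⟨k, φ, ψ, hk, hkr, hφ, hψ, hsum⟩ := exists_separated_sum Q hQ0 hQr
  obtain ⟨e, he, hU⟩ := exists_wronskian_ne_zero MonomialOrder.lex hφ
  obtain ⟨l, hl, hV⟩ := exists_wronskian_ne_zero MonomialOrder.lex hψ
  have hl' : ∀ j, Finsupp.single 0 (l j 0) = l j := fun j => (Finsupp.unique_single (l j)).symm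
  refine ⟨k, e, fun j => l j 0, _, _, hk, hkr, he, fun j => ?_, fun i j hij => ?_, hU, hV, ?_⟩
  · have := hl j
    rw [← hl' j, Finsupp.degree_single] at this
    change l j 0 < k
    omega
  · by_contra hne
    refine hV (Matrix.det_zero_of_row_eq hne ?_)
    have : l i = l j := by rw [← hl' i, ← hl' j]; exact congrArg _ hij
    funext s
    simp [this]
  · rw [RingHom.map_det, AlgHom.map_det, AlgHom.map_det, ← Matrix.det_transpose (inZero.mapMatrix _), ← Matrix.det_mul]
    congr 1
    ext1 i j
    simp only [RingHom.mapMatrix_apply, Matrix.map_apply, Matrix.of_apply, Matrix.mul_apply,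
      AlgHom.mapMatrix_apply, Matrix.transpose_apply]
    rw [← hasse_map, ← hQ, hsum, hasse_sum]
    refine Finset.sum_congr rfl fun s _ => ?_
    rw [hasse_inSucc_mul_inZero, Finsupp.tail_cons, Finsupp.cons_zero, hl']

lemma map_extract_eq {σ τ : Type*} (j : (τ →₀ ℕ) ↪ (σ →₀ ℕ)) (W : MvPolynomial σ ℤ) {v : ℚ}
    {U : MvPolynomial τ ℚ}
    (h : ∀ α, coeff (j α) (map (Int.castRingHom ℚ) W) = v * coeff α U) :
    map (Int.castRingHom ℚ) (extract j W) = C v * U := by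
  ext α
  rw [coeff_map, coeff_extract, coeff_C_mul, ← h, coeff_map]

theorem roth_index (M : ℕ) : ∀ ε : ℝ, 0 < ε → ∃ ω C : ℝ, 0 < ω ∧ 1 ≤ C ∧
    ∀ r : Fin M → ℕ, (∀ h, 0 < r h) → (∀ i j, i < j → (r i : ℝ) ≤ ω * r j) →
    ∀ f : MvPolynomial (Fin M) ℤ, f ≠ 0 → (∀ h, degreeOf h f ≤ r h) →
    ∀ a b : Fin M → ℤ, (∀ h, 0 < a h) → (∀ h, IsCoprime (a h) (b h)) →
    (∀ h l, lOne intAbs f * C ^ r l ≤ (a h : ℝ) ^ (ω * r h)) →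
    ∃ e : Fin M →₀ ℕ, ∑ h, (r h : ℝ)⁻¹ * e h ≤ ε ∧
      coeff e (shift (fun h => -(b h / a h : ℚ)) (map (Int.castRingHom ℚ) f)) ≠ 0 := by
  induction M with
  | zero =>
    intro ε hε
    refine ⟨1, 1, one_pos, le_rfl, fun r _ _ f hf _ a b _ _ _ => ⟨0, by simpa using hε.le, ?_⟩⟩
    obtain ⟨c, rfl⟩ : ∃ c, f = C c := ⟨_, eq_C_of_isEmpty f⟩
    have : c ≠ 0 := by rintro rfl; exact hf (map_zero C)
    rw [map_C, show (shift _) (C _) = C _ from (shift _).commutes _, coeff_C, if_pos rfl]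
    simpa using this
  | succ M ih =>
    intro ε hε
    wlog hε1 : ε ≤ 1 generalizing ε
    · obtain ⟨ω, C, hω, hC, h⟩ := this 1 one_pos le_rfl
      refine ⟨ω, C, hω, hC, fun r h1 h2 f h3 h4 a b h5 h6 h7 => ?_⟩
      obtain ⟨e, he, he'⟩ := h r h1 h2 f h3 h4 a b h5 h6 h7
      exact ⟨e, he.trans (not_le.mp hε1).le, he'⟩
    obtain ⟨ω', C', hω', hC', ih⟩ := ih (ε ^ 2 / 128) (by positivity)
    set ω := min ω' (ε ^ 2 / 128) with hω
    have hω0 : 0 < ω := lt_min hω' (by positivity)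
    have hωε : ω ≤ ε ^ 2 / 128 := min_le_right _ _
    have hω1 : ω ≤ 1 := hωε.trans (by nlinarith)
    have hωε2 : ω ≤ ε / 2 := hωε.trans (by nlinarith)
    set K : ℝ := 2 ^ (M + 2) * C' with hK
    have hK1 : 1 ≤ K := by
      have : (1 : ℝ) ≤ 2 ^ (M + 2) := one_le_pow₀ (by norm_num)
      nlinarith
    refine ⟨ω, K, hω0, hK1, fun r hr0 hr f hf hdeg a b ha hab hsize => ?_⟩
    by_contra! hcon
    obtain ⟨k, e, l, U, V, hk, hkr, he, hl, hlinj, hU, hV, hW⟩ :=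
      exists_split_wronskian f hf (hdeg 0)
    set A := Matrix.of fun i j => hasse ((e i).cons (l j)) f with hA
    have hrmax : ∀ h, r h ≤ r (Fin.last M) := by
      intro h
      rcases (Fin.le_last h).eq_or_lt with h1 | h1
      · rw [h1]
      · have := hr h _ h1
        have h2 : (r h : ℝ) ≤ r (Fin.last M) := this.trans (by
          have : (0 : ℝ) ≤ r (Fin.last M) := Nat.cast_nonneg _
          nlinarith)
        exact_mod_cast h2
    set N := r (Fin.last M) with hN
    have hf1 : 1 ≤ lOne intAbs f := one_le_lOne hf
    have hkR : (0 : ℝ) < k := by exact_mod_cast hk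
    -- size of the Wronskian
    have hWsize : lOne intAbs A.det ≤ ((2 : ℝ) ^ ((M + 2) * N) * lOne intAbs f) ^ k := by
      refine (lOne_det_le A fun i j => lOne_hasse_le _ f hdeg).trans ?_
      refine pow_le_pow_left₀ (by positivity) ?_ k
      rw [← mul_assoc]
      refine mul_le_mul_of_nonneg_right ?_ (by linarith)
      have h1 : k ≤ 2 ^ N := by
        have : N < 2 ^ N := Nat.lt_two_pow_self
        have := hrmax 0
        omega
      have h2 : ∑ h, r h ≤ (M + 1) * N := by
        calc ∑ h, r h ≤ ∑ _h : Fin (M + 1), N := Finset.sum_le_sum fun h _ => hrmax h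
          _ = (M + 1) * N := by simp
      have h3 : k * 2 ^ ∑ h, r h ≤ 2 ^ ((M + 2) * N) := by
        calc k * 2 ^ ∑ h, r h ≤ 2 ^ N * 2 ^ ((M + 1) * N) :=
              Nat.mul_le_mul h1 (Nat.pow_le_pow_right two_pos h2)
          _ = 2 ^ ((M + 2) * N) := by rw [← pow_add]; congr 1; ring
      exact_mod_cast h3
    have hWbound : ∀ h, lOne intAbs A.det * C' ^ (k * N) ≤ ((a h : ℝ) ^ (ω * r h)) ^ k := by
      intro h
      calc lOne intAbs A.det * C' ^ (k * N)
          ≤ ((2 : ℝ) ^ ((M + 2) * N) * lOne intAbs f) ^ k * C' ^ (k * N) :=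
            mul_le_mul_of_nonneg_right hWsize (by positivity)
        _ = (lOne intAbs f * K ^ N) ^ k := by
            rw [mul_comm k N, pow_mul C' N k, ← mul_pow, hK, mul_pow (2 ^ (M + 2)) C' N, ← pow_mul]
            congr 1; ring
        _ ≤ _ := pow_le_pow_left₀ (by positivity) (hsize h (Fin.last M)) k
    obtain ⟨t₀, ht₀⟩ := MvPolynomial.ne_zero_iff.mp hV
    obtain ⟨α₀, hα₀⟩ := MvPolynomial.ne_zero_iff.mp hU
    let jU : (Fin M →₀ ℕ) ↪ (Fin (M + 1) →₀ ℕ) := ⟨fun α => α.cons (t₀ 0), Finsupp.cons_right_injective _⟩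
    let jV : (Fin 1 →₀ ℕ) ↪ (Fin (M + 1) →₀ ℕ) := ⟨fun β => α₀.cons (β 0), fun β β' h => by
      have := (Finsupp.cons_injective2 h).1
      exact Finsupp.ext fun i => by rw [Subsingleton.elim i 0]; exact this⟩
    have hU0 : map (Int.castRingHom ℚ) (extract jU A.det) = C (coeff t₀ V) * U := by
      refine map_extract_eq jU _ fun α => ?_
      rw [hW, coeff_inSucc_mul_inZero]
      simp only [jU, Function.Embedding.coeFn_mk, Finsupp.tail_cons, Finsupp.cons_zero]
      rw [mul_comm, show Finsupp.single 0 (t₀ 0) = t₀ from (Finsupp.unique_single t₀).symm]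
    have hV0 : map (Int.castRingHom ℚ) (extract jV A.det) = C (coeff α₀ U) * V := by
      refine map_extract_eq jV _ fun β => ?_
      rw [hW, coeff_inSucc_mul_inZero]
      change coeff (α₀.cons (β 0)).tail U * coeff (Finsupp.single 0 ((α₀.cons (β 0)) 0)) V = _
      rw [Finsupp.tail_cons, Finsupp.cons_zero, show Finsupp.single 0 (β 0) = β from (Finsupp.unique_single β).symm]
    have hU0' : extract jU A.det ≠ 0 := by
      intro h
      rw [h, map_zero] at hU0
      exact mul_ne_zero ((map_ne_zero_iff _ (C_injective _ _)).mpr ht₀) hU hU0.symm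
    have hV0' : extract jV A.det ≠ 0 := by
      intro h
      rw [h, map_zero] at hV0
      exact mul_ne_zero ((map_ne_zero_iff _ (C_injective _ _)).mpr hα₀) hV hV0.symm
    have ha2 : (1 : ℝ) < a 0 := by
      have h1 : (1 : ℤ) ≤ a 0 := ha 0
      rcases h1.eq_or_lt with h2 | h2
      · exfalso
        have h3 := hsize 0 0
        rw [← h2, Int.cast_one, Real.one_rpow] at h3
        have h4 : (2 : ℝ) ≤ K ^ r 0 := by
          have h5 : (2 : ℝ) ≤ K := by
            have : (2 : ℝ) ≤ 2 ^ (M + 2) := by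
              calc (2 : ℝ) = 2 ^ 1 := by norm_num
                _ ≤ _ := pow_le_pow_right₀ (by norm_num) (by omega)
            nlinarith
          calc (2 : ℝ) ≤ K ^ 1 := by simpa using h5
            _ ≤ _ := pow_le_pow_right₀ hK1 (hr0 0)
        nlinarith
      · exact_mod_cast h2
    -- orders of vanishing of the two factors
    obtain ⟨t, ht, htc⟩ := exists_order_of_one_variable _ hV0' (ha 0) (hab 0)
    have htω : (t : ℝ) ≤ ω * r 0 * k := by
      have h1 : (a 0 : ℝ) ^ t ≤ ((a 0 : ℝ) ^ (ω * r 0)) ^ k := by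
        refine (ht.trans (lOne_extract_le _ _ _)).trans (le_trans ?_ (hWbound 0))
        exact le_mul_of_one_le_right (lOne_nonneg _ _) (one_le_pow₀ hC')
      rw [← Real.rpow_natCast, ← Real.rpow_natCast, ← Real.rpow_mul (by linarith)] at h1
      exact (Real.rpow_le_rpow_left_iff ha2).mp h1
    obtain ⟨e', he', hec⟩ := ih (fun h => k * r h.succ) (fun h => Nat.mul_pos hk (hr0 _))
      (fun i j hij => by
        have h1 := hr i.succ j.succ (Fin.succ_lt_succ_iff.mpr hij)
        push_cast
        have h2 : (r i.succ : ℝ) ≤ ω' * r j.succ := h1.trans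
          (mul_le_mul_of_nonneg_right (min_le_left _ _) (Nat.cast_nonneg _))
        calc (k : ℝ) * r i.succ ≤ k * (ω' * r j.succ) := mul_le_mul_of_nonneg_left h2 hkR.le
          _ = _ := by ring)
      _ hU0' (fun h => by
        refine degreeOf_le_iff.mpr fun α hα => ?_
        rw [mem_support_iff, coeff_extract] at hα
        have h1 := degreeOf_le_iff.mp (degreeOf_det_le A h.succ fun i j =>
          (degreeOf_hasse_le _ f h.succ).trans (hdeg h.succ)) _ (mem_support_iff.mpr hα)
        simpa [jU] using h1)
      (fun h => a h.succ) (fun h => b h.succ) (fun h => ha _) (fun h => hab _)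
      (fun h l' => by
        have ha1 : (1 : ℝ) ≤ a h.succ := by exact_mod_cast ha h.succ
        calc lOne intAbs (extract jU A.det) * C' ^ (k * r l'.succ)
            ≤ lOne intAbs A.det * C' ^ (k * N) := by
              refine mul_le_mul (lOne_extract_le _ _ _) ?_ (by positivity) (lOne_nonneg _ _)
              exact pow_le_pow_right₀ hC' (Nat.mul_le_mul_left _ (hrmax _))
          _ ≤ ((a h.succ : ℝ) ^ (ω * r h.succ)) ^ k := hWbound _
          _ = (a h.succ : ℝ) ^ (ω * r h.succ * k) := by
              rw [← Real.rpow_natCast, ← Real.rpow_mul (by linarith)]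
          _ ≤ _ := by
              refine Real.rpow_le_rpow_of_exponent_le ha1 ?_
              push_cast
              have : ω * (r h.succ * k : ℝ) ≤ ω' * (r h.succ * k : ℝ) :=
                mul_le_mul_of_nonneg_right (min_le_left _ _) (by positivity)
              nlinarith)
    set ξ : Fin (M + 1) → ℚ := fun h => -(b h / a h : ℚ) with hξ
    rw [hU0, map_mul, show (shift _) (C (coeff t₀ V)) = C (coeff t₀ V) from
      (shift _).commutes _, coeff_C_mul] at hec
    rw [hV0, map_mul, show (shift _) (C (coeff α₀ U)) = C (coeff α₀ U) from
      (shift _).commutes _, coeff_C_mul] at htc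
    have hWc : coeff (e'.cons t) (shift ξ (map (Int.castRingHom ℚ) A.det)) ≠ 0 := by
      rw [hW, map_mul, shift_inSucc, shift_inZero, coeff_inSucc_mul_inZero, Finsupp.tail_cons,
        Finsupp.cons_zero]
      exact mul_ne_zero (right_ne_zero_of_mul hec) (right_ne_zero_of_mul htc)
    -- lower bound for the order of vanishing
    set w : Fin (M + 1) → ℝ := fun h => (r h : ℝ)⁻¹ with hw
    have hfI : IndexGE w ε (shift ξ (map (Int.castRingHom ℚ) f)) := by
      intro γ hγ
      by_contra! h
      exact hγ (hcon γ h.le)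
    have hr0R : ∀ h, (0 : ℝ) < r h := fun h => by exact_mod_cast hr0 h
    have hWI : IndexGE w (∑ j, max 0 (ε - ω - l j / r 0))
        (shift ξ (map (Int.castRingHom ℚ) A.det)) := by
      rw [RingHom.map_det, AlgHom.map_det]
      refine IndexGE.det fun i j => ?_
      simp only [RingHom.mapMatrix_apply, Matrix.map_apply, AlgHom.mapMatrix_apply, hA,
        Matrix.of_apply]
      rw [← hasse_map, ← hasse_shift]
      rcases max_choice 0 (ε - ω - l j / r 0) with h | h
      · rw [h]
        exact indexGE_zero_of_nonneg (fun s => inv_nonneg.mpr (Nat.cast_nonneg _)) _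
      · rw [h]
        refine (hfI.hasse _).mono ?_
        rw [Fin.sum_univ_succ]
        simp only [Finsupp.cons_zero, Finsupp.cons_succ, hw]
        have h1 : ∑ h : Fin M, (r h.succ : ℝ)⁻¹ * e i h ≤ ω := by
          calc ∑ h : Fin M, (r h.succ : ℝ)⁻¹ * e i h ≤ ∑ h : Fin M, ω / r 0 * e i h := by
                refine Finset.sum_le_sum fun h _ => mul_le_mul_of_nonneg_right ?_ (Nat.cast_nonneg _)
                rw [inv_eq_one_div, div_le_div_iff₀ (hr0R _) (hr0R _), one_mul]
                exact hr 0 h.succ (Fin.succ_pos h)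
            _ = ω / r 0 * (e i).degree := by
                rw [← Finset.mul_sum, Finsupp.degree_eq_sum]; push_cast; rfl
            _ ≤ ω / r 0 * r 0 := by
                refine mul_le_mul_of_nonneg_left ?_ (by positivity)
                have := he i
                have h2 : (e i).degree ≤ r 0 := by omega
                exact_mod_cast h2
            _ = ω := div_mul_cancel₀ _ (hr0R 0).ne'
        rw [inv_mul_eq_div]
        linarith
    have hup := hWI _ hWc
    rw [Fin.sum_univ_succ] at hup
    simp only [Finsupp.cons_zero, Finsupp.cons_succ, hw] at hup
    have h1 : (r 0 : ℝ)⁻¹ * t ≤ ω * k := by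
      rw [inv_mul_eq_div, div_le_iff₀ (hr0R 0)]; linarith
    have h2 : ∑ h : Fin M, (r h.succ : ℝ)⁻¹ * e' h ≤ k * (ε ^ 2 / 128) := by
      have h3 : ∑ h : Fin M, (r h.succ : ℝ)⁻¹ * e' h =
          k * ∑ h : Fin M, ((k * r h.succ : ℕ) : ℝ)⁻¹ * e' h := by
        rw [Finset.mul_sum]
        refine Finset.sum_congr rfl fun h _ => ?_
        have := (hr0R h.succ).ne'
        push_cast
        field_simp
      rw [h3]
      exact mul_le_mul_of_nonneg_left he' hkR.le
    have h3 : ∑ j, max 0 (ε - ω - l j / r 0) = ∑ j : Fin k, max 0 (ε - ω - (j : ℕ) / r 0) := by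
      let l' : Fin k → Fin k := fun j => ⟨l j, hl j⟩
      have hl' : Function.Bijective l' := Finite.injective_iff_bijective.mp fun i j h =>
        hlinj (Fin.mk.inj_iff.mp h)
      exact hl'.sum_comp (fun j : Fin k => max 0 (ε - ω - (j : ℕ) / r 0))
    have h4 := le_sum_max_sub (hr0 0) hkr (θ := ε - ω) (by linarith) (by linarith)
    rw [h3] at hup
    have h5 : (k : ℝ) * ε ^ 2 / 32 ≤ k * (ε - ω) ^ 2 / 8 := by
      have : ε ^ 2 / 4 ≤ (ε - ω) ^ 2 := by nlinarith
      nlinarith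
    have h6 : ω * k ≤ k * (ε ^ 2 / 128) := by nlinarith
    have h7 : 0 < (k : ℝ) * ε ^ 2 := by positivity
    nlinarith

end SubspaceThm

namespace SubspaceThm

open Finset

lemma sum_sq_le_of_mean_zero {m : ℕ} {α : Type*} [DecidableEq α] (S : Fin m → Finset α)
    (f : Fin m → α → ℝ) (hf : ∀ h, ∑ x ∈ S h, f h x = 0) (hb : ∀ h, ∀ x ∈ S h, |f h x| ≤ 1) :
    ∑ κ ∈ Fintype.piFinset S, (∑ h, f h (κ h)) ^ 2 ≤ m * (Fintype.piFinset S).card := by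
  have hcross : ∀ h l, h ≠ l → ∑ κ ∈ Fintype.piFinset S, f h (κ h) * f l (κ l) = 0 := by
    intro h l hne
    let g : Fin m → α → ℝ := fun u x => if u = h then f h x else if u = l then f l x else 1
    have : ∀ κ : Fin m → α, f h (κ h) * f l (κ l) = ∏ u, g u (κ u) := by
      intro κ
      rw [← Finset.prod_subset (Finset.subset_univ {h, l}), Finset.prod_pair hne]
      · simp [g, hne.symm]
      · intro u _ hu
        simp only [Finset.mem_insert, Finset.mem_singleton, not_or] at hu
        simp [g, hu.1, hu.2]
    simp_rw [this]
    rw [← Finset.prod_univ_sum]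
    refine Finset.prod_eq_zero (Finset.mem_univ h) ?_
    simpa [g] using hf h
  have hexp : ∀ κ : Fin m → α, (∑ h, f h (κ h)) ^ 2 = ∑ h, ∑ l, f h (κ h) * f l (κ l) := by
    intro κ; rw [sq, Finset.sum_mul_sum]
  simp_rw [hexp]
  rw [Finset.sum_comm]
  have : ∀ h : Fin m, ∑ κ ∈ Fintype.piFinset S, ∑ l, f h (κ h) * f l (κ l) ≤
      (Fintype.piFinset S).card := by
    intro h
    rw [Finset.sum_comm, Finset.sum_eq_single h (fun l _ hl => hcross h l (Ne.symm hl)) (by simp)]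
    calc _ ≤ ∑ κ ∈ Fintype.piFinset S, (1 : ℝ) := by
          refine Finset.sum_le_sum fun κ hκ => ?_
          have := hb h (κ h) (Fintype.mem_piFinset.mp hκ h)
          rw [← abs_mul_abs_self]
          nlinarith [abs_nonneg (f h (κ h))]
      _ = _ := by simp
  calc _ ≤ ∑ h : Fin m, ((Fintype.piFinset S).card : ℝ) := Finset.sum_le_sum fun h _ => this h
    _ = _ := by simp

variable {ι : Type*} [Fintype ι] [DecidableEq ι]

lemma sum_piAntidiag_apply (r : ℕ) (i : ι) :
    (Fintype.card ι : ℝ) * ∑ x ∈ piAntidiag (univ : Finset ι) r, (x i : ℝ) =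
      r * (piAntidiag (univ : Finset ι) r).card := by
  have hsym : ∀ j, ∑ x ∈ piAntidiag (univ : Finset ι) r, (x j : ℝ) =
      ∑ x ∈ piAntidiag (univ : Finset ι) r, (x i : ℝ) := by
    intro j
    refine Finset.sum_nbij' (fun x => x ∘ Equiv.swap i j) (fun x => x ∘ Equiv.swap i j) ?_ ?_ ?_ ?_ ?_
    · intro x hx
      simp only [mem_piAntidiag, mem_univ, implies_true, and_true] at hx ⊢
      rw [← hx]; exact Equiv.sum_comp (Equiv.swap i j) x
    · intro x hx
      simp only [mem_piAntidiag, mem_univ, implies_true, and_true] at hx ⊢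
      rw [← hx]; exact Equiv.sum_comp (Equiv.swap i j) x
    · intro x _; ext; simp
    · intro x _; ext; simp
    · intro x _; simp
  calc _ = ∑ j : ι, ∑ x ∈ piAntidiag (univ : Finset ι) r, (x j : ℝ) := by
        rw [Finset.sum_congr rfl fun j _ => hsym j]; simp
    _ = ∑ x ∈ piAntidiag (univ : Finset ι) r, ∑ j : ι, (x j : ℝ) := Finset.sum_comm
    _ = ∑ x ∈ piAntidiag (univ : Finset ι) r, (r : ℝ) := by
        refine Finset.sum_congr rfl fun x hx => ?_
        simp only [mem_piAntidiag, mem_univ, implies_true, and_true] at hx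
        rw [← hx]; push_cast; rfl
    _ = _ := by simp [mul_comm]

/-- Exponent vectors of monomials that are homogeneous of degree `r h` in the `h`-th block. -/
def blockExponents (ι : Type*) [Fintype ι] [DecidableEq ι] {m : ℕ} (r : Fin m → ℕ) :
    Finset (Fin m → ι → ℕ) :=
  Fintype.piFinset fun h => piAntidiag (univ : Finset ι) (r h)

lemma mem_blockExponents {m : ℕ} {r : Fin m → ℕ} {κ : Fin m → ι → ℕ} :
    κ ∈ blockExponents ι r ↔ ∀ h, ∑ i, κ h i = r h := by
  simp [blockExponents, Fintype.mem_piFinset]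

/-- Exponent vectors which are far from being equidistributed. -/
noncomputable def badExponents (ι : Type*) [Fintype ι] [DecidableEq ι] {m : ℕ} (r : Fin m → ℕ) (η : ℝ) :
    Finset (Fin m → ι → ℕ) :=
  (blockExponents ι r).filter fun κ =>
    ∃ i, η * m < |∑ h, (κ h i : ℝ) / r h - m / Fintype.card ι|

lemma card_badExponents_le [Nonempty ι] {m : ℕ} (hm : 0 < m) {r : Fin m → ℕ} (hr : ∀ h, 0 < r h)
    {η : ℝ} (hη : 0 < η) :
    ((badExponents ι r η).card : ℝ) * (η ^ 2 * m) ≤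
      Fintype.card ι * (blockExponents ι r).card := by
  have hN : (0 : ℝ) < Fintype.card ι := by exact_mod_cast Fintype.card_pos
  have hN1 : (1 : ℝ) ≤ Fintype.card ι := by exact_mod_cast Fintype.card_pos
  have hm' : (0 : ℝ) < m := by exact_mod_cast hm
  have key : ∀ i : ι, ∑ κ ∈ blockExponents ι r,
      (∑ h, (κ h i : ℝ) / r h - m / Fintype.card ι) ^ 2 ≤ m * (blockExponents ι r).card := by
    intro i
    have := sum_sq_le_of_mean_zero (fun h => piAntidiag (univ : Finset ι) (r h))
      (fun h x => (x i : ℝ) / r h - 1 / Fintype.card ι) ?_ ?_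
    · simpa [Finset.sum_sub_distrib, blockExponents, div_eq_mul_inv] using this
    · intro h
      have hrh : (r h : ℝ) ≠ 0 := by exact_mod_cast (hr h).ne'
      have := sum_piAntidiag_apply (r h) i
      rw [Finset.sum_sub_distrib, ← Finset.sum_div]
      simp only [sum_const, nsmul_eq_mul]
      field_simp
      linarith
    · intro h x hx
      have hrh : (0 : ℝ) < r h := by exact_mod_cast (hr h)
      simp only [mem_piAntidiag, mem_univ, implies_true, and_true] at hx
      have h1 : x i ≤ r h := by
        rw [← hx]; exact Finset.single_le_sum (f := x) (fun _ _ => Nat.zero_le _) (mem_univ i)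
      have h2 : (x i : ℝ) / r h ≤ 1 := by rw [div_le_one hrh]; exact_mod_cast h1
      have h3 : (0 : ℝ) ≤ (x i : ℝ) / r h := by positivity
      have h4 : 1 / (Fintype.card ι : ℝ) ≤ 1 := by rw [div_le_one hN]; exact hN1
      have h5 : 0 < 1 / (Fintype.card ι : ℝ) := by positivity
      rw [abs_le]; constructor <;> linarith
  have hsum : ∑ κ ∈ blockExponents ι r, ∑ i : ι,
      (∑ h, (κ h i : ℝ) / r h - m / Fintype.card ι) ^ 2 ≤
      Fintype.card ι * (m * (blockExponents ι r).card) := by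
    rw [Finset.sum_comm]
    calc _ ≤ ∑ _i : ι, (m * (blockExponents ι r).card : ℝ) := Finset.sum_le_sum fun i _ => key i
      _ = _ := by simp
  have hlow : ((badExponents ι r η).card : ℝ) * (η * m) ^ 2 ≤ ∑ κ ∈ blockExponents ι r, ∑ i : ι,
      (∑ h, (κ h i : ℝ) / r h - m / Fintype.card ι) ^ 2 := by
    calc _ = ∑ κ ∈ badExponents ι r η, (η * m) ^ 2 := by simp
      _ ≤ ∑ κ ∈ badExponents ι r η, ∑ i : ι,
          (∑ h, (κ h i : ℝ) / r h - m / Fintype.card ι) ^ 2 := by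
          refine Finset.sum_le_sum fun κ hκ => ?_
          obtain ⟨i, hi⟩ := (Finset.mem_filter.mp hκ).2
          refine le_trans ?_ (Finset.single_le_sum (f := fun i : ι =>
            (∑ h, (κ h i : ℝ) / r h - m / Fintype.card ι) ^ 2) (fun _ _ => sq_nonneg _) (mem_univ i))
          rw [← sq_abs (∑ h, (κ h i : ℝ) / r h - m / Fintype.card ι)]
          exact pow_le_pow_left₀ (by positivity) hi.le 2
      _ ≤ _ := Finset.sum_le_sum_of_subset_of_nonneg (Finset.filter_subset _ _)
          fun _ _ _ => Finset.sum_nonneg fun _ _ => sq_nonneg _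
  have := hlow.trans hsum
  refine le_of_mul_le_mul_right ?_ hm'
  linarith

lemma card_blockExponents_le {m : ℕ} (r : Fin m → ℕ) :
    (blockExponents ι r).card ≤ (2 ^ Fintype.card ι) ^ ∑ h, r h := by
  rw [blockExponents, Fintype.card_piFinset, ← Finset.prod_pow_eq_pow_sum]
  refine Finset.prod_le_prod' fun h _ => ?_
  have : piAntidiag (univ : Finset ι) (r h) ⊆ Fintype.piFinset fun _ => range (r h + 1) := by
    intro x hx
    simp only [mem_piAntidiag, mem_univ, implies_true, and_true] at hx
    rw [Fintype.mem_piFinset]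
    intro i
    rw [mem_range, Nat.lt_succ_iff, ← hx]
    exact Finset.single_le_sum (f := x) (fun _ _ => Nat.zero_le _) (mem_univ i)
  refine (Finset.card_le_card this).trans ?_
  simp only [Fintype.card_piFinset, card_range, prod_const, card_univ]
  rw [← pow_mul, mul_comm, pow_mul]
  exact Nat.pow_le_pow_left (Nat.lt_two_pow_self) _

lemma blockExponents_nonempty [Nonempty ι] {m : ℕ} (r : Fin m → ℕ) :
    (blockExponents ι r).Nonempty := by
  obtain ⟨i⟩ := ‹Nonempty ι›
  exact ⟨fun h => Pi.single i (r h), mem_blockExponents.mpr fun h => by simp⟩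

end SubspaceThm

namespace SubspaceThm

open Finset NumberField

/-- The house of an algebraic integer, as a ring seminorm. -/
noncomputable def houseSeminorm (K : Type*) [Field K] [NumberField K] : RingSeminorm (𝓞 K) where
  toFun α := house (algebraMap (𝓞 K) K α)
  map_zero' := by simp [house]
  add_le' a b := by rw [map_add]; exact house_add_le _ _
  neg' a := by rw [map_neg]; simp [house]
  mul_le' a b := by rw [map_mul]; exact house_mul_le _ _

lemma houseSeminorm_apply {K : Type*} [Field K] [NumberField K] (α : 𝓞 K) :
    houseSeminorm K α = house (algebraMap (𝓞 K) K α) := rfl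

lemma houseSeminorm_intCast {K : Type*} [Field K] [NumberField K] (a : ℤ) :
    houseSeminorm K (a : 𝓞 K) = |(a : ℝ)| := by
  rw [houseSeminorm_apply, map_intCast, house_intCast, Int.cast_abs]

lemma houseSeminorm_one {K : Type*} [Field K] [NumberField K] : houseSeminorm K 1 = 1 := by
  simpa using houseSeminorm_intCast (K := K) 1

attribute [local instance] Matrix.seminormedAddCommGroup

/-- Siegel's lemma for integral solutions of equations over the integers of a number field. -/
lemma exists_small_int_solution (K : Type*) [Field K] [NumberField K] :
    ∃ (D : ℕ) (c : ℝ), 0 < D ∧ 1 ≤ c ∧ ∀ {α β : Type} [Fintype α] [Fintype β]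
      (a : α → β → 𝓞 K) (A : ℝ), 1 ≤ A → (∀ k l, houseSeminorm K (a k l) ≤ A) →
      2 * D * Fintype.card α ≤ Fintype.card β → 0 < Fintype.card β →
      ∃ t : β → ℤ, t ≠ 0 ∧ (∀ k, ∑ l, (t l : 𝓞 K) * a k l = 0) ∧
        ∀ l, |(t l : ℝ)| ≤ c * Fintype.card β * A := by
  classical
  obtain ⟨c₀, hc₀⟩ : ∃ c₀ : ℝ, ∀ (x : 𝓞 K) (i : K →+* ℂ),
      |((((RingOfIntegers.basis K).reindex (equivReindex K).symm).repr x i : ℤ) : ℝ)| ≤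
        c₀ * houseSeminorm K x := by
    obtain ⟨c₀, h⟩ : ∃ c₀ : ℝ, ∀ (x : 𝓞 K) (i : K →+* ℂ),
        ‖(((integralBasis K).reindex (equivReindex K).symm).repr x i : ℂ)‖ ≤
          c₀ * house (algebraMap (𝓞 K) K x) :=
      ⟨_, fun x i => house.basis_repr_norm_le_const_mul_house K x i⟩
    refine ⟨c₀, fun x i => ?_⟩
    rw [houseSeminorm_apply]
    refine le_trans (le_of_eq ?_) (h x i)
    simp [integralBasis_repr_apply]
  set β' := (RingOfIntegers.basis K).reindex (equivReindex K).symm with hβ'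
  refine ⟨Fintype.card (K →+* ℂ), max 1 c₀, Fintype.card_pos, le_max_left _ _, ?_⟩
  intro α β _ _ a A hA ha hcard hpos
  rcases isEmpty_or_nonempty α with hα | hα
  · refine ⟨fun _ => 1, ?_, fun k => (IsEmpty.false k).elim, fun l => ?_⟩
    · obtain ⟨l⟩ := Fintype.card_pos_iff.mp hpos
      intro h; simpa using congrFun h l
    · have h1 : (1 : ℝ) ≤ Fintype.card β := by exact_mod_cast hpos
      have h2 : (1 : ℝ) ≤ max 1 c₀ := le_max_left _ _
      have := one_le_mul_of_one_le_of_one_le (one_le_mul_of_one_le_of_one_le h2 h1) hA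
      simpa using this
  let M : Matrix (α × (K →+* ℂ)) β ℤ := fun k l => β'.repr (a k.1 l) k.2
  have hMcard : Fintype.card (α × (K →+* ℂ)) = Fintype.card α * Fintype.card (K →+* ℂ) :=
    Fintype.card_prod _ _
  have hMpos : 0 < Fintype.card (α × (K →+* ℂ)) := Fintype.card_pos
  have hlt : 2 * Fintype.card (α × (K →+* ℂ)) ≤ Fintype.card β := by rw [hMcard]; linarith
  obtain ⟨t, ht0, hMt, htn⟩ := Int.Matrix.exists_ne_zero_int_vec_norm_le M (by omega) hMpos
  refine ⟨t, ht0, fun k => ?_, fun l => ?_⟩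
  · refine β'.repr.map_eq_zero_iff.mp ?_
    ext i
    have := congrFun hMt (k, i)
    simp only [Matrix.mulVec, dotProduct, M, Pi.zero_apply] at this
    rw [map_sum, Finsupp.coe_finsetSum, Finset.sum_apply, Finsupp.coe_zero, Pi.zero_apply, ← this]
    refine Finset.sum_congr rfl fun l _ => ?_
    rw [← zsmul_eq_mul, map_zsmul, Finsupp.smul_apply, smul_eq_mul, mul_comm]
  · have hMn : ‖M‖ ≤ max 1 c₀ * A := by
      rw [Matrix.norm_le_iff (by positivity)]
      intro k l
      rw [Int.norm_eq_abs]
      refine (hc₀ _ _).trans ?_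
      exact mul_le_mul (le_max_right _ _) (ha _ _) (apply_nonneg _ _) (by positivity)
    have h2 : (1 : ℝ) ≤ max 1 c₀ := le_max_left _ _
    have h1 : (1 : ℝ) ≤ Fintype.card β := by exact_mod_cast hpos
    have h3 : max 1 ‖M‖ ≤ max 1 c₀ * A :=
      max_le (one_le_mul_of_one_le_of_one_le h2 hA) hMn
    have h4 := norm_le_pi_norm t l
    rw [Int.norm_eq_abs] at h4
    have hbase : (1 : ℝ) ≤ Fintype.card β * max 1 ‖M‖ :=
      one_le_mul_of_one_le_of_one_le h1 (le_max_left _ _)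
    have hexp : (Fintype.card (α × (K →+* ℂ)) : ℝ) /
        (Fintype.card β - Fintype.card (α × (K →+* ℂ))) ≤ 1 := by
      have : (2 * Fintype.card (α × (K →+* ℂ)) : ℝ) ≤ Fintype.card β := by exact_mod_cast hlt
      have hp : (0 : ℝ) < Fintype.card (α × (K →+* ℂ)) := by exact_mod_cast hMpos
      rw [div_le_one (by linarith)]; linarith
    calc _ ≤ ‖t‖ := h4
      _ ≤ _ := htn
      _ ≤ (Fintype.card β * max 1 ‖M‖) ^ (1 : ℝ) := Real.rpow_le_rpow_of_exponent_le hbase hexp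
      _ = Fintype.card β * max 1 ‖M‖ := Real.rpow_one _
      _ ≤ Fintype.card β * (max 1 c₀ * A) := by gcongr
      _ = _ := by ring

end SubspaceThm

namespace SubspaceThm

open Finset NumberField

lemma exists_numberField_integral_multiple {τ : Type*} [Finite τ] (a : τ → ℝ)
    (ha : ∀ t, IsAlgebraic ℚ (a t)) :
    ∃ (K : Type) (_ : Field K) (_ : NumberField K) (φ : K →+* ℝ) (D : ℤ) (b : τ → 𝓞 K), D ≠ 0 ∧
      ∀ t, φ (algebraMap (𝓞 K) K (b t)) = D * a t := by
  classical
  have := Fintype.ofFinite τ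
  let K := IntermediateField.adjoin ℚ (Set.range a)
  have : FiniteDimensional ℚ K := IntermediateField.finiteDimensional_adjoin (by
    rintro _ ⟨t, rfl⟩; exact (ha t).isIntegral)
  have : NumberField K := { to_charZero := inferInstance, to_finiteDimensional := this }
  let a' : τ → K := fun t => ⟨a t, IntermediateField.subset_adjoin ℚ _ ⟨t, rfl⟩⟩
  obtain ⟨D, hD, hDi⟩ := exists_integral_multiples ℤ ℚ (Finset.univ.image a')
  have hintegral : ∀ t, IsIntegral ℤ (D • a' t) := fun t =>
    hDi _ (Finset.mem_image_of_mem _ (Finset.mem_univ t))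
  refine ⟨K, inferInstance, inferInstance, (algebraMap K ℝ), D, fun t => ⟨D • a' t, hintegral t⟩, hD,
    fun t => ?_⟩
  change algebraMap K ℝ (D • a' t) = _
  rw [zsmul_eq_mul, map_mul, map_intCast]
  rfl

end SubspaceThm

namespace SubspaceThm

open MvPolynomial

lemma isWeightedHomogeneous_bind₁ {σ τ R M : Type*} [CommRing R] [AddCommMonoid M] {w : σ → M}
    {w' : τ → M} {f : MvPolynomial σ R} {n : M} (hf : IsWeightedHomogeneous w f n)
    {s : σ → MvPolynomial τ R} (hs : ∀ i, IsWeightedHomogeneous w' (s i) (w i)) :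
    IsWeightedHomogeneous w' (bind₁ s f) n := by
  rw [bind₁, aeval_def, eval₂_eq]
  refine IsWeightedHomogeneous.sum _ _ _ fun e he => ?_
  rw [algebraMap_eq]
  refine IsWeightedHomogeneous.C_mul ?_ _
  have h := IsWeightedHomogeneous.prod e.support (fun i => s i ^ e i) (fun i => e i • w i)
    (w := w') (fun i _ => (hs i).pow (e i))
  rwa [show ∑ i ∈ e.support, e i • w i = n from hf (mem_support_iff.mp he)] at h

section

variable {ι R S : Type*} {m : ℕ} [CommRing R] [CommRing S]

/-- Homogeneous of degree `r h` in the `h`-th block of variables. -/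
def BlockHomogeneous (r : Fin m → ℕ) (f : MvPolynomial (Fin m × ι) R) : Prop :=
  IsWeightedHomogeneous (fun s : Fin m × ι => (Pi.single s.1 1 : Fin m → ℕ)) f r

lemma weight_block_apply [Fintype ι] (e : Fin m × ι →₀ ℕ) (h : Fin m) :
    Finsupp.weight (fun s : Fin m × ι => (Pi.single s.1 1 : Fin m → ℕ)) e h = ∑ i, e (h, i) := by
  classical
  rw [Finsupp.weight_apply, Finsupp.sum_fintype _ _ (by simp), Finset.sum_apply,
    Fintype.sum_prod_type, Finset.sum_eq_single h]
  · simp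
  · intro b _ hb
    simp [hb.symm]
  · simp

lemma blockHomogeneous_iff [Fintype ι] {r : Fin m → ℕ} {f : MvPolynomial (Fin m × ι) R} :
    BlockHomogeneous r f ↔ ∀ e ∈ f.support, ∀ h, ∑ i, e (h, i) = r h := by
  constructor
  · intro H e he h
    rw [← weight_block_apply, H (mem_support_iff.mp he)]
  · intro H e he
    ext h
    rw [weight_block_apply]
    exact H e (mem_support_iff.mpr he) h

lemma BlockHomogeneous.totalDegree_le [Fintype ι] {r : Fin m → ℕ} {f : MvPolynomial (Fin m × ι) R}
    (hf : BlockHomogeneous r f) : f.totalDegree ≤ ∑ h, r h := by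
  refine Finset.sup_le fun e he => ?_
  rw [Finsupp.sum_fintype _ _ (by simp), Fintype.sum_prod_type]
  exact Finset.sum_le_sum fun h _ => (blockHomogeneous_iff.mp hf e he h).le

lemma BlockHomogeneous.map {r : Fin m → ℕ} {f : MvPolynomial (Fin m × ι) R}
    (hf : BlockHomogeneous r f) (φ : R →+* S) : BlockHomogeneous r (MvPolynomial.map φ f) := by
  intro e he
  refine hf (fun h => he ?_)
  rw [coeff_map, h, map_zero]

/-- The substitution in every block of variables of the linear forms given by a matrix. -/
noncomputable def blockForm {ι κ : Type*} [Fintype κ] (A : Fin m → Matrix ι κ R) (s : Fin m × ι) :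
    MvPolynomial (Fin m × κ) R :=
  ∑ j, C (A s.1 s.2 j) * X (s.1, j)

lemma map_blockForm {κ : Type*} [Fintype κ] (φ : R →+* S) (A : Fin m → Matrix ι κ R)
    (s : Fin m × ι) :
    MvPolynomial.map φ (blockForm A s) = blockForm (fun h => (A h).map φ) s := by
  simp [blockForm]

lemma blockHomogeneous_blockForm {κ : Type*} [Fintype κ] (A : Fin m → Matrix ι κ R)
    (s : Fin m × ι) : BlockHomogeneous (Pi.single s.1 1) (blockForm A s) := by
  refine IsWeightedHomogeneous.sum _ _ _ fun j _ => IsWeightedHomogeneous.C_mul ?_ _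
  exact isWeightedHomogeneous_X _ _ (s.1, j)

lemma BlockHomogeneous.bind_blockForm {κ : Type*} [Fintype κ] {r : Fin m → ℕ}
    {f : MvPolynomial (Fin m × ι) R} (hf : BlockHomogeneous r f) (A : Fin m → Matrix ι κ R) :
    BlockHomogeneous r (bind₁ (blockForm A) f) :=
  isWeightedHomogeneous_bind₁ hf fun s => blockHomogeneous_blockForm A s

lemma bind_blockForm_bind {κ υ : Type*} [Fintype κ] [Fintype υ] (A : Fin m → Matrix ι κ R)
    (B : Fin m → Matrix κ υ R) (f : MvPolynomial (Fin m × ι) R) :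
    bind₁ (blockForm B) (bind₁ (blockForm A) f) = bind₁ (blockForm fun h => A h * B h) f := by
  rw [bind₁_bind₁]
  congr 2
  ext1 s
  simp only [blockForm, map_sum, map_mul, bind₁_C_right, bind₁_X_right, Matrix.mul_apply,
    Finset.mul_sum, Finset.sum_mul]
  rw [Finset.sum_comm]
  refine Finset.sum_congr rfl fun j _ => Finset.sum_congr rfl fun i _ => ?_
  ring

lemma bind_blockForm_one [Fintype ι] [DecidableEq ι] (f : MvPolynomial (Fin m × ι) R) :
    bind₁ (blockForm fun _ => (1 : Matrix ι ι R)) f = f := by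
  have : blockForm (fun _ : Fin m => (1 : Matrix ι ι R)) = X := by
    ext1 s
    rw [blockForm, Finset.sum_eq_single s.2]
    · simp
    · intro j _ hj; simp [Matrix.one_apply_ne hj.symm]
    · simp
  rw [this]
  rw [bind₁_X_left, AlgHom.id_apply]

lemma lOne_blockForm_le {κ : Type*} [Fintype κ] (ν : RingSeminorm R) (h1 : ν 1 ≤ 1)
    (A : Fin m → Matrix ι κ R) (s : Fin m × ι) :
    lOne ν (blockForm A s) ≤ ∑ j, ν (A s.1 s.2 j) := by
  refine (lOne_sum_le ν _ _).trans (Finset.sum_le_sum fun j _ => ?_)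
  refine (lOne_mul_le ν _ _).trans ?_
  rw [lOne_C, lOne_X]
  exact mul_le_of_le_one_right (apply_nonneg ν _) h1

lemma bind_C_mul {σ τ : Type*} (c : R) (s : σ → MvPolynomial τ R) (e : σ →₀ ℕ) (a : R) :
    bind₁ (fun i => C c * s i) (monomial e a) =
      C (c ^ (e.sum fun _ k => k)) * bind₁ s (monomial e a) := by
  rw [bind₁_monomial, bind₁_monomial]
  simp_rw [mul_pow]
  rw [Finset.prod_mul_distrib, Finset.prod_pow_eq_pow_sum, C_pow]
  rw [Finsupp.sum]
  ring

end

end SubspaceThm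

namespace SubspaceThm

open MvPolynomial NumberField

variable {ι : Type} [Fintype ι]

/-- The exponent vector attached to a family of exponent vectors of the blocks. -/
noncomputable def blockExp {m : ℕ} (κ : Fin m → ι → ℕ) : Fin m × ι →₀ ℕ :=
  Finsupp.equivFunOnFinite.symm fun s => κ s.1 s.2

lemma blockExp_apply {m : ℕ} (κ : Fin m → ι → ℕ) (h : Fin m) (i : ι) :
    blockExp κ (h, i) = κ h i := rfl

lemma blockExp_injective {m : ℕ} : Function.Injective (blockExp (ι := ι) (m := m)) := by
  intro κ κ' h
  ext u i
  rw [← blockExp_apply κ, h, blockExp_apply]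

lemma blockExp_surj {m : ℕ} (e : Fin m × ι →₀ ℕ) : blockExp (fun h i => e (h, i)) = e := by
  ext ⟨h, i⟩; rfl

lemma lOne_map_le_of_le {σ R S : Type*} [CommRing R] [CommRing S] (ν : RingSeminorm R)
    (μ : RingSeminorm S) (φ : R →+* S) (h : ∀ a, μ (φ a) ≤ ν a) (f : MvPolynomial σ R) :
    lOne μ (map φ f) ≤ lOne ν f := by
  rw [lOne_eq_sum μ (support_map_subset φ f), lOne]
  exact Finset.sum_le_sum fun e _ => by rw [coeff_map]; exact h _

lemma isAlgebraic_det {κ : Type*} [Fintype κ] [DecidableEq κ] {A : Matrix κ κ ℝ}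
    (hA : ∀ i j, IsAlgebraic ℚ (A i j)) : IsAlgebraic ℚ A.det := by
  rw [← mem_algebraicClosure_iff (F := ℚ) (E := ℝ)]
  rw [Matrix.det_apply]
  refine sum_mem fun σ _ => ?_
  rw [Units.smul_def]
  exact zsmul_mem (prod_mem fun i _ => mem_algebraicClosure_iff.mpr (hA _ _)) _

lemma isAlgebraic_inv {κ : Type*} [Fintype κ] [DecidableEq κ] {A : Matrix κ κ ℝ}
    (hA : ∀ i j, IsAlgebraic ℚ (A i j)) (i j : κ) : IsAlgebraic ℚ (A⁻¹ i j) := by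
  rw [Matrix.inv_def, Matrix.smul_apply, smul_eq_mul, Ring.inverse_eq_inv', Matrix.adjugate_apply]
  refine (isAlgebraic_det hA).inv.mul (isAlgebraic_det fun k l => ?_)
  rw [Matrix.updateRow_apply]
  split_ifs
  · rw [Pi.single_apply]
    split_ifs
    · exact isAlgebraic_one
    · exact isAlgebraic_zero
  · exact hA _ _

theorem exists_auxiliary [DecidableEq ι] [Nonempty ι] (L : Matrix ι ι ℝ) (hL : ∀ i j, IsAlgebraic ℚ (L i j))
    (hdet : L.det ≠ 0) {η : ℝ} (hη : 0 < η) :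
    ∃ (m : ℕ) (C : ℝ), 0 < m ∧ 1 ≤ C ∧ ∀ r : Fin m → ℕ, (∀ h, 0 < r h) →
      ∃ P : MvPolynomial (Fin m × ι) ℤ, P ≠ 0 ∧ BlockHomogeneous r P ∧
        lOne intAbs P ≤ C ^ ∑ h, r h ∧
        ∃ Q : MvPolynomial (Fin m × ι) ℝ,
          bind₁ (blockForm fun _ => L) Q = map (Int.castRingHom ℝ) P ∧
          BlockHomogeneous r Q ∧ lOne realAbs Q ≤ C ^ ∑ h, r h ∧
          ∀ e ∈ Q.support, ∀ i,
            |∑ h, (e (h, i) : ℝ) / r h - m / Fintype.card ι| ≤ η * m := by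
  classical
  obtain ⟨K, _, _, φ, D, M, hD, hM⟩ := exists_numberField_integral_multiple
    (fun s : ι × ι => L⁻¹ s.1 s.2) fun s => isAlgebraic_inv hL s.1 s.2
  obtain ⟨d, c, hd, hc, hsieg⟩ := exists_small_int_solution K
  let N := Fintype.card ι
  obtain ⟨m, hm⟩ := exists_nat_gt ((2 * d * N : ℝ) / η ^ 2)
  have hm0 : 0 < m := by
    have : (0 : ℝ) ≤ (2 * d * N : ℝ) / η ^ 2 := by positivity
    exact_mod_cast this.trans_lt hm
  let M' : Matrix ι ι (𝓞 K) := fun i j => M (i, j)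
  let ν := houseSeminorm K
  have hν1 : ν 1 ≤ 1 := houseSeminorm_one.le
  let B₁ : ℝ := 1 + ∑ i, ∑ j, ν (M' i j)
  let B₂ : ℝ := 1 + ∑ i, ∑ j, realAbs (L⁻¹ i j)
  have hB₁ : 1 ≤ B₁ := le_add_of_nonneg_right
    (Finset.sum_nonneg fun _ _ => Finset.sum_nonneg fun _ _ => apply_nonneg _ _)
  have hB₂ : 1 ≤ B₂ := le_add_of_nonneg_right
    (Finset.sum_nonneg fun _ _ => Finset.sum_nonneg fun _ _ => apply_nonneg _ _)
  let E : ℝ := 2 ^ N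
  have hE : 1 ≤ E := one_le_pow₀ (by norm_num)
  let C₀ : ℝ := c * E ^ 2 * B₁
  have hC₀ : 1 ≤ C₀ := one_le_mul_of_one_le_of_one_le
    (one_le_mul_of_one_le_of_one_le hc (one_le_pow₀ hE)) hB₁
  refine ⟨m, C₀ * B₂, hm0, one_le_mul_of_one_le_of_one_le hC₀ hB₂, fun r hr => ?_⟩
  set R := ∑ h, r h with hR
  have hR1 : 1 ≤ R := by
    have : r ⟨0, hm0⟩ ≤ R := Finset.single_le_sum (f := r) (fun _ _ => Nat.zero_le _) (Finset.mem_univ _)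
    exact (hr _).trans_le this
  let β := {κ // κ ∈ blockExponents ι r}
  let α := {κ // κ ∈ badExponents ι r η}
  have hcβ : Fintype.card β = (blockExponents ι r).card := Fintype.card_coe _
  have hcα : Fintype.card α = (badExponents ι r η).card := Fintype.card_coe _
  have hmono : ∀ (S : Type) [CommRing S] (l : β) (a : S),
      BlockHomogeneous r (monomial (blockExp l.1) a) := by
    intro S _ l a
    rw [blockHomogeneous_iff]
    intro e he h
    rw [Finset.mem_singleton.mp (support_monomial_subset he)]
    exact mem_blockExponents.mp l.2 h
  have hcβE : (Fintype.card β : ℝ) ≤ E ^ R := by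
    rw [hcβ]
    refine (Nat.cast_le.mpr (card_blockExponents_le r)).trans (le_of_eq ?_)
    simp [E, N, hR]
  obtain ⟨t, ht0, ht, htb⟩ := hsieg (α := α) (β := β)
    (fun k l => coeff (blockExp k.1) (bind₁ (blockForm fun _ => M') (monomial (blockExp l.1) 1)))
    (B₁ ^ R) (one_le_pow₀ hB₁) (by
      intro k l
      refine (coeff_le_lOne ν _ _).trans ?_
      refine (lOne_bind₁_le_pow ν hν1 _ _ hB₁ (fun s => ?_) (hmono _ l _).totalDegree_le).trans ?_
      · refine (lOne_blockForm_le ν hν1 _ _).trans ?_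
        refine le_trans (Finset.single_le_sum (f := fun i => ∑ j, ν (M' i j))
          (fun _ _ => Finset.sum_nonneg fun _ _ => apply_nonneg _ _) (Finset.mem_univ s.2)) ?_
        linarith
      · rw [lOne_monomial]
        exact mul_le_of_le_one_left (by positivity) hν1)
    (by
      have h1 := card_badExponents_le (ι := ι) hm0 hr hη
      rw [← hcα, ← hcβ] at h1
      rw [div_lt_iff₀ (by positivity)] at hm
      have hN : (0 : ℝ) < N := by exact_mod_cast Fintype.card_pos
      have h2 : (Fintype.card α : ℝ) * (2 * d * N) ≤ N * Fintype.card β :=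
        le_trans (mul_le_mul_of_nonneg_left (by linarith) (by positivity)) h1
      have h3 : (2 * d * Fintype.card α : ℝ) ≤ Fintype.card β :=
        le_of_mul_le_mul_right (by linarith) hN
      exact_mod_cast h3)
    (by rw [hcβ]; exact (blockExponents_nonempty r).card_pos)
  let P : MvPolynomial (Fin m × ι) ℤ := ∑ l : β, monomial (blockExp l.1) (t l)
  have hPhom : BlockHomogeneous r P :=
    IsWeightedHomogeneous.sum _ _ _ fun l _ => hmono ℤ l (t l)
  have hPcoeff : ∀ l : β, coeff (blockExp l.1) P = t l := by
    intro l
    simp only [P, coeff_sum, coeff_monomial]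
    rw [Finset.sum_eq_single l]
    · simp
    · intro k _ hk
      rw [if_neg]
      intro h
      exact hk (Subtype.ext (blockExp_injective h))
    · simp
  have hPb : lOne intAbs P ≤ C₀ ^ R := by
    calc lOne intAbs P ≤ ∑ l : β, |(t l : ℝ)| := by
          refine (lOne_sum_le _ _ _).trans (Finset.sum_le_sum fun l _ => ?_)
          rw [lOne_monomial, intAbs_apply]
      _ ≤ ∑ l : β, c * Fintype.card β * B₁ ^ R := Finset.sum_le_sum fun l _ => htb l
      _ = c * (Fintype.card β : ℝ) ^ 2 * B₁ ^ R := by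
          simp only [Finset.sum_const, Finset.card_univ, nsmul_eq_mul]; ring
      _ ≤ c ^ R * (E ^ R) ^ 2 * B₁ ^ R := by
          gcongr
          exact le_self_pow₀ hc (by omega)
      _ = C₀ ^ R := by
          simp only [C₀]; rw [mul_pow, mul_pow, pow_right_comm E 2 R]
  let Q : MvPolynomial (Fin m × ι) ℝ :=
    bind₁ (blockForm fun _ => L⁻¹) (map (Int.castRingHom ℝ) P)
  have hQhom : BlockHomogeneous r Q := (hPhom.map _).bind_blockForm _
  refine ⟨P, ?_, hPhom, hPb.trans ?_, Q, ?_, hQhom, ?_, ?_⟩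
  · intro h
    refine ht0 (funext fun l => ?_)
    rw [← hPcoeff, h]; simp
  · exact pow_le_pow_left₀ (by positivity) (le_mul_of_one_le_right (by positivity) hB₂) _
  · simp only [Q]
    rw [bind_blockForm_bind]
    simp_rw [Matrix.nonsing_inv_mul L (isUnit_iff_ne_zero.mpr hdet)]
    exact bind_blockForm_one _
  · rw [mul_pow]
    refine (lOne_bind₁_le_pow realAbs (by simp [realAbs_apply]) _ _ hB₂ (fun s => ?_)
      (hPhom.map _).totalDegree_le).trans ?_
    · refine (lOne_blockForm_le realAbs (by simp [realAbs_apply]) _ _).trans ?_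
      refine le_trans (Finset.single_le_sum (f := fun i => ∑ j, realAbs (L⁻¹ i j))
          (fun _ _ => Finset.sum_nonneg fun _ _ => apply_nonneg _ _) (Finset.mem_univ s.2)) ?_
      linarith
    · refine mul_le_mul_of_nonneg_right (le_trans ?_ hPb) (by positivity)
      exact lOne_map_le_of_le _ _ _ (fun a => by
        rw [intAbs_apply, realAbs_apply]; simp) _
  · intro e he i
    by_contra hcon
    push Not at hcon
    let k : α := ⟨fun h i => e (h, i), Finset.mem_filter.mpr
      ⟨mem_blockExponents.mpr (blockHomogeneous_iff.mp hQhom e he), i, hcon⟩⟩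
    have hke : blockExp k.1 = e := blockExp_surj e
    have h0 := congrArg (fun x => φ (algebraMap (𝓞 K) K x)) (ht k)
    simp only [map_sum, map_mul, map_zero, map_intCast] at h0
    have hterm : ∀ l : β, φ (algebraMap (𝓞 K) K (coeff (blockExp k.1)
        (bind₁ (blockForm fun _ => M') (monomial (blockExp l.1) 1)))) =
        (D : ℝ) ^ R * coeff (blockExp k.1) (bind₁ (blockForm fun _ => L⁻¹)
          (monomial (blockExp l.1) (1 : ℝ))) := by
      intro l
      have h1 := coeff_map (φ.comp (algebraMap (𝓞 K) K)) (bind₁ (blockForm fun _ : Fin m => M')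
        (monomial (blockExp l.1) 1)) (blockExp k.1)
      rw [RingHom.comp_apply] at h1
      rw [← h1, map_bind₁, map_monomial, map_one]
      have h2 : (fun s : Fin m × ι => map (φ.comp (algebraMap (𝓞 K) K))
          (blockForm (fun _ : Fin m => M') s)) =
          fun s => C (D : ℝ) * blockForm (fun _ : Fin m => L⁻¹) s := by
        ext1 s
        rw [map_blockForm, blockForm, blockForm, Finset.mul_sum]
        refine Finset.sum_congr rfl fun j _ => ?_
        rw [Matrix.map_apply, RingHom.comp_apply, hM, ← mul_assoc, ← C_mul]
      rw [h2, bind_C_mul, coeff_C_mul]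
      congr 2
      rw [Finsupp.sum_fintype _ _ (by simp), Fintype.sum_prod_type, hR]
      exact Finset.sum_congr rfl fun h _ => mem_blockExponents.mp l.2 h
    simp_rw [hterm] at h0
    rw [mem_support_iff] at he
    apply he
    have h3 : (D : ℝ) ^ R * coeff (blockExp k.1) Q = 0 := by
      rw [← h0]
      simp only [Q, P, map_sum, coeff_sum, Finset.mul_sum]
      refine Finset.sum_congr rfl fun l _ => ?_
      rw [map_monomial, ← mul_one ((Int.castRingHom ℝ) (t l)), ← C_mul_monomial, map_mul,
        bind₁_C_right, coeff_C_mul, eq_intCast]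
      ring
    rw [hke] at h3
    exact (mul_eq_zero.mp h3).resolve_left (pow_ne_zero _ (Int.cast_ne_zero.mpr hD))

end SubspaceThm

namespace SubspaceThm

open MvPolynomial

lemma coeff_bind_C_mul_X {σ R : Type*} [CommRing R] [Fintype σ] (d : σ → R) (f : MvPolynomial σ R)
    (e : σ →₀ ℕ) :
    coeff e (bind₁ (fun s => C (d s) * X s) f) = coeff e f * ∏ s, d s ^ e s := by
  classical
  induction f using MvPolynomial.induction_on' with
  | monomial u a =>
    have : bind₁ (fun s => C (d s) * X s) (monomial u a) = monomial u (a * ∏ s, d s ^ u s) := by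
      rw [bind₁_monomial, Finset.prod_subset (Finset.subset_univ _)
        (fun s _ hs => by rw [Finsupp.notMem_support_iff.mp hs, pow_zero])]
      simp_rw [mul_pow]
      rw [Finset.prod_mul_distrib, monomial_eq, Finsupp.prod_fintype _ _ (by simp), C_mul, map_prod]
      simp only [C_pow]
      ring
    rw [this, coeff_monomial, coeff_monomial]
    split_ifs with h
    · rw [h]
    · simp
  | add p q hp hq => rw [map_add, coeff_add, hp, hq, coeff_add, add_mul]

/-- The matrix with columns `g j` and one further column, a standard basis vector. -/
def frame {ι κ : Type*} [DecidableEq ι] (g : κ → ι → ℤ) (l : ι) : Matrix ι (Option κ) ℤ :=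
  fun i j => j.elim (if i = l then 1 else 0) fun j => g j i

/-- The weight measuring the index with respect to the distinguished variables. -/
noncomputable def noneWeight {κ : Type*} {m : ℕ} (r : Fin m → ℕ) (s : Fin m × Option κ) : ℝ :=
  s.2.elim (r s.1 : ℝ)⁻¹ fun _ => 0

lemma sum_noneWeight {κ : Type*} [Fintype κ] {m : ℕ} (r : Fin m → ℕ) (e : Fin m × Option κ →₀ ℕ) :
    ∑ s, noneWeight r s * e s = ∑ h, (r h : ℝ)⁻¹ * e (h, none) := by
  rw [Fintype.sum_prod_type]
  refine Finset.sum_congr rfl fun h _ => ?_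
  rw [Fintype.sum_option]
  simp [noneWeight]

lemma abs_weighted_le {ι : Type*} [Fintype ι] {c : ι → ℝ} {e : ι → ℕ} {r : ℕ} (h : ∑ i, e i = r)
    (hr : 0 < r) : |∑ i, c i * ((e i : ℝ) / r)| ≤ ∑ i, |c i| := by
  refine (Finset.abs_sum_le_sum_abs _ _).trans (Finset.sum_le_sum fun i _ => ?_)
  have hr' : (0 : ℝ) < r := by exact_mod_cast hr
  rw [abs_mul, abs_of_nonneg (a := (e i : ℝ) / r) (by positivity)]
  refine mul_le_of_le_one_right (abs_nonneg _) ?_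
  rw [div_le_one hr', ← h]
  exact_mod_cast Finset.single_le_sum (f := e) (fun _ _ => Nat.zero_le _) (Finset.mem_univ i)

/-- The exponent estimate for well distributed exponent vectors. -/
lemma sum_exponent_le {ι : Type*} [Fintype ι] {m : ℕ} {c : ι → ℝ} {r : Fin m → ℕ}
    (hr : ∀ h, 0 < r h) {e : Fin m × ι →₀ ℕ} (he : ∀ h, ∑ i, e (h, i) = r h)
    {η ρ R : ℝ} {q : Fin m → ℝ} (hR : 0 ≤ R) (h1 : ∀ h, R ≤ r h * q h)
    (h2 : ∀ h, r h * q h ≤ (1 + ρ) * R)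
    (hgood : ∀ i, |∑ h, (e (h, i) : ℝ) / r h - m / Fintype.card ι| ≤ η * m) :
    ∑ h, ∑ i, c i * q h * e (h, i) ≤
      m * R * ((∑ i, c i) / Fintype.card ι + (∑ i, |c i|) * (η + ρ)) := by
  have hsplit : ∀ h, ∑ i, c i * q h * e (h, i) =
      R * ∑ i, c i * ((e (h, i) : ℝ) / r h) +
        (r h * q h - R) * ∑ i, c i * ((e (h, i) : ℝ) / r h) := by
    intro h
    have hr' : (r h : ℝ) ≠ 0 := by exact_mod_cast (hr h).ne'
    rw [← add_mul, Finset.mul_sum]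
    refine Finset.sum_congr rfl fun i _ => ?_
    field_simp
    ring
  simp_rw [hsplit]
  rw [Finset.sum_add_distrib, ← Finset.mul_sum]
  have hA : ∑ h, ∑ i, c i * ((e (h, i) : ℝ) / r h) ≤
      m * ((∑ i, c i) / Fintype.card ι) + (∑ i, |c i|) * (η * m) := by
    rw [Finset.sum_comm]
    simp_rw [← Finset.mul_sum]
    have : ∀ i, c i * ∑ h, (e (h, i) : ℝ) / r h ≤ c i * (m / Fintype.card ι) + |c i| * (η * m) := by
      intro i
      have h3 : c i * (∑ h, (e (h, i) : ℝ) / r h - m / Fintype.card ι) ≤ |c i| * (η * m) := by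
        refine (le_abs_self _).trans ?_
        rw [abs_mul]
        exact mul_le_mul_of_nonneg_left (hgood i) (abs_nonneg _)
      linarith
    refine (Finset.sum_le_sum fun i _ => this i).trans (le_of_eq ?_)
    rw [Finset.sum_add_distrib, ← Finset.sum_mul, ← Finset.sum_mul]
    ring
  have hB : ∑ h, (r h * q h - R) * ∑ i, c i * ((e (h, i) : ℝ) / r h) ≤
      m * (ρ * R * ∑ i, |c i|) := by
    have : ∀ h, (r h * q h - R) * ∑ i, c i * ((e (h, i) : ℝ) / r h) ≤ ρ * R * ∑ i, |c i| := by
      intro h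
      have h3 := (le_abs_self _).trans (abs_weighted_le (c := c) (he h) (hr h))
      have h4 : 0 ≤ r h * q h - R := sub_nonneg.mpr (h1 h)
      have h5 : r h * q h - R ≤ ρ * R := by linarith [h2 h]
      have h6 : (0 : ℝ) ≤ ∑ i, |c i| := Finset.sum_nonneg fun _ _ => abs_nonneg _
      calc _ ≤ (r h * q h - R) * ∑ i, |c i| := mul_le_mul_of_nonneg_left h3 h4
        _ ≤ _ := mul_le_mul_of_nonneg_right h5 h6
    refine (Finset.sum_le_sum fun h _ => this h).trans (le_of_eq ?_)
    simp
  have hA' := mul_le_mul_of_nonneg_left hA hR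
  refine (add_le_add hA' hB).trans (le_of_eq ?_)
  ring

lemma abs_coeff_frame_le {ι κ : Type} [Fintype ι] [DecidableEq ι] [Fintype κ] (L : Matrix ι ι ℝ)
    {c : ι → ℝ} {m : ℕ} {r : Fin m → ℕ} (hr : ∀ h, 0 < r h) {q : Fin m → ℝ} (hq : ∀ h, 0 ≤ q h)
    {R η ρ A B : ℝ} (hR : 0 ≤ R) (hA : ∀ i, |c i| ≤ A)
    (h1 : ∀ h, R ≤ r h * q h) (h2 : ∀ h, r h * q h ≤ (1 + ρ) * R)
    {P : MvPolynomial (Fin m × ι) ℤ} {Q : MvPolynomial (Fin m × ι) ℝ}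
    (hPQ : bind₁ (blockForm fun _ => L) Q = map (Int.castRingHom ℝ) P) (hQ : BlockHomogeneous r Q)
    (hgood : ∀ e ∈ Q.support, ∀ i,
            |∑ h, (e (h, i) : ℝ) / r h - m / Fintype.card ι| ≤ η * m)
    (hB : ∀ i k, Fintype.card κ + |L i k| ≤ B)
    {g : Fin m → κ → ι → ℤ} (hg : ∀ h j i, |∑ k, L i k * g h j k| ≤ Real.exp (c i * q h))
    (l : Fin m → ι) (e : Fin m × Option κ →₀ ℕ) :
    |((coeff e (bind₁ (blockForm fun h => frame (g h) (l h)) P) : ℤ) : ℝ)| ≤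
      lOne realAbs Q * B ^ (∑ h, r h) *
      Real.exp (m * R * ((∑ i, c i) / Fintype.card ι + (∑ i, |c i|) * (η + ρ))) *
      Real.exp (A * ∑ h, q h * e (h, none)) := by
  classical
  let G : Fin m → Matrix ι (Option κ) ℝ := fun h => (frame (g h) (l h)).map (Int.castRingHom ℝ)
  let d : Fin m × Option κ → ℝ := fun s => s.2.elim (Real.exp (-(A * q s.1))) fun _ => 1
  let G' : Fin m → Matrix ι (Option κ) ℝ := fun h => (L * G h) * Matrix.diagonal fun j => d (h, j)
  have hbind : bind₁ (fun s => C (d s) * X s)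
      (map (Int.castRingHom ℝ) (bind₁ (blockForm fun h => frame (g h) (l h)) P)) =
      bind₁ (blockForm G') Q := by
    rw [map_bind₁]
    simp_rw [map_blockForm]
    rw [← hPQ, bind_blockForm_bind, ← bind_blockForm_bind (fun h => L * G h)]
    congr 2
    ext1 s
    rw [blockForm, Finset.sum_eq_single s.2]
    · simp
    · intro j _ hj; simp [Matrix.diagonal_apply_ne _ hj.symm]
    · simp
  have hcoeff := congrArg (coeff e) hbind
  rw [coeff_bind_C_mul_X, coeff_map, eq_intCast] at hcoeff
  have hprod : ∏ s, d s ^ e s = Real.exp (-(A * ∑ h, q h * e (h, none))) := by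
    rw [Fintype.prod_prod_type, Finset.mul_sum, ← Finset.sum_neg_distrib, Real.exp_sum]
    refine Finset.prod_congr rfl fun h _ => ?_
    rw [Fintype.prod_option]
    simp only [d, Option.elim, one_pow, Finset.prod_const_one, mul_one]
    rw [← Real.exp_nat_mul]
    ring_nf
  have hB0 : ∀ i k, 0 ≤ B := fun i k => le_trans (by positivity) (hB i k)
  have hform : ∀ s : Fin m × ι, lOne realAbs (blockForm G' s) ≤ B * Real.exp (c s.2 * q s.1) := by
    rintro ⟨h, i⟩
    refine (lOne_blockForm_le realAbs (by simp [realAbs_apply]) _ _).trans ?_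
    rw [Fintype.sum_option]
    have hLG : ∀ j, (L * G h) i (some j) = ∑ k, L i k * g h j k := by
      intro j; simp [Matrix.mul_apply, G, frame]
    have hLn : (L * G h) i none = L i (l h) := by
      rw [Matrix.mul_apply, Finset.sum_eq_single (l h)]
      · simp [G, frame]
      · intro k _ hk; simp [G, frame, hk]
      · simp
    simp only [G', Matrix.mul_diagonal, hLG, hLn, realAbs_apply, d, Option.elim, mul_one]
    have e1 : ∑ j : κ, |∑ k, L i k * g h j k| ≤ Fintype.card κ * Real.exp (c i * q h) := by
      refine (Finset.sum_le_sum fun j _ => hg h j i).trans (le_of_eq (by simp))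
    have e2 : |L i (l h) * Real.exp (-(A * q h))| ≤ |L i (l h)| * Real.exp (c i * q h) := by
      rw [abs_mul, Real.abs_exp]
      refine mul_le_mul_of_nonneg_left (Real.exp_le_exp.mpr ?_) (abs_nonneg _)
      have := neg_le_of_abs_le (hA i)
      nlinarith [hq h]
    have e3 := mul_le_mul_of_nonneg_right (hB i (l h)) (Real.exp_pos (c i * q h)).le
    linarith
  have hl : lOne realAbs (bind₁ (blockForm G') Q) ≤ lOne realAbs Q * B ^ (∑ h, r h) *
      Real.exp (m * R * ((∑ i, c i) / Fintype.card ι + (∑ i, |c i|) * (η + ρ))) := by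
    refine (lOne_bind₁_le realAbs (by simp [realAbs_apply]) _ _).trans ?_
    rw [lOne, mul_assoc, Finset.sum_mul]
    refine Finset.sum_le_sum fun u hu => mul_le_mul_of_nonneg_left ?_ (apply_nonneg _ _)
    have hu' := blockHomogeneous_iff.mp hQ u hu
    rw [Finset.prod_subset (Finset.subset_univ _)
        (fun s _ hs => by rw [Finsupp.notMem_support_iff.mp hs, pow_zero])]
    calc _ ≤ ∏ s : Fin m × ι, (B * Real.exp (c s.2 * q s.1)) ^ u s :=
          Finset.prod_le_prod (fun s _ => pow_nonneg (lOne_nonneg _ _) _)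
            fun s _ => pow_le_pow_left₀ (lOne_nonneg _ _) (hform s) _
      _ = B ^ (∑ h, r h) * Real.exp (∑ h, ∑ i, c i * q h * u (h, i)) := by
          simp_rw [mul_pow]
          rw [Finset.prod_mul_distrib, Finset.prod_pow_eq_pow_sum, Fintype.sum_prod_type]
          simp_rw [hu', ← Real.exp_nat_mul]
          rw [← Real.exp_sum, Fintype.sum_prod_type]
          congr 2
          refine Finset.sum_congr rfl fun h _ => Finset.sum_congr rfl fun i _ => ?_
          ring
      _ ≤ _ := by
          refine mul_le_mul_of_nonneg_left (Real.exp_le_exp.mpr ?_) ?_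
          · exact sum_exponent_le hr hu' hR h1 h2 (hgood u hu)
          · rcases isEmpty_or_nonempty ι with hι | ⟨⟨i⟩⟩
            · have : ∑ h, r h = 0 := Finset.sum_eq_zero fun h _ => by rw [← hu' h]; simp
              rw [this]; simp
            · exact pow_nonneg (hB0 i i) _
  have hfin := (coeff_le_lOne realAbs (bind₁ (blockForm G') Q) e).trans hl
  rw [← hcoeff, hprod, realAbs_apply, abs_mul, Real.abs_exp, Real.exp_neg, ← div_eq_mul_inv,
    div_le_iff₀ (Real.exp_pos _)] at hfin
  exact hfin

theorem exists_vanishing {ι κ : Type} [Fintype ι] [DecidableEq ι] [Nonempty ι] [Fintype κ]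
    (L : Matrix ι ι ℝ) (hL : ∀ i j, IsAlgebraic ℚ (L i j)) (hdet : L.det ≠ 0) (c : ι → ℝ)
    (hc : ∑ i, c i < 0) :
    ∃ (m : ℕ) (θ C ρ q₁ : ℝ), 0 < m ∧ 0 < θ ∧ 1 ≤ C ∧ 0 < ρ ∧ ρ ≤ 1 ∧ 1 ≤ q₁ ∧
      ∀ (r : Fin m → ℕ) (q : Fin m → ℝ) (R : ℝ), (∀ h, 0 < r h) → (∀ h, q₁ ≤ q h) → 0 < R →
        (∀ h, R ≤ r h * q h) → (∀ h, r h * q h ≤ (1 + ρ) * R) →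
        ∃ P : MvPolynomial (Fin m × ι) ℤ, P ≠ 0 ∧ BlockHomogeneous r P ∧
          lOne intAbs P ≤ C ^ ∑ h, r h ∧
          ∀ g : Fin m → κ → ι → ℤ,
            (∀ h j i, |∑ k, L i k * g h j k| ≤ Real.exp (c i * q h)) →
            ∀ l : Fin m → ι,
              IndexGE (noneWeight r) θ (bind₁ (blockForm fun h => frame (g h) (l h)) P) := by
  have hN : (0 : ℝ) < Fintype.card ι := by exact_mod_cast Fintype.card_pos
  obtain ⟨σ, hσdef⟩ : ∃ σ : ℝ, σ = -((∑ i, c i) / Fintype.card ι) := ⟨_, rfl⟩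
  obtain ⟨S, hSdef⟩ : ∃ S : ℝ, S = ∑ i, |c i| := ⟨_, rfl⟩
  have hσ : 0 < σ := by rw [hσdef, neg_pos]; exact div_neg_of_neg_of_pos hc hN
  have hS : 0 ≤ S := by rw [hSdef]; exact Finset.sum_nonneg fun _ _ => abs_nonneg _
  obtain ⟨ρ, hρdef⟩ : ∃ ρ : ℝ, ρ = min 1 (σ / (8 * (S + 1))) := ⟨_, rfl⟩
  have hρ0 : 0 < ρ := by rw [hρdef]; positivity
  have hρ1 : ρ ≤ 1 := by rw [hρdef]; exact min_le_left _ _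
  have hρS : S * (ρ + ρ) ≤ σ / 4 := by
    have h1 : ρ ≤ σ / (8 * (S + 1)) := by rw [hρdef]; exact min_le_right _ _
    rw [le_div_iff₀ (by positivity)] at h1
    nlinarith
  obtain ⟨m, C, hm, hC, hP⟩ := exists_auxiliary L hL hdet hρ0
  have hm' : (0 : ℝ) < m := by exact_mod_cast hm
  obtain ⟨B, hBdef⟩ : ∃ B : ℝ, B = 1 + Fintype.card κ + ∑ i, ∑ k, |L i k| := ⟨_, rfl⟩
  have hLB : ∀ i k, Fintype.card κ + |L i k| ≤ B := by
    intro i k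
    have h1 : |L i k| ≤ ∑ k, |L i k| :=
      Finset.single_le_sum (f := fun k => |L i k|) (fun _ _ => abs_nonneg _) (Finset.mem_univ k)
    have h2 : ∑ k, |L i k| ≤ ∑ i, ∑ k, |L i k| :=
      Finset.single_le_sum (f := fun i => ∑ k, |L i k|)
        (fun _ _ => Finset.sum_nonneg fun _ _ => abs_nonneg _) (Finset.mem_univ i)
    rw [hBdef]; linarith
  have hB : 1 ≤ B := by
    have : 0 ≤ ∑ i, ∑ k, |L i k| :=
      Finset.sum_nonneg fun _ _ => Finset.sum_nonneg fun _ _ => abs_nonneg _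
    rw [hBdef]
    have h0 : (0 : ℝ) ≤ Fintype.card κ := by positivity
    linarith
  have hCB : 1 ≤ C * B := one_le_mul_of_one_le_of_one_le hC hB
  have hlog : 0 ≤ Real.log (C * B) := Real.log_nonneg hCB
  obtain ⟨A, hAdef⟩ : ∃ A : ℝ, A = S + 1 := ⟨_, rfl⟩
  have hA : 0 < A := by linarith
  refine ⟨m, σ / (16 * A) * m, C, ρ, 1 + 8 * Real.log (C * B) / σ, hm, by positivity, hC, hρ0, hρ1,
    by have : 0 ≤ 8 * Real.log (C * B) / σ := by positivity
       linarith, fun r q R hr hq hR h1 h2 => ?_⟩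
  have hq₁ : (1 : ℝ) ≤ 1 + 8 * Real.log (C * B) / σ := by
    have : 0 ≤ 8 * Real.log (C * B) / σ := by positivity
    linarith
  have hqpos : ∀ h, 0 < q h := fun h => by linarith [hq h]
  obtain ⟨P, hP0, hPhom, hPb, Q, hPQ, hQhom, hQb, hQgood⟩ := hP r hr
  refine ⟨P, hP0, hPhom, hPb, fun g hg l e he => ?_⟩
  rw [sum_noneWeight]
  by_contra hcon
  push Not at hcon
  apply he
  have hb := abs_coeff_frame_le (κ := κ) L hr (fun h => (hqpos h).le) hR.le (A := A) (c := c)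
    (fun i => by
      rw [hAdef, hSdef]
      have := Finset.single_le_sum (f := fun i => |c i|) (fun _ _ => abs_nonneg _) (Finset.mem_univ i)
      linarith) h1 h2 hPQ hQhom hQgood hLB hg l e
  have hr1 : ((∑ h, r h : ℕ) : ℝ) * Real.log (C * B) ≤ m * R * (σ / 4) := by
    have : ∀ h, (r h : ℝ) * Real.log (C * B) ≤ R * (σ / 4) := by
      intro h
      have h3 : 8 * Real.log (C * B) ≤ q h * σ := by
        have := hq h
        have h4 : 8 * Real.log (C * B) / σ ≤ q h := by linarith
        rwa [div_le_iff₀ hσ] at h4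
      have h5 : r h * q h ≤ 2 * R := (h2 h).trans (by nlinarith)
      have hrp : (0 : ℝ) < r h := by exact_mod_cast hr h
      nlinarith
    push_cast
    rw [Finset.sum_mul]
    refine (Finset.sum_le_sum fun h _ => this h).trans (le_of_eq ?_)
    simp; ring
  have hr2 : A * ∑ h, q h * e (h, none) ≤ m * R * (σ / 8) := by
    have : ∀ h, q h * e (h, none) ≤ 2 * R * ((r h : ℝ)⁻¹ * e (h, none)) := by
      intro h
      have hrp : (0 : ℝ) < r h := by exact_mod_cast hr h
      have h5 : r h * q h ≤ 2 * R := (h2 h).trans (by nlinarith)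
      rw [← mul_assoc]
      refine mul_le_mul_of_nonneg_right ?_ (by positivity)
      rw [← div_eq_mul_inv, le_div_iff₀ hrp]
      linarith
    have h6 := (Finset.sum_le_sum fun h (_ : h ∈ Finset.univ) => this h)
    rw [← Finset.mul_sum] at h6
    have h7 : ∑ h, q h * e (h, none) ≤ 2 * R * (σ / (16 * A) * m) := by
      refine h6.trans (mul_le_mul_of_nonneg_left ?_ (by positivity))
      exact hcon.le
    refine (mul_le_mul_of_nonneg_left h7 hA.le).trans (le_of_eq ?_)
    field_simp
    ring
  have hlt : |((coeff e (bind₁ (blockForm fun h => frame (g h) (l h)) P) : ℤ) : ℝ)| < 1 := by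
    refine hb.trans_lt ?_
    calc _ ≤ C ^ (∑ h, r h) * B ^ (∑ h, r h) *
          Real.exp (m * R * ((∑ i, c i) / Fintype.card ι + (∑ i, |c i|) * (ρ + ρ))) *
          Real.exp (A * ∑ h, q h * e (h, none)) := by gcongr
      _ = Real.exp (((∑ h, r h : ℕ) : ℝ) * Real.log (C * B) +
          m * R * ((∑ i, c i) / Fintype.card ι + (∑ i, |c i|) * (ρ + ρ)) +
          A * ∑ h, q h * e (h, none)) := by
          rw [Real.exp_add, Real.exp_add, Real.exp_nat_mul, Real.exp_log (by positivity), mul_pow]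
      _ < 1 := by
          rw [Real.exp_lt_one_iff]
          rw [← hSdef, show (∑ i, c i) / Fintype.card ι = -σ by rw [hσdef, neg_neg]]
          have hmR : 0 < m * R := by positivity
          nlinarith
  have : |coeff e (bind₁ (blockForm fun h => frame (g h) (l h)) P)| < 1 := by exact_mod_cast hlt
  exact Int.abs_lt_one_iff.mp this

end SubspaceThm

namespace SubspaceThm

open MvPolynomial

lemma coeff_eval₂Hom_of_minimal {σ A B : Type*} [CommRing A] [CommRing B]
    (φ : A →+* MvPolynomial σ B) (T : MvPolynomial σ A) {α : σ →₀ ℕ}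
    (hα : ∀ β ∈ T.support, β ≤ α → β = α) :
    coeff α (eval₂Hom φ X T) = coeff 0 (φ (coeff α T)) := by
  classical
  rw [coe_eval₂Hom, eval₂_eq, coeff_sum]
  have hterm : ∀ β, coeff α (φ (coeff β T) * ∏ i ∈ β.support, (X i : MvPolynomial σ B) ^ β i) =
      if β ≤ α then coeff (α - β) (φ (coeff β T)) else 0 := by
    intro β
    have : ∏ i ∈ β.support, (X i : MvPolynomial σ B) ^ β i = monomial β 1 := by
      rw [monomial_eq, C_1, one_mul]; rfl
    rw [this, coeff_mul_monomial', mul_one]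
  simp_rw [hterm]
  by_cases hmem : α ∈ T.support
  · rw [Finset.sum_eq_single α]
    · simp
    · intro β hβ hne
      rw [if_neg]
      exact fun h => hne (hα β hβ h)
    · exact fun h => (h hmem).elim
  · rw [notMem_support_iff.mp hmem, map_zero, coeff_zero]
    refine Finset.sum_eq_zero fun β hβ => if_neg fun h => ?_
    exact hmem (hα β hβ h ▸ hβ)

lemma indexGE_coeff_aeval {σ κ : Type*} [Fintype κ] {m : ℕ} {r : Fin m → ℕ} {θ : ℝ}
    {F : MvPolynomial (Fin m × Option κ) ℚ} (hF : IndexGE (noneWeight r) θ F)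
    (v : Fin m × Option κ → MvPolynomial σ (MvPolynomial (Fin m) ℚ))
    (hv : ∀ h, v (h, none) = C (X h)) (β : σ →₀ ℕ) :
    IndexGE (fun h => (r h : ℝ)⁻¹) θ (coeff β (aeval v F)) := by
  classical
  rw [aeval_def, eval₂_eq', coeff_sum]
  refine IndexGE.sum _ fun e he => ?_
  have h1 : ∏ s, v s ^ e s = C (∏ h, X h ^ e (h, none)) * ∏ h, ∏ j, v (h, some j) ^ e (h, some j) := by
    rw [Fintype.prod_prod_type, map_prod, ← Finset.prod_mul_distrib]
    refine Finset.prod_congr rfl fun h _ => ?_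
    rw [Fintype.prod_option, hv, C_pow]
  have h2 : algebraMap ℚ (MvPolynomial σ (MvPolynomial (Fin m) ℚ)) (coeff e F) = C (C (coeff e F)) :=
    rfl
  rw [h1, h2, ← mul_assoc, ← C_mul, coeff_C_mul]
  have h3 : C (coeff e F) * ∏ h, (X h : MvPolynomial (Fin m) ℚ) ^ e (h, none) =
      monomial (Finsupp.equivFunOnFinite.symm fun h => e (h, none)) (coeff e F) := by
    rw [monomial_eq, Finsupp.prod_fintype _ _ (by simp)]
    rfl
  rw [h3]
  have h4 : IndexGE (fun h => (r h : ℝ)⁻¹) θ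
      (monomial (Finsupp.equivFunOnFinite.symm fun h => e (h, none)) (coeff e F)) := by
    intro u hu
    rw [coeff_monomial] at hu
    split_ifs at hu with h
    · rw [← h]
      have := hF e hu
      rw [sum_noneWeight] at this
      simpa using this
    · exact (hu rfl).elim
  have := h4.mul (indexGE_zero_of_nonneg (fun h => by positivity)
    (coeff β (∏ h, ∏ j, v (h, some j) ^ e (h, some j))))
  rwa [add_zero] at this

section Specialize

variable {ι R S : Type*} [Fintype ι] [DecidableEq ι] {m : ℕ} [CommRing R] [CommRing S]
  (l l' : Fin m → ι)

/-- Specialization of one variable of each block to `1` and separation of another one. -/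
noncomputable def specialize : MvPolynomial (Fin m × ι) R →ₐ[R]
    MvPolynomial (Fin m × ι) (MvPolynomial (Fin m) R) :=
  aeval fun s => if s.2 = l s.1 then C (X s.1) else if s.2 = l' s.1 then 1 else X s

/-- The exponents of the separated variables. -/
noncomputable def sepExp (e : Fin m × ι →₀ ℕ) : Fin m →₀ ℕ :=
  Finsupp.equivFunOnFinite.symm fun h => e (h, l h)

/-- The exponents of the remaining variables. -/
noncomputable def restExp (e : Fin m × ι →₀ ℕ) : Fin m × ι →₀ ℕ :=
  Finsupp.equivFunOnFinite.symm fun s => if s.2 = l s.1 then 0 else if s.2 = l' s.1 then 0 else e s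

lemma specialize_eq (P : MvPolynomial (Fin m × ι) R) :
    specialize l l' P = ∑ e ∈ P.support,
      monomial (restExp l l' e) (monomial (sepExp l e) (coeff e P)) := by
  rw [specialize, aeval_def, eval₂_eq']
  refine Finset.sum_congr rfl fun e _ => ?_
  have h2 : algebraMap R (MvPolynomial (Fin m × ι) (MvPolynomial (Fin m) R)) (coeff e P) =
    C (C (coeff e P)) := rfl
  rw [h2, monomial_eq (s := restExp l l' e), monomial_eq (s := sepExp l e),
    Finsupp.prod_fintype _ _ (by simp), Finsupp.prod_fintype _ _ (by simp), C_mul, mul_assoc]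
  congr 1
  rw [Fintype.prod_prod_type, Fintype.prod_prod_type, map_prod, ← Finset.prod_mul_distrib]
  refine Finset.prod_congr rfl fun h _ => ?_
  rw [← Finset.mul_prod_erase _ _ (Finset.mem_univ (l h)),
    ← Finset.mul_prod_erase Finset.univ (fun i => X (h, i) ^ restExp l l' e (h, i))
      (Finset.mem_univ (l h))]
  simp only [restExp, sepExp, Finsupp.coe_equivFunOnFinite_symm, if_true, pow_zero, one_mul, C_pow]
  congr 1
  refine Finset.prod_congr rfl fun i hi => ?_
  rw [if_neg (Finset.ne_of_mem_erase hi), if_neg (Finset.ne_of_mem_erase hi)]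
  split_ifs <;> simp

lemma coeff_specialize (P : MvPolynomial (Fin m × ι) R) (α : Fin m × ι →₀ ℕ) :
    coeff α (specialize l l' P) = ∑ e ∈ P.support with restExp l l' e = α,
      monomial (sepExp l e) (coeff e P) := by
  rw [specialize_eq, coeff_sum, Finset.sum_filter]
  exact Finset.sum_congr rfl fun e _ => coeff_monomial _ _ _

lemma lOne_coeff_specialize_le (ν : RingSeminorm R) (P : MvPolynomial (Fin m × ι) R)
    (α : Fin m × ι →₀ ℕ) : lOne ν (coeff α (specialize l l' P)) ≤ lOne ν P := by
  rw [coeff_specialize]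
  refine (lOne_sum_le ν _ _).trans ?_
  simp_rw [lOne_monomial]
  exact Finset.sum_le_sum_of_subset_of_nonneg (Finset.filter_subset _ _)
    fun _ _ _ => apply_nonneg _ _

lemma degreeOf_coeff_specialize_le {r : Fin m → ℕ} {P : MvPolynomial (Fin m × ι) R}
    (hP : BlockHomogeneous r P) (α : Fin m × ι →₀ ℕ) (h : Fin m) :
    degreeOf h (coeff α (specialize l l' P)) ≤ r h := by
  rw [coeff_specialize]
  refine (degreeOf_sum_le _ _ _).trans (Finset.sup_le fun e he => ?_)
  have hs := blockHomogeneous_iff.mp hP e (Finset.mem_filter.mp he).1 h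
  refine (degreeOf_le_iff.mpr fun u hu => ?_)
  rw [Finset.mem_singleton.mp (support_monomial_subset hu), ← hs]
  exact Finset.single_le_sum (f := fun i => e (h, i)) (fun _ _ => Nat.zero_le _)
    (Finset.mem_univ (l h))

lemma specialize_ne_zero {r : Fin m → ℕ} {P : MvPolynomial (Fin m × ι) R}
    (hP : BlockHomogeneous r P) (hP0 : P ≠ 0) : specialize l l' P ≠ 0 := by
  obtain ⟨e₀, he₀⟩ := support_nonempty.mpr hP0
  intro h0
  have h1 := congrArg (fun T => coeff (sepExp l e₀) (coeff (restExp l l' e₀) T)) h0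
  simp only [coeff_specialize, coeff_sum, coeff_monomial, coeff_zero] at h1
  rw [Finset.sum_eq_single e₀, if_pos rfl] at h1
  · exact mem_support_iff.mp he₀ h1
  · intro e he hne
    obtain ⟨he, hrest⟩ := Finset.mem_filter.mp he
    refine if_neg fun hsep => hne ?_
    have hb := blockHomogeneous_iff.mp hP
    have hoff : ∀ h i, i ≠ l' h → e (h, i) = e₀ (h, i) := by
      intro h i hi
      by_cases hil : i = l h
      · have := DFunLike.congr_fun hsep h
        simp only [sepExp, Finsupp.coe_equivFunOnFinite_symm] at this
        rw [hil]; exact this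
      · have := DFunLike.congr_fun hrest (h, i)
        simpa only [restExp, Finsupp.coe_equivFunOnFinite_symm, hil, hi, if_false] using this
    ext ⟨h, i⟩
    by_cases hi : i = l' h
    · have s1 := hb e he h
      have s2 := hb e₀ he₀ h
      rw [← Finset.add_sum_erase _ _ (Finset.mem_univ (l' h))] at s1 s2
      have : ∑ x ∈ Finset.univ.erase (l' h), e (h, x) =
          ∑ x ∈ Finset.univ.erase (l' h), e₀ (h, x) :=
        Finset.sum_congr rfl fun x hx => hoff h x (Finset.ne_of_mem_erase hx)
      rw [hi]; omega
    · exact hoff h i hi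
  · intro hn
    exact (hn (Finset.mem_filter.mpr ⟨he₀, rfl⟩)).elim

lemma specialize_map (φ : R →+* S) (P : MvPolynomial (Fin m × ι) R) (α : Fin m × ι →₀ ℕ) :
    coeff α (specialize l l' (MvPolynomial.map φ P)) =
      MvPolynomial.map φ (coeff α (specialize l l' P)) := by
  rw [specialize_eq, specialize_eq, coeff_sum, coeff_sum, map_sum]
  refine (Finset.sum_subset (support_map_subset φ P) fun e _ he => ?_).trans ?_
  · rw [notMem_support_iff.mp he]; simp
  · refine Finset.sum_congr rfl fun e _ => ?_
    rw [coeff_monomial, coeff_monomial, coeff_map]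
    split_ifs <;> simp

end Specialize

end SubspaceThm

namespace SubspaceThm

open MvPolynomial

lemma IndexGE.map {σ R S : Type*} [Fintype σ] [CommRing R] [CommRing S] {w : σ → ℝ} {θ : ℝ}
    {f : MvPolynomial σ R} (hf : IndexGE w θ f) (φ : R →+* S) :
    IndexGE w θ (MvPolynomial.map φ f) := by
  intro e he
  refine hf e fun h => he ?_
  rw [coeff_map, h, map_zero]

/-- Passage to one variable in each block. -/
theorem exists_one_variable_per_block {ι κ : Type} [Fintype ι] [DecidableEq ι] [Fintype κ] {m : ℕ}
    {r : Fin m → ℕ} {P : MvPolynomial (Fin m × ι) ℤ} (hP0 : P ≠ 0) (hP : BlockHomogeneous r P)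
    {l l' : Fin m → ι} (hl : ∀ h, l h ≠ l' h) {g : Fin m → κ → ι → ℤ} {V : Fin m → ι → ℤ}
    (hV : ∀ h, V h (l h) ≠ 0) (hVg : ∀ h j, ∑ i, V h i * g h j i = 0)
    {H : Fin m → Matrix (Option κ) ι ℚ}
    (hH : ∀ h, (frame (g h) (l h)).map (Int.castRingHom ℚ) * H h = 1) {θ : ℝ}
    (hF : IndexGE (noneWeight r) θ (bind₁ (blockForm fun h => frame (g h) (l h)) P)) :
    ∃ f : MvPolynomial (Fin m) ℤ, f ≠ 0 ∧ (∀ h, degreeOf h f ≤ r h) ∧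
      lOne intAbs f ≤ lOne intAbs P ∧
      IndexGE (fun h => (r h : ℝ)⁻¹) θ
        (shift (fun h => -((V h (l' h) : ℚ) / V h (l h))) (map (Int.castRingHom ℚ) f)) := by
  classical
  have hVq : ∀ h, (V h (l h) : ℚ) ≠ 0 := fun h => Int.cast_ne_zero.mpr (hV h)
  have hHnone : ∀ h i, (V h (l h) : ℚ) * H h none i = V h i := by
    intro h i
    have h1 : Matrix.vecMul (fun k => (V h k : ℚ)) ((frame (g h) (l h)).map (Int.castRingHom ℚ)) =
        fun j => j.elim (V h (l h) : ℚ) fun _ => 0 := by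
      ext j
      rcases j with _ | j
      · simp [Matrix.vecMul, dotProduct, frame]
      · have := hVg h j
        simp only [Matrix.vecMul, dotProduct, frame, Matrix.map_apply, Option.elim, eq_intCast]
        exact_mod_cast this
    have h2 := congrFun (congrArg (fun M => Matrix.vecMul (fun k => (V h k : ℚ)) M) (hH h)) i
    simp only [← Matrix.vecMul_vecMul, h1, Matrix.vecMul_one] at h2
    rw [← h2]
    simp [Matrix.vecMul, dotProduct, Fintype.sum_option]
  have hT0 := specialize_ne_zero l l' hP hP0
  obtain ⟨α, hαmem, hαmin⟩ : ∃ α ∈ (specialize l l' P).support,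
      ∀ β ∈ (specialize l l' P).support, β ≤ α → β = α := by
    obtain ⟨α, hα⟩ := (specialize l l' P).support.exists_minimal (support_nonempty.mpr hT0)
    exact ⟨α, hα.1, fun β hβ hle => le_antisymm hle (hα.2 hβ hle)⟩
  refine ⟨coeff α (specialize l l' P), mem_support_iff.mp hαmem,
    degreeOf_coeff_specialize_le l l' hP α, lOne_coeff_specialize_le l l' _ _ _, ?_⟩
  set ξ : Fin m → ℚ := fun h => -((V h (l' h) : ℚ) / V h (l h)) with hξ
  let φ : MvPolynomial (Fin m) ℚ →ₐ[ℚ] MvPolynomial (Fin m × ι) (MvPolynomial (Fin m) ℚ) :=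
    aeval fun h => C (X h + C (ξ h)) - ∑ i ∈ (Finset.univ.erase (l h)).erase (l' h),
      C (C ((V h i : ℚ) / V h (l h))) * X (h, i)
  have hφ0 : ∀ f, coeff 0 (φ f) = shift ξ f := by
    intro f
    let ψ : MvPolynomial (Fin m) ℚ →+* MvPolynomial (Fin m) ℚ := (constantCoeff).comp φ.toRingHom
    have : ψ = (shift ξ).toRingHom := by
      refine MvPolynomial.ringHom_ext (fun a => ?_) fun h => ?_
      · have e1 : φ (C a) = C (C a) := φ.commutes a
        have e2 : shift ξ (C a) = C a := (shift ξ).commutes a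
        change constantCoeff (φ (C a)) = shift ξ (C a)
        rw [e1, e2, constantCoeff_C]
      · change constantCoeff (φ (X h)) = shift ξ (X h)
        simp only [φ, shift, aeval_X, map_sub, map_sum, map_mul, constantCoeff_C, constantCoeff_X,
          mul_zero, Finset.sum_const_zero, sub_zero]
    exact DFunLike.congr_fun this f
  let Θ : MvPolynomial (Fin m × ι) (MvPolynomial (Fin m) ℚ) →+*
      MvPolynomial (Fin m × ι) (MvPolynomial (Fin m) ℚ) := eval₂Hom φ.toRingHom X
  have hmin' : ∀ β ∈ (specialize l l' (map (Int.castRingHom ℚ) P)).support, β ≤ α → β = α := by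
    intro β hβ
    refine hαmin β (mem_support_iff.mpr fun h => mem_support_iff.mp hβ ?_)
    rw [specialize_map, h, map_zero]
  have hkey := coeff_eval₂Hom_of_minimal φ.toRingHom _ hmin'
  rw [specialize_map] at hkey
  have hkey' : coeff α (Θ (specialize l l' (map (Int.castRingHom ℚ) P))) =
      shift ξ (map (Int.castRingHom ℚ) (coeff α (specialize l l' P))) := hkey.trans (hφ0 _)
  rw [← hkey']
  let F := map (Int.castRingHom ℚ) (bind₁ (blockForm fun h => frame (g h) (l h)) P)
  have hPF : map (Int.castRingHom ℚ) P = bind₁ (blockForm H) F := by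
    simp only [F]
    rw [map_bind₁]
    simp_rw [map_blockForm]
    rw [bind_blockForm_bind]
    simp_rw [hH]
    exact (bind_blockForm_one _).symm
  let v : Fin m × Option κ → MvPolynomial (Fin m × ι) (MvPolynomial (Fin m) ℚ) :=
    fun s => Θ (specialize l l' (blockForm H s))
  have hΘC : ∀ a : ℚ, Θ (C (C a)) = C (C a) := by
    intro a
    simp only [Θ, coe_eval₂Hom, eval₂_C]
    exact φ.commutes a
  have hcomp : aeval v F = Θ (specialize l l' (map (Int.castRingHom ℚ) P)) := by
    rw [hPF]
    have : (aeval v : MvPolynomial (Fin m × Option κ) ℚ →ₐ[ℚ] _).toRingHom =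
        Θ.comp ((specialize l l').toRingHom.comp (bind₁ (blockForm H)).toRingHom) := by
      refine MvPolynomial.ringHom_ext (fun a => ?_) fun s => ?_
      · change aeval v (C a) = Θ (specialize l l' (bind₁ (blockForm H) (C a)))
        have e1 : specialize l l' (C a : MvPolynomial (Fin m × ι) ℚ) = C (C a) :=
          (specialize l l').commutes a
        have e2 : aeval v (C a) = C (C a) := (aeval v).commutes a
        rw [bind₁_C_right, e1, hΘC, e2]
      · change aeval v (X s) = Θ (specialize l l' (bind₁ (blockForm H) (X s)))
        rw [bind₁_X_right, aeval_X]
    exact DFunLike.congr_fun this F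
  rw [← hcomp]
  refine indexGE_coeff_aeval (hF.map _) v (fun h => ?_) α
  have hform : blockForm H (h, none) = ∑ i, C ((V h i : ℚ) / V h (l h)) * X (h, i) := by
    refine Finset.sum_congr rfl fun i _ => ?_
    rw [← hHnone h i, mul_div_cancel_left₀ _ (hVq h)]
  simp only [v]
  rw [hform, map_sum, map_sum, ← Finset.add_sum_erase _ _ (Finset.mem_univ (l h)),
    ← Finset.add_sum_erase _ _ (Finset.mem_erase.mpr ⟨(hl h).symm, Finset.mem_univ (l' h)⟩)]
  have hsC : ∀ a : ℚ, specialize l l' (C a : MvPolynomial (Fin m × ι) ℚ) = C (C a) :=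
    fun a => (specialize l l').commutes a
  have hX1 : Θ (specialize l l' (X (h, l h))) = C (X h + C (ξ h)) -
      ∑ i ∈ (Finset.univ.erase (l h)).erase (l' h), C (C ((V h i : ℚ) / V h (l h))) * X (h, i) := by
    rw [specialize, aeval_X, if_pos rfl]
    simp only [Θ, coe_eval₂Hom, eval₂_C]
    change φ (X h) = _
    simp only [φ, aeval_X]
  have hX2 : Θ (specialize l l' (X (h, l' h))) = 1 := by
    rw [specialize, aeval_X, if_neg (hl h).symm, if_pos rfl, map_one]
  have hX3 : ∀ i ∈ (Finset.univ.erase (l h)).erase (l' h),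
      Θ (specialize l l' (C ((V h i : ℚ) / V h (l h)) * X (h, i))) =
      C (C ((V h i : ℚ) / V h (l h))) * X (h, i) := by
    intro i hi
    rw [map_mul, map_mul, hsC, hΘC, specialize, aeval_X,
      if_neg (Finset.ne_of_mem_erase (Finset.mem_of_mem_erase hi)),
      if_neg (Finset.ne_of_mem_erase hi)]
    simp only [Θ, coe_eval₂Hom, eval₂_X]
  rw [Finset.sum_congr rfl hX3, map_mul, map_mul, map_mul, map_mul, hsC, hsC, hΘC, hΘC, hX1, hX2,
    div_self (hVq h), hξ]
  simp only [C_1, map_add, map_neg]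
  ring

end SubspaceThm

namespace SubspaceThm

open Finset NumberField Matrix

/-- Liouville's inequality for a linear form with algebraic coefficients. -/
lemma exists_liouville_bound {τ : Type} [Fintype τ] (b : τ → ℝ) (hb : ∀ t, IsAlgebraic ℚ (b t)) :
    ∃ (C : ℝ) (E : ℕ), 1 ≤ C ∧ ∀ (V : τ → ℤ) (M : ℝ), 1 ≤ M → (∀ t, |(V t : ℝ)| ≤ M) →
      ∑ t, V t * b t ≠ 0 → 1 ≤ |∑ t, V t * b t| * C * M ^ E := by
  obtain ⟨K, _, _, φ, D, β, hD, hβ⟩ := exists_numberField_integral_multiple b hb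
  obtain ⟨B, hB⟩ : ∃ B : ℝ, B = 1 + ∑ t, houseSeminorm K (β t) := ⟨_, rfl⟩
  have hB1 : 1 ≤ B := by
    rw [hB]; linarith [Finset.sum_nonneg fun t (_ : t ∈ univ) => apply_nonneg (houseSeminorm K) (β t)]
  have hD1 : (1 : ℝ) ≤ |(D : ℝ)| := by exact_mod_cast Int.one_le_abs hD
  refine ⟨|(D : ℝ)| * B ^ (Module.finrank ℚ K - 1), Module.finrank ℚ K - 1, ?_, ?_⟩
  · nlinarith [one_le_pow₀ hB1 (n := Module.finrank ℚ K - 1)]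
  intro V M hM hV hne
  obtain ⟨α, hα⟩ : ∃ α : 𝓞 K, α = ∑ t, (V t : 𝓞 K) * β t := ⟨_, rfl⟩
  have hφα : φ (algebraMap (𝓞 K) K α) = D * ∑ t, V t * b t := by
    rw [hα, map_sum, map_sum, Finset.mul_sum]
    refine Finset.sum_congr rfl fun t _ => ?_
    rw [map_mul, map_mul, hβ, map_intCast, map_intCast]; ring
  have hα0 : algebraMap (𝓞 K) K α ≠ 0 := by
    intro h0
    rw [h0, map_zero] at hφα
    rcases mul_eq_zero.mp hφα.symm with h | h
    · exact hD (by exact_mod_cast h)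
    · exact hne h
  have hhouse : house (algebraMap (𝓞 K) K α) ≤ B * M := by
    rw [← houseSeminorm_apply, hα]
    calc houseSeminorm K (∑ t, (V t : 𝓞 K) * β t)
        ≤ ∑ t, houseSeminorm K ((V t : 𝓞 K) * β t) := by
          classical
          induction (univ : Finset τ) using Finset.induction_on with
          | empty => simp
          | insert a s ha ih =>
            rw [Finset.sum_insert ha, Finset.sum_insert ha]
            exact (map_add_le_add _ _ _).trans (by gcongr)
      _ ≤ ∑ t, M * houseSeminorm K (β t) := by
          refine Finset.sum_le_sum fun t _ => (map_mul_le_mul _ _ _).trans ?_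
          rw [houseSeminorm_intCast]
          exact mul_le_mul_of_nonneg_right (hV t) (apply_nonneg _ _)
      _ ≤ B * M := by
          rw [← Finset.mul_sum, hB]; nlinarith
  have hnorm : (1 : ℝ) ≤ ‖Algebra.norm ℚ (algebraMap (𝓞 K) K α)‖ := by
    have h1 : Algebra.norm ℚ (algebraMap (𝓞 K) K α) = ((Algebra.norm ℤ α : ℤ) : ℚ) :=
      (Algebra.coe_norm_int α).symm
    rw [h1]
    have h2 : Algebra.norm ℤ α ≠ 0 := by
      rw [Algebra.norm_ne_zero_iff]
      rintro rfl; exact hα0 (map_zero _)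
    have := Int.one_le_abs h2
    rw [Int.norm_cast_rat, Int.norm_eq_abs]
    exact_mod_cast this
  have h3 := norm_norm_le_norm_mul_house_pow (algebraMap (𝓞 K) K α) (Complex.ofRealHom.comp φ)
  have h4 : ‖(Complex.ofRealHom.comp φ) (algebraMap (𝓞 K) K α)‖ = |(D : ℝ)| * |∑ t, V t * b t| := by
    rw [RingHom.comp_apply, hφα]
    simp [-Complex.ofReal_sum, -Complex.ofReal_mul]
  rw [h4] at h3
  calc (1 : ℝ) ≤ _ := hnorm
    _ ≤ _ := h3
    _ ≤ |(D : ℝ)| * |∑ t, V t * b t| * (B * M) ^ (Module.finrank ℚ K - 1) := by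
      have : 0 ≤ house (algebraMap (𝓞 K) K α) := house_nonneg _
      gcongr
    _ = _ := by rw [mul_pow]; ring

lemma abs_adjugate_le {κ : Type} [Fintype κ] [DecidableEq κ] (A : Matrix (Option κ) (Option κ) ℝ)
    {w : Option κ → ℝ} (hw : ∀ i, 0 ≤ w i) (hA : ∀ i j, |A i (some j)| ≤ w i) (i : Option κ) :
    |A.adjugate none i| ≤ (Fintype.card (Option κ)).factorial * ∏ k ∈ univ.erase i, w k := by
  rw [adjugate_apply, ← det_transpose, det_apply']
  refine (Finset.abs_sum_le_sum_abs _ _).trans ?_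
  have : ∀ σ : Equiv.Perm (Option κ),
      |((Equiv.Perm.sign σ : ℤ) : ℝ) * ∏ k, (A.updateRow i (Pi.single none 1))ᵀ (σ k) k| ≤
        ∏ k ∈ univ.erase i, w k := by
    intro σ
    have hs : |((Equiv.Perm.sign σ : ℤ) : ℝ)| = 1 := by
      rcases Int.units_eq_one_or (Equiv.Perm.sign σ) with h | h <;> simp [h]
    rw [abs_mul, hs, one_mul, Finset.abs_prod, ← Finset.mul_prod_erase _ _ (Finset.mem_univ i)]
    simp only [transpose_apply]
    by_cases hi : σ i = none
    · rw [updateRow_self, hi, Pi.single_eq_same, abs_one, one_mul]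
      refine Finset.prod_le_prod (fun _ _ => abs_nonneg _) fun k hk => ?_
      have hki := Finset.ne_of_mem_erase hk
      rw [updateRow_ne hki]
      obtain ⟨j, hj⟩ := Option.ne_none_iff_exists'.mp fun h => hki (σ.injective (h.trans hi.symm))
      rw [hj]; exact hA k j
    · rw [updateRow_self, Pi.single_eq_of_ne hi, abs_zero, zero_mul]
      exact Finset.prod_nonneg fun k _ => hw k
  refine (Finset.sum_le_card_nsmul _ _ _ fun σ _ => this σ).trans (le_of_eq ?_)
  rw [nsmul_eq_mul, Finset.card_univ, Fintype.card_perm]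

/-- The hyperplane of rational points orthogonal to an integer vector. -/
def orthHyperplane {ι : Type} [Fintype ι] (v : ι → ℤ) : Submodule ℚ (ι → ℚ) :=
  LinearMap.ker (∑ i, (v i : ℚ) • LinearMap.proj (R := ℚ) (φ := fun _ : ι => ℚ) i)

lemma mem_orthHyperplane {ι : Type} [Fintype ι] {v : ι → ℤ} {x : ι → ℚ} :
    x ∈ orthHyperplane v ↔ ∑ i, v i * x i = 0 := by
  simp [orthHyperplane, LinearMap.mem_ker]

lemma orthHyperplane_ne_top {ι : Type} [Fintype ι] [DecidableEq ι] {v : ι → ℤ} (hv : v ≠ 0) :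
    orthHyperplane v ≠ ⊤ := by
  intro h
  apply hv
  ext i
  have : Pi.single i (1 : ℚ) ∈ orthHyperplane v := h ▸ Submodule.mem_top
  rw [mem_orthHyperplane] at this
  simpa [Pi.single_apply] using this

/-- If the normal vector of the integral points is of small height, these points lie in a subspace
from a fixed finite list. -/
lemma exists_low_height {κ : Type} [Fintype κ] [DecidableEq κ]
    (L : Matrix (Option κ) (Option κ) ℝ) (hL : ∀ i j, IsAlgebraic ℚ (L i j)) (hdet : L.det ≠ 0)
    (c : Option κ → ℝ) (hc : ∑ i, c i < 0) :
    ∃ (δ q₁ : ℝ) (T : Finset (Submodule ℚ (Option κ → ℚ))), 0 < δ ∧ (∀ W ∈ T, W ≠ ⊤) ∧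
      ∀ q, q₁ ≤ q → ∀ G : Matrix (Option κ) (Option κ) ℤ, G.det ≠ 0 →
        (∀ i j, |∑ k, L i k * G k (some j)| ≤ Real.exp (c i * q)) →
        ∀ (V : Option κ → ℤ) (d : ℤ), (∀ i, G.adjugate none i = d * V i) →
        (∃ W ∈ T, ∀ j, (fun i => (G i (some j) : ℚ)) ∈ W) ∨ ∃ i, Real.exp (δ * q) ≤ |(V i : ℝ)| := by
  classical
  obtain ⟨s, hs⟩ : ∃ s : ℝ, s = -∑ i, c i := ⟨_, rfl⟩
  have hs0 : 0 < s := by rw [hs]; linarith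
  have hlio : ∀ i, ∃ (C : ℝ) (E : ℕ), 1 ≤ C ∧ ∀ (V : Option κ → ℤ) (M : ℝ), 1 ≤ M →
      (∀ t, |(V t : ℝ)| ≤ M) → ∑ t, V t * L⁻¹ t i ≠ 0 → 1 ≤ |∑ t, V t * L⁻¹ t i| * C * M ^ E :=
    fun i => exists_liouville_bound _ fun t => isAlgebraic_inv hL t i
  choose Ci Ei hCi hlio using hlio
  have hVS : ∀ S : Finset (Option κ), ∃ (v : Option κ → ℤ) (b : Option κ → ℝ), 
      (v = 0 → ∀ (u : Option κ → ℤ) (b : Option κ → ℝ), (∀ i, i ∉ S → b i = 0) → 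
        (∀ k, (u k : ℝ) = ∑ i, b i * L i k) → u = 0) ∧
      (∀ i, i ∉ S → b i = 0) ∧ ∀ k, (v k : ℝ) = ∑ i, b i * L i k := by
    intro S
    by_cases h : ∃ (v : Option κ → ℤ) (b : Option κ → ℝ), v ≠ 0 ∧ (∀ i, i ∉ S → b i = 0) ∧ 
        ∀ k, (v k : ℝ) = ∑ i, b i * L i k
    · obtain ⟨v, b, hv, h⟩ := h
      exact ⟨v, b, fun h => absurd h hv, h⟩
    · push Not at h
      refine ⟨0, 0, fun _ u b hb hu => ?_, by simp, by simp⟩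
      by_contra hu0
      obtain ⟨k, hk⟩ := h u b hu0 hb
      exact hk (hu k)
  choose v b hv0 hbS hvb using hVS
  obtain ⟨F, hF⟩ : ∃ F : ℝ, F = (Fintype.card (Option κ)).factorial * |L.det|⁻¹ := ⟨_, rfl⟩
  have hF0 : 0 ≤ F := by rw [hF]; positivity
  obtain ⟨B, hB⟩ : ∃ B : ℝ, B = 1 + ∑ S, ∑ i, |b S i| := ⟨_, rfl⟩
  obtain ⟨C, hC⟩ : ∃ C : ℝ, C = 1 + ∑ i, Ci i := ⟨_, rfl⟩
  obtain ⟨E, hE⟩ : ∃ E : ℕ, E = ∑ i, Ei i := ⟨_, rfl⟩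
  obtain ⟨δ, hδ⟩ : ∃ δ : ℝ, δ = s / (4 * (E + 1)) := ⟨_, rfl⟩
  have hδ0 : 0 < δ := by rw [hδ]; positivity
  have hBS : ∀ S, ∑ i, |b S i| < B := fun S => by
    have := Finset.single_le_sum (f := fun S => ∑ i, |b S i|)
      (fun _ _ => Finset.sum_nonneg fun _ _ => abs_nonneg _) (Finset.mem_univ S)
    rw [hB]; linarith
  have hB0 : 0 < B := (Finset.sum_nonneg fun _ _ => abs_nonneg _).trans_lt (hBS ∅)
  have hCC : ∀ i, Ci i ≤ C := fun i => by
    have := Finset.single_le_sum (f := Ci) (fun i _ => by linarith [hCi i]) (Finset.mem_univ i)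
    rw [hC]; linarith
  have hC0 : 0 < C := by linarith [hCi none, hCC none]
  have hEE : ∀ i, Ei i ≤ E := fun i => by
    rw [hE]; exact Finset.single_le_sum (f := Ei) (fun i _ => Nat.zero_le _) (Finset.mem_univ i)
  refine ⟨δ, max 1 (max (2 * Real.log B / s) (4 * Real.log (F * C + 1) / s)),
    (univ.image fun S => if v S = 0 then ⊥ else orthHyperplane (v S)), hδ0, ?_, ?_⟩
  · intro W hW
    obtain ⟨S, -, rfl⟩ := Finset.mem_image.mp hW
    split_ifs with h
    · exact bot_ne_top
    · exact orthHyperplane_ne_top h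
  intro q hq G hG hGL V d hd
  have hqpos : 0 < q := one_pos.trans_le ((le_max_left _ _).trans hq)
  have hqB : 2 * Real.log B ≤ q * s := by
    rw [← div_le_iff₀ hs0]; exact ((le_max_left _ _).trans (le_max_right _ _)).trans hq
  have hqC : 4 * Real.log (F * C + 1) ≤ q * s := by
    rw [← div_le_iff₀ hs0]; exact ((le_max_right _ _).trans (le_max_right _ _)).trans hq
  by_cases hlow : ∃ i, Real.exp (δ * q) ≤ |(V i : ℝ)|
  · exact Or.inr hlow
  left
  push Not at hlow
  have hadj0 : ∃ i, G.adjugate none i ≠ 0 := by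
    by_contra h
    push Not at h
    apply hG
    have := congrFun (congrFun (adjugate_mul G) none) none
    simpa [Matrix.mul_apply, h] using this.symm
  have hd0 : d ≠ 0 := by
    obtain ⟨i, hi⟩ := hadj0
    rintro rfl
    exact hi (by simp [hd])
  have hV0 : V ≠ 0 := by
    obtain ⟨i, hi⟩ := hadj0
    rintro rfl
    exact hi (by simp [hd])
  have hd1 : (1 : ℝ) ≤ |(d : ℝ)| := by exact_mod_cast Int.one_le_abs hd0
  obtain ⟨a, ha⟩ : ∃ a : Option κ → ℝ, a = fun i => ∑ t, V t * L⁻¹ t i := ⟨_, rfl⟩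
  have hVa : ∀ k, (V k : ℝ) = ∑ i, a i * L i k := by
    intro k
    have h1 : (fun k => (V k : ℝ)) ᵥ* (L⁻¹ * L) = fun k => (V k : ℝ) := by
      rw [nonsing_inv_mul L (isUnit_iff_ne_zero.mpr hdet), vecMul_one]
    rw [← vecMul_vecMul] at h1
    rw [← congrFun h1 k, ha]
    rfl
  have hda : ∀ i, L.det * (d * a i) =
      (L * G.map (Int.castRingHom ℝ)).adjugate none i := by
    intro i
    have h1 : (L * G.map (Int.castRingHom ℝ)).adjugate * L =
        L.det • (G.map (Int.castRingHom ℝ)).adjugate := by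
      rw [adjugate_mul_distrib, Matrix.mul_assoc, adjugate_mul, Matrix.mul_smul, Matrix.mul_one]
    have h2 : (L * G.map (Int.castRingHom ℝ)).adjugate =
        L.det • ((G.map (Int.castRingHom ℝ)).adjugate * L⁻¹) := by
      rw [← Matrix.smul_mul, ← h1, Matrix.mul_assoc, mul_nonsing_inv L (isUnit_iff_ne_zero.mpr hdet),
        Matrix.mul_one]
    have h3 : (G.map (Int.castRingHom ℝ)).adjugate = G.adjugate.map (Int.castRingHom ℝ) := by
      have := (RingHom.map_adjugate (Int.castRingHom ℝ) G).symm
      simpa [RingHom.mapMatrix_apply] using this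
    rw [h2, Matrix.smul_apply, smul_eq_mul, h3, Matrix.mul_apply, ha, Finset.mul_sum]
    congr 1
    refine Finset.sum_congr rfl fun t _ => ?_
    simp [hd, mul_assoc]
  have hexp : ∀ i, ∏ k ∈ univ.erase i, Real.exp (c k * q) = Real.exp ((-s - c i) * q) := by
    intro i
    rw [← Real.exp_sum, ← Finset.sum_mul, hs]
    congr 2
    rw [← Finset.add_sum_erase _ _ (Finset.mem_univ i)]
    ring
  have habound : ∀ i, |a i| ≤ F * Real.exp ((-s - c i) * q) := by
    intro i
    have h1 := abs_adjugate_le (L * G.map (Int.castRingHom ℝ)) (w := fun i => Real.exp (c i * q))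
      (fun _ => (Real.exp_pos _).le) (fun i j => by simpa [Matrix.mul_apply] using hGL i j) i
    rw [← hda, hexp, abs_mul, abs_mul] at h1
    have hL0 : 0 < |L.det| := abs_pos.mpr hdet
    rw [hF, mul_right_comm, ← div_eq_mul_inv, le_div_iff₀ hL0]
    refine le_trans ?_ h1
    nlinarith [mul_le_mul_of_nonneg_right hd1 (mul_nonneg hL0.le (abs_nonneg (a i)))]
  have hcS : ∀ i, a i ≠ 0 → c i ≤ -(s / 2) := by
    intro i hi
    have h1 := hlio i V (Real.exp (δ * q)) (Real.one_le_exp (by positivity)) (fun t => (hlow t).le)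
      (by rw [ha] at hi; exact hi)
    have h2 : Real.exp (δ * q) ^ Ei i ≤ Real.exp (s / 4 * q) := by
      rw [← Real.exp_nat_mul]
      apply Real.exp_le_exp.mpr
      have h3 : (Ei i : ℝ) * δ ≤ s / 4 := by
        have : (Ei i : ℝ) ≤ E := by exact_mod_cast hEE i
        rw [hδ, mul_div_assoc', div_le_div_iff₀ (by positivity) (by positivity)]
        nlinarith
      nlinarith
    have h4 : (1 : ℝ) ≤ F * Real.exp ((-s - c i) * q) * C * Real.exp (s / 4 * q) := by
      refine h1.trans ?_
      have h5 := habound i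
      have h6 := hCC i
      have h7 := hCi i
      rw [ha] at h5
      have h8 : 0 ≤ F * Real.exp ((-s - c i) * q) := by positivity
      gcongr
    have h9 : F * C + 1 ≤ Real.exp (s / 4 * q) := by
      rw [← Real.log_le_iff_le_exp (by positivity)]; linarith
    have h10 : (1 : ℝ) ≤ Real.exp (s / 4 * q) * Real.exp ((-s - c i) * q) * Real.exp (s / 4 * q) := by
      refine h4.trans ?_
      have : F * C ≤ Real.exp (s / 4 * q) := by linarith
      calc _ = (F * C) * Real.exp ((-s - c i) * q) * Real.exp (s / 4 * q) := by ring
        _ ≤ _ := by gcongr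
    rw [← Real.exp_add, ← Real.exp_add, Real.one_le_exp_iff] at h10
    have : 0 ≤ (-(s / 2) - c i) * q := by linarith
    have := nonneg_of_mul_nonneg_left this hqpos
    linarith
  obtain ⟨S, hS⟩ : ∃ S : Finset (Option κ), S = univ.filter fun i => a i ≠ 0 := ⟨_, rfl⟩
  have hvS : v S ≠ 0 := by
    intro h
    refine hV0 (hv0 S h V a (fun i hi => ?_) hVa)
    by_contra hai
    exact hi (by rw [hS]; simp [hai])
  refine ⟨_, Finset.mem_image_of_mem _ (Finset.mem_univ S), fun j => ?_⟩
  rw [if_neg hvS, mem_orthHyperplane]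
  have h1 : ((∑ i, v S i * G i (some j) : ℤ) : ℝ) = ∑ i, b S i * ∑ k, L i k * G k (some j) := by
    push_cast
    simp_rw [hvb, Finset.sum_mul, Finset.mul_sum, mul_assoc]
    exact Finset.sum_comm
  have h2 : |((∑ i, v S i * G i (some j) : ℤ) : ℝ)| < 1 := by
    rw [h1]
    have hBexp : B ≤ Real.exp (s / 2 * q) := by
      rw [← Real.log_le_iff_le_exp hB0]; linarith
    calc _ ≤ ∑ i, |b S i * ∑ k, L i k * G k (some j)| := Finset.abs_sum_le_sum_abs _ _
      _ ≤ ∑ i, |b S i| * Real.exp (-(s / 2) * q) := by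
        refine Finset.sum_le_sum fun i _ => ?_
        rw [abs_mul]
        by_cases hi : i ∈ S
        · gcongr
          refine (hGL i j).trans (Real.exp_le_exp.mpr ?_)
          have := hcS i (by rw [hS] at hi; exact (Finset.mem_filter.mp hi).2)
          nlinarith
        · rw [hbS S i hi]; simp
      _ = (∑ i, |b S i|) * Real.exp (-(s / 2) * q) := by rw [Finset.sum_mul]
      _ < B * Real.exp (-(s / 2) * q) := by
        have := hBS S
        gcongr
      _ ≤ Real.exp (s / 2 * q) * Real.exp (-(s / 2) * q) := by gcongr
      _ = 1 := by rw [← Real.exp_add]; simp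
  have h3 : ∑ i, v S i * G i (some j) = 0 := by
    rw [← Int.abs_lt_one_iff]; exact_mod_cast h2
  exact_mod_cast h3

end SubspaceThm

namespace SubspaceThm

open Finset Matrix

lemma exists_large_denominator {κ : Type} [Fintype κ] [DecidableEq κ] [Nonempty κ]
    {V : Option κ → ℤ} (hV : univ.gcd V = 1) {l : Option κ} (hl : V l ≠ 0) :
    ∃ l', l ≠ l' ∧ |V l| ≤ ((V l' / V l : ℚ).den : ℤ) ^ Fintype.card κ := by
  have hne : (univ.erase l).Nonempty := by
    rw [← Finset.card_pos, Finset.card_erase_of_mem (mem_univ l), Finset.card_univ,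
      Fintype.card_option, Nat.add_sub_cancel]
    exact Fintype.card_pos
  obtain ⟨l', hl', hmax⟩ := Finset.exists_max_image _ (fun i => (V i / V l : ℚ).den) hne
  refine ⟨l', (Finset.ne_of_mem_erase hl').symm, ?_⟩
  obtain ⟨D, hD⟩ : ∃ D : ℤ, D = ∏ i ∈ univ.erase l, ((V i / V l : ℚ).den : ℤ) := ⟨_, rfl⟩
  have hD0 : 0 < D := by
    rw [hD]; exact Finset.prod_pos fun i _ => by exact_mod_cast (V i / V l : ℚ).den_pos
  have hdvd : ∀ i, V l ∣ D * V i := by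
    intro i
    by_cases hi : i = l
    · rw [hi]; exact Dvd.intro_left _ rfl
    have h1 : V l ∣ ((V i / V l : ℚ).den : ℤ) * V i := by
      refine ⟨(V i / V l : ℚ).num, ?_⟩
      have hq : (V l : ℚ) ≠ 0 := by exact_mod_cast hl
      have h2 := Rat.den_mul_eq_num (V i / V l : ℚ)
      have h3 : (((V i / V l : ℚ).den : ℤ) : ℚ) * V i = V l * ((V i / V l : ℚ).num : ℚ) := by
        rw [← h2]; push_cast; field_simp
      exact_mod_cast h3
    refine h1.trans (mul_dvd_mul_right ?_ _)
    rw [hD]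
    exact Finset.dvd_prod_of_mem (fun i => ((V i / V l : ℚ).den : ℤ))
      (Finset.mem_erase.mpr ⟨hi, mem_univ i⟩)
  have hVD : V l ∣ D := by
    have h1 : V l ∣ univ.gcd fun i => D * V i := Finset.dvd_gcd fun i _ => hdvd i
    rw [Finset.gcd_mul_left, hV, mul_one] at h1
    exact h1.trans (normalize_associated D).dvd
  calc |V l| ≤ D := Int.le_of_dvd hD0 ((abs_dvd _ _).mpr hVD)
    _ ≤ ∏ i ∈ univ.erase l, ((V l' / V l : ℚ).den : ℤ) := by
      rw [hD]
      exact Finset.prod_le_prod (fun _ _ => by positivity) fun i hi => by exact_mod_cast hmax i hi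
    _ = _ := by
      rw [Finset.prod_const, Finset.card_erase_of_mem (mem_univ l), Finset.card_univ,
        Fintype.card_option, Nat.add_sub_cancel]

lemma exists_rapidly_decreasing {p : ℝ → Prop} (hp : ∀ x, ∃ q, x ≤ q ∧ p q) {x₀ K : ℝ}
    (hx₀ : 0 ≤ x₀) (hK : 0 ≤ K) (m : ℕ) :
    ∃ q : Fin m → ℝ, (∀ h, x₀ ≤ q h ∧ p (q h)) ∧ ∀ i j, i < j → K * q j ≤ q i := by
  induction m with
  | zero => exact ⟨0, fun h => h.elim0, fun h => h.elim0⟩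
  | succ m ih =>
    obtain ⟨q, hq, hqK⟩ := ih
    obtain ⟨t, ht, hpt⟩ := hp (max x₀ (K * ∑ h, q h))
    refine ⟨Fin.cons t q, Fin.cases ⟨(le_max_left _ _).trans ht, hpt⟩ hq, fun i j hij => ?_⟩
    obtain ⟨j, rfl⟩ := Fin.exists_succ_eq.mpr (Fin.ne_zero_of_lt hij)
    rw [Fin.cons_succ]
    induction i using Fin.cases with
    | zero =>
      rw [Fin.cons_zero]
      refine le_trans ?_ ((le_max_right _ _).trans ht)
      have := Finset.single_le_sum (f := q) (fun i _ => hx₀.trans (hq i).1) (mem_univ j)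
      gcongr
    | succ i => exact hqK i j (Fin.succ_lt_succ_iff.mp hij)

lemma exists_frame_inverse {κ : Type} [Fintype κ] [DecidableEq κ]
    {G : Matrix (Option κ) (Option κ) ℤ} {l : Option κ} (hl : G.adjugate none l ≠ 0) :
    ∃ H : Matrix (Option κ) (Option κ) ℚ,
      (frame (fun j i => G i (some j)) l).map (Int.castRingHom ℚ) * H = 1 := by
  refine ⟨_, mul_nonsing_inv _ (isUnit_iff_ne_zero.mpr ?_)⟩
  have h1 : frame (fun j i => G i (some j)) l = G.updateCol none (Pi.single l 1) := by
    ext i j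
    rcases j with _ | j
    · simp [frame, Pi.single_apply]
    · simp [frame]
  have h2 : (frame (fun j i => G i (some j)) l).det = G.adjugate none l := by
    rw [h1, ← cramer_apply, cramer_eq_adjugate_mulVec]
    simp
  have h3 := RingHom.map_det (Int.castRingHom ℚ) (frame (fun j i => G i (some j)) l)
  rw [RingHom.mapMatrix_apply] at h3
  rw [← h3, h2]
  simpa using hl

/-- The subspace theorem for the penultimate minimum. -/
theorem exists_penultimate {κ : Type} [Fintype κ] [DecidableEq κ]
    (L : Matrix (Option κ) (Option κ) ℝ) (hL : ∀ i j, IsAlgebraic ℚ (L i j)) (hdet : L.det ≠ 0)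
    (c : Option κ → ℝ) (hc : ∑ i, c i < 0) :
    ∃ (q₁ : ℝ) (T : Finset (Submodule ℚ (Option κ → ℚ))), (∀ W ∈ T, W ≠ ⊤) ∧
      ∀ q, q₁ ≤ q → ∀ G : Matrix (Option κ) (Option κ) ℤ, G.det ≠ 0 →
        (∀ i j, |∑ k, L i k * G k (some j)| ≤ Real.exp (c i * q)) →
        ∃ W ∈ T, ∀ j, (fun i => (G i (some j) : ℚ)) ∈ W := by
  classical
  rcases isEmpty_or_nonempty κ with hκ | hκ
  · exact ⟨0, {⊥}, by simp [bot_ne_top], fun q _ G _ _ => ⟨⊥, by simp, fun j => isEmptyElim j⟩⟩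
  obtain ⟨δ, q₂, T, hδ, hT, hlow⟩ := exists_low_height L hL hdet c hc
  obtain ⟨m, θ, C, ρ, q₁, hm, hθ, hC, hρ, hρ1, hq₁, hvan⟩ :=
    exists_vanishing (κ := κ) L hL hdet c hc
  obtain ⟨ω, C', hω, hC', hroth⟩ := roth_index m (θ / 2) (half_pos hθ)
  by_contra hcon
  push Not at hcon
  obtain ⟨n, hn⟩ : ∃ n : ℝ, n = Fintype.card κ := ⟨_, rfl⟩
  have hn0 : 0 < n := by rw [hn]; exact_mod_cast Fintype.card_pos
  obtain ⟨x₀, hx₀⟩ : ∃ x₀ : ℝ, x₀ = max q₁ (max q₂ (2 * (m + 1) * n * Real.log (C * C') / (ω * δ))) :=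
    ⟨_, rfl⟩
  have hx₁ : q₁ ≤ x₀ := by rw [hx₀]; exact le_max_left _ _
  have hx₂ : q₂ ≤ x₀ := by rw [hx₀]; exact (le_max_left _ _).trans (le_max_right _ _)
  have hx₃ : 2 * (m + 1) * n * Real.log (C * C') ≤ x₀ * (ω * δ) := by
    rw [← div_le_iff₀ (by positivity), hx₀]; exact (le_max_right _ _).trans (le_max_right _ _)
  have hx₀0 : 0 < x₀ := by linarith
  obtain ⟨q, hq, hqK⟩ := exists_rapidly_decreasing (fun x => hcon x T hT) hx₀0.le
    (by positivity : 0 ≤ 2 / ω) m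
  choose hqx G hG hGL hGT using hq
  have hq0 : ∀ h, 0 < q h := fun h => hx₀0.trans_le (hqx h)
  have hV : ∀ h, ∃ V : Option κ → ℤ, (∀ i, (G h).adjugate none i =
      (univ.gcd ((G h).adjugate none)) * V i) ∧ univ.gcd V = 1 := by
    intro h
    obtain ⟨V, hV, hV1⟩ := Finset.extract_gcd ((G h).adjugate none) univ_nonempty
    exact ⟨V, fun i => hV i (mem_univ i), hV1⟩
  choose V hV hV1 using hV
  have hl : ∀ h, ∃ l, Real.exp (δ * q h) ≤ |(V h l : ℝ)| := by
    intro h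
    refine (hlow (q h) (hx₂.trans (hqx h)) (G h) (hG h) (hGL h) (V h) _ (hV h)).resolve_left ?_
    rintro ⟨W, hW, hWG⟩
    obtain ⟨j, hj⟩ := hGT h W hW
    exact hj (hWG j)
  choose l hl using hl
  have hVl : ∀ h, V h (l h) ≠ 0 := by
    intro h h0
    have := hl h
    rw [h0] at this
    simp only [Int.cast_zero, abs_zero] at this
    exact absurd this (not_le.mpr (Real.exp_pos _))
  have hd0 : ∀ h, univ.gcd ((G h).adjugate none) ≠ 0 := by
    intro h h0
    apply hG h
    have h1 := congrFun (congrFun (adjugate_mul (G h)) none) none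
    have h2 : ∀ i, (G h).adjugate none i = 0 := fun i => by rw [hV, h0, zero_mul]
    simpa [Matrix.mul_apply, h2] using h1.symm
  choose l' hll' hden using fun h => exists_large_denominator (hV1 h) (hVl h)
  choose H hH using fun h => exists_frame_inverse (G := G h) (l := l h)
    (by rw [hV]; exact mul_ne_zero (hd0 h) (hVl h))
  have hVG : ∀ h j, ∑ i, V h i * G h i (some j) = 0 := by
    intro h j
    have h1 := congrFun (congrFun (adjugate_mul (G h)) none) (some j)
    rw [Matrix.mul_apply] at h1
    simp only [hV, mul_assoc, ← Finset.mul_sum] at h1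
    simpa [hd0 h] using h1
  have hm' : (univ : Finset (Fin m)).Nonempty := ⟨⟨0, hm⟩, mem_univ _⟩
  obtain ⟨R, hR⟩ : ∃ R : ℝ, R = (∑ h, q h) / ρ := ⟨_, rfl⟩
  have hqR : ∀ h, q h ≤ ρ * R := by
    intro h
    rw [hR, mul_div_cancel₀ _ hρ.ne']
    exact Finset.single_le_sum (f := q) (fun i _ => (hq0 i).le) (mem_univ h)
  have hR0 : 0 < R := by rw [hR]; exact div_pos (Finset.sum_pos (fun h _ => hq0 h) hm') hρ
  obtain ⟨r, hr⟩ : ∃ r : Fin m → ℕ, r = fun h => ⌈R / q h⌉₊ := ⟨_, rfl⟩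
  have hr0 : ∀ h, 0 < r h := fun h => by rw [hr]; exact Nat.ceil_pos.mpr (div_pos hR0 (hq0 h))
  have hr1 : ∀ h, R ≤ r h * q h := fun h => by
    rw [← div_le_iff₀ (hq0 h), hr]; exact Nat.le_ceil _
  have hr2 : ∀ h, r h * q h ≤ (1 + ρ) * R := fun h => by
    have : (r h : ℝ) ≤ R / q h + 1 := by
      rw [hr]; exact (Nat.ceil_lt_add_one (div_pos hR0 (hq0 h)).le).le
    have h2 : r h * q h ≤ (R / q h + 1) * q h := mul_le_mul_of_nonneg_right this (hq0 h).le
    rw [add_mul, div_mul_cancel₀ _ (hq0 h).ne', one_mul] at h2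
    linarith [hqR h]
  have hr3 : ∀ h, r h * q h ≤ 2 * R := fun h => (hr2 h).trans (by nlinarith)
  obtain ⟨P, hP0, hPhom, hPb, hPvan⟩ := hvan r q R hr0 (fun h => hx₁.trans (hqx h)) hR0 hr1 hr2
  have hind := hPvan (fun h j i => G h i (some j)) (fun h j i => hGL h i j) l
  obtain ⟨f, hf0, hfdeg, hfb, hfind⟩ := exists_one_variable_per_block hP0 hPhom hll' hVl hVG hH hind
  have hrω : ∀ i j, i < j → (r i : ℝ) ≤ ω * r j := by
    intro i j hij
    have h1 := hqK i j hij
    have h2 := hr3 i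
    have h3 := hr1 j
    have h4 : (r i : ℝ) * q i ≤ ω * r j * q i := by
      have : ω * (2 / ω * q j) ≤ ω * q i := mul_le_mul_of_nonneg_left h1 hω.le
      rw [← mul_assoc, mul_div_cancel₀ _ hω.ne'] at this
      have h5 : (r j : ℝ) * (2 * q j) ≤ r j * (ω * q i) := mul_le_mul_of_nonneg_left this (by positivity)
      linarith
    exact le_of_mul_le_mul_right h4 (hq0 i)
  have hbig : ∀ h k, lOne intAbs f * C' ^ r k ≤
      (((V h (l' h) / V h (l h) : ℚ).den : ℤ) : ℝ) ^ (ω * r h) := by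
    intro h k
    have hrx : ∀ h, (r h : ℝ) * x₀ ≤ 2 * R := fun h =>
      (mul_le_mul_of_nonneg_left (hqx h) (by positivity)).trans (hr3 h)
    obtain ⟨a, ha⟩ : ∃ a : ℝ, a = (((V h (l' h) / V h (l h) : ℚ).den : ℤ) : ℝ) := ⟨_, rfl⟩
    have ha0 : 0 < a := by rw [ha]; exact_mod_cast (V h (l' h) / V h (l h) : ℚ).den_pos
    have hla : δ * q h ≤ n * Real.log a := by
      have h1 : Real.exp (δ * q h) ≤ a ^ Fintype.card κ := by
        refine (hl h).trans ?_
        rw [ha]; exact_mod_cast hden h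
      rw [← Real.le_log_iff_exp_le (by positivity), Real.log_pow, ← hn] at h1
      exact h1
    rw [← ha]
    have hC0 : 0 < C := by linarith
    have hC'0 : 0 < C' := by linarith
    have hlC := Real.log_nonneg hC
    have hlC' := Real.log_nonneg hC'
    have hlCC : Real.log (C * C') = Real.log C + Real.log C' := Real.log_mul hC0.ne' hC'0.ne'
    calc lOne intAbs f * C' ^ r k ≤ C ^ (∑ h, r h) * C' ^ r k := by gcongr; exact hfb.trans hPb
      _ = Real.exp ((∑ h, r h : ℕ) * Real.log C + r k * Real.log C') := by
        rw [Real.exp_add, Real.exp_nat_mul, Real.exp_nat_mul, Real.exp_log hC0, Real.exp_log hC'0]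
      _ ≤ Real.exp (Real.log a * (ω * r h)) := by
        apply Real.exp_le_exp.mpr
        have h1 : ((∑ h, r h : ℕ) : ℝ) * x₀ ≤ m * (2 * R) := by
          push_cast
          rw [Finset.sum_mul]
          refine (Finset.sum_le_sum fun h _ => hrx h).trans ?_
          simp
        have h2 : (((∑ h, r h : ℕ) : ℝ) * Real.log C + r k * Real.log C') * x₀ ≤
            2 * (m + 1) * R * Real.log (C * C') := by
          have e1 := mul_le_mul_of_nonneg_right h1 hlC
          have e2 := mul_le_mul_of_nonneg_right (hrx k) hlC'
          rw [hlCC]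
          nlinarith [mul_nonneg hR0.le hlC, mul_nonneg (mul_nonneg (Nat.cast_nonneg (α := ℝ) m) hR0.le) hlC']
        have h3 : ω * δ * R ≤ n * (Real.log a * (ω * r h)) := by
          have e1 : ω * δ * R ≤ ω * δ * (r h * q h) := mul_le_mul_of_nonneg_left (hr1 h) (by positivity)
          have e2 := mul_le_mul_of_nonneg_left hla (by positivity : 0 ≤ ω * r h)
          nlinarith
        have h4 : n * (2 * (m + 1) * R * Real.log (C * C')) ≤ x₀ * (n * (Real.log a * (ω * r h))) := by
          have e1 := mul_le_mul_of_nonneg_right hx₃ hR0.le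
          have e2 := mul_le_mul_of_nonneg_left h3 hx₀0.le
          nlinarith
        have h5 := (mul_le_mul_of_nonneg_left h2 hn0.le).trans h4
        have h6 : (n * x₀) * (((∑ h, r h : ℕ) : ℝ) * Real.log C + r k * Real.log C') ≤
          (n * x₀) * (Real.log a * (ω * r h)) := by linarith
        exact le_of_mul_le_mul_left h6 (by positivity)
      _ = a ^ (ω * r h) := by rw [Real.rpow_def_of_pos ha0]
  obtain ⟨e, he, hecoeff⟩ := hroth r hr0 hrω f hf0 hfdeg
    (fun h => ((V h (l' h) / V h (l h) : ℚ).den : ℤ)) (fun h => (V h (l' h) / V h (l h) : ℚ).num)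
    (fun h => by exact_mod_cast (V h (l' h) / V h (l h) : ℚ).den_pos)
    (fun h => (Int.isCoprime_iff_nat_coprime.mpr (by simpa using (V h (l' h) / V h (l h) : ℚ).reduced)).symm) hbig
  have h1 : (fun h => -((V h (l' h) / V h (l h) : ℚ).num / (((V h (l' h) / V h (l h) : ℚ).den : ℤ) : ℚ) : ℚ)) =
      fun h => -((V h (l' h) : ℚ) / V h (l h)) := by
    ext h; rw [Int.cast_natCast, Rat.num_div_den]
  rw [h1] at hecoeff
  linarith [hfind e hecoeff]

end SubspaceThm

namespace SubspaceThm

open Finset Matrix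

/-- The image of an integer vector under a real matrix. -/
def evalInt {ι κ : Type} [Fintype κ] (A : Matrix ι κ ℝ) (w : κ → ℤ) : ι → ℝ :=
  A *ᵥ fun k => (w k : ℝ)

lemma evalInt_apply {ι κ : Type} [Fintype κ] (A : Matrix ι κ ℝ) (w : κ → ℤ) (i : ι) :
    evalInt A w i = ∑ k, A i k * w k := rfl

lemma exists_pos_le_norm_evalInt {n : ℕ} {A : Matrix (Fin n) (Fin n) ℝ} (hA : A.det ≠ 0) :
    ∃ μ : ℝ, 0 < μ ∧ ∀ w : Fin n → ℤ, w ≠ 0 → μ ≤ ‖evalInt A w‖ := by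
  obtain ⟨B, hB⟩ : ∃ B : ℝ, B = 1 + ∑ i, ∑ j, |A⁻¹ i j| := ⟨_, rfl⟩
  have hB0 : 0 < B := by
    rw [hB]
    have := Finset.sum_nonneg fun i (_ : i ∈ univ) =>
      Finset.sum_nonneg fun j (_ : j ∈ (univ : Finset (Fin n))) => abs_nonneg (A⁻¹ i j)
    linarith
  refine ⟨B⁻¹, inv_pos.mpr hB0, fun w hw => ?_⟩
  obtain ⟨i, hi⟩ := Function.ne_iff.mp hw
  have h1 : (w i : ℝ) = ∑ j, A⁻¹ i j * evalInt A w j := by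
    have : A⁻¹ *ᵥ evalInt A w = fun k => (w k : ℝ) := by
      rw [evalInt, mulVec_mulVec, nonsing_inv_mul A (isUnit_iff_ne_zero.mpr hA), one_mulVec]
    exact (congrFun this i).symm
  have h2 : (1 : ℝ) ≤ |(w i : ℝ)| := by exact_mod_cast Int.one_le_abs hi
  have h3 : |(w i : ℝ)| ≤ (∑ j, |A⁻¹ i j|) * ‖evalInt A w‖ := by
    rw [h1, Finset.sum_mul]
    refine (Finset.abs_sum_le_sum_abs _ _).trans (Finset.sum_le_sum fun j _ => ?_)
    rw [abs_mul]
    exact mul_le_mul_of_nonneg_left (norm_le_pi_norm (evalInt A w) j) (abs_nonneg _)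
  have h4 : ∑ j, |A⁻¹ i j| ≤ B := by
    have := Finset.single_le_sum (f := fun i => ∑ j, |A⁻¹ i j|)
      (fun i _ => Finset.sum_nonneg fun j _ => abs_nonneg _) (mem_univ i)
    rw [hB]; linarith
  rw [inv_le_iff_one_le_mul₀ hB0]
  nlinarith [norm_nonneg (evalInt A w)]

lemma exists_short_unimodular {n : ℕ} {A : Matrix (Fin (n + 1)) (Fin (n + 1)) ℝ} (hA : A.det ≠ 0) :
    ∃ W : Matrix (Fin (n + 1)) (Fin (n + 1)) ℤ, IsUnit W.det ∧
      0 < ‖evalInt A fun i => W i 0‖ ∧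
      ∀ w, w ≠ 0 → 2 / 3 * ‖evalInt A fun i => W i 0‖ ≤ ‖evalInt A w‖ := by
  obtain ⟨μ, hμ, hμA⟩ := exists_pos_le_norm_evalInt hA
  obtain ⟨s, hs⟩ : ∃ s : Set ℝ, s = {t | ∃ w, w ≠ 0 ∧ ‖evalInt A w‖ = t} := ⟨_, rfl⟩
  have hsne : s.Nonempty := ⟨_, by rw [hs]; exact ⟨1, one_ne_zero, rfl⟩⟩
  have hsbdd : BddBelow s := ⟨μ, by rw [hs]; rintro _ ⟨w, hw, rfl⟩; exact hμA w hw⟩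
  have hinf : μ ≤ sInf s := le_csInf hsne (by rw [hs]; rintro _ ⟨w, hw, rfl⟩; exact hμA w hw)
  have hmin : ∀ w, w ≠ 0 → sInf s ≤ ‖evalInt A w‖ := fun w hw =>
    csInf_le hsbdd (by rw [hs]; exact ⟨w, hw, rfl⟩)
  obtain ⟨t, hts, ht⟩ := exists_lt_of_csInf_lt hsne (show sInf s < 3 / 2 * sInf s by linarith)
  rw [hs] at hts
  obtain ⟨v, hv, rfl⟩ := hts
  obtain ⟨d, bM, bN, f, a, hsnf⟩ := Submodule.smithNormalForm (Pi.basisFun ℤ (Fin (n + 1)))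
    (Submodule.span ℤ {v})
  have hv' : ∃ (j : Fin (n + 1)) (m : ℤ), v = m • bM j := by
    have hd : d = 1 := by
      have h1 := (LinearEquiv.toSpanNonzeroSingleton ℤ _ v hv).finrank_eq
      rw [Module.finrank_self, Module.finrank_eq_card_basis bN, Fintype.card_fin] at h1
      exact h1.symm
    subst hd
    have h1 := bN.sum_repr ⟨v, Submodule.mem_span_singleton_self v⟩
    rw [Fin.sum_univ_one] at h1
    have h2 := congrArg Subtype.val h1
    rw [Submodule.coe_smul, hsnf, smul_smul] at h2
    exact ⟨_, _, h2.symm⟩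
  obtain ⟨j, m, hvm⟩ := hv'
  have hm : m ≠ 0 := by rintro rfl; exact hv (by rw [hvm, zero_smul])
  obtain ⟨b, hb⟩ : ∃ b : Module.Basis (Fin (n + 1)) ℤ (Fin (n + 1) → ℤ),
    b = bM.reindex (Equiv.swap 0 j) := ⟨_, rfl⟩
  have hb0 : v = m • b 0 := by rw [hb, Module.Basis.reindex_apply]; simpa using hvm
  have hnorm : ‖evalInt A (b 0)‖ ≤ ‖evalInt A v‖ := by
    have h1 : evalInt A v = (m : ℝ) • evalInt A (b 0) := by
      ext i
      simp only [evalInt_apply, hb0, Pi.smul_apply, smul_eq_mul, Int.cast_mul, Finset.mul_sum]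
      exact Finset.sum_congr rfl fun k _ => by ring
    rw [h1, norm_smul]
    have h2 : (1 : ℝ) ≤ ‖(m : ℝ)‖ := by
      rw [Real.norm_eq_abs]; exact_mod_cast Int.one_le_abs hm
    nlinarith [norm_nonneg (evalInt A (b 0))]
  refine ⟨fun i k => b k i, ?_, ?_, ?_⟩
  · have h1 := (Pi.basisFun ℤ (Fin (n + 1))).isUnit_det b
    rw [Module.Basis.det_apply] at h1
    exact h1
  · exact hμ.trans_le (hμA _ (b.ne_zero 0))
  · intro w hw
    have := hmin w hw
    change 2 / 3 * ‖evalInt A (b 0)‖ ≤ _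
    linarith

lemma abs_det_map_of_isUnit {n : ℕ} {U : Matrix (Fin n) (Fin n) ℤ} (hU : IsUnit U.det) :
    |(U.map (Int.castRingHom ℝ)).det| = 1 := by
  have h := RingHom.map_det (Int.castRingHom ℝ) U
  rw [RingHom.mapMatrix_apply] at h
  rw [← h]
  rcases Int.isUnit_iff.mp hU with h | h <;> simp [h]

lemma det_eq_mul_schur {n : ℕ} (A : Matrix (Fin (n + 1)) (Fin (n + 1)) ℝ) (hA : A 0 0 ≠ 0) :
    A.det = A 0 0 * det (of fun i j : Fin n =>
      A i.succ j.succ - A i.succ 0 * (A 0 j.succ / A 0 0)) := by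
  obtain ⟨B, hB⟩ : ∃ B : Matrix (Fin (n + 1)) (Fin (n + 1)) ℝ,
    B = of fun i => Fin.cons (A i 0) fun j => A i j.succ - A i 0 * (A 0 j.succ / A 0 0) := ⟨_, rfl⟩
  have h1 : A.det = B.det := by
    rw [← det_transpose A, ← det_transpose B]
    refine det_eq_of_forall_row_eq_smul_add_const (k := 0)
      (Fin.cons 0 fun j => A 0 j.succ / A 0 0) (by simp) fun j i => ?_
    induction j using Fin.cases with
    | zero => simp [hB]
    | succ j => simp [hB]; ring
  rw [h1, det_succ_row_zero, Fin.sum_univ_succ]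
  have h2 : ∀ j : Fin n, B 0 j.succ = 0 := fun j => by
    simp [hB, mul_div_cancel₀ _ hA]
  simp only [h2, mul_zero, zero_mul, Finset.sum_const_zero, add_zero]
  simp only [Fin.val_zero, pow_zero, one_mul]
  congr 1
  · simp [hB]
  · congr 1
    ext i j
    simp [hB]

/-- Every lattice has a basis which, with respect to suitably ordered coordinates, is reduced in the
sense of Minkowski and Davenport. -/
theorem exists_reduced_basis (n : ℕ) : ∃ C : ℝ, 1 ≤ C ∧
    ∀ A : Matrix (Fin n) (Fin n) ℝ, A.det ≠ 0 →
      ∃ (U : Matrix (Fin n) (Fin n) ℤ) (π : Equiv.Perm (Fin n)) (w : Fin n → ℝ), IsUnit U.det ∧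
        (∀ i, 0 < w i) ∧
        (∀ i j, |(A * U.map (Int.castRingHom ℝ)) (π i) j| ≤ C * w i) ∧
        (∀ i j, |(A * U.map (Int.castRingHom ℝ)) (π i) j| ≤ C * w j) ∧ ∏ i, w i ≤ C * |A.det| := by
  induction n with
  | zero =>
    exact ⟨1, le_rfl, fun A _ => ⟨1, 1, 1, by simp, fun i => i.elim0, fun i => i.elim0,
      fun i => i.elim0, by simp⟩⟩
  | succ n ih =>
    obtain ⟨C, hC, ih⟩ := ih
    refine ⟨6 * C, by linarith, fun A hA => ?_⟩
    obtain ⟨W, hW, hβ, hmin⟩ := exists_short_unimodular hA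
    obtain ⟨β, hβdef⟩ : ∃ β : ℝ, β = ‖evalInt A fun i => W i 0‖ := ⟨_, rfl⟩
    rw [← hβdef] at hβ hmin
    obtain ⟨A₁, hA₁⟩ : ∃ A₁, A₁ = A * W.map (Int.castRingHom ℝ) := ⟨_, rfl⟩
    have hA₁0 : ∀ i, A₁ i 0 = evalInt A (fun i => W i 0) i := fun i => by
      rw [hA₁]; simp [Matrix.mul_apply, evalInt_apply]
    obtain ⟨i₀, -, hi₀⟩ := Finset.exists_max_image univ (fun i => |A₁ i 0|) univ_nonempty
    have hβi₀ : |A₁ i₀ 0| = β := by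
      rw [hβdef]
      refine le_antisymm ?_ ((pi_norm_le_iff_of_nonneg (abs_nonneg _)).mpr fun i => ?_)
      · rw [hA₁0]; exact norm_le_pi_norm (evalInt A fun i => W i 0) i₀
      · rw [← hA₁0]; exact hi₀ i (mem_univ i)
    obtain ⟨A₂, hA₂⟩ : ∃ A₂, A₂ = A₁.submatrix (Equiv.swap 0 i₀) id := ⟨_, rfl⟩
    have hA₂00 : |A₂ 0 0| = β := by simp [hA₂, hβi₀]
    have hA₂0 : ∀ i, |A₂ i 0| ≤ β := fun i => by
      rw [← hβi₀, hA₂]; exact hi₀ _ (mem_univ _)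
    have hA₂ne : A₂ 0 0 ≠ 0 := by rw [← abs_pos, hA₂00]; exact hβ
    have hdet₂ : |A₂.det| = |A.det| := by
      rw [hA₂, det_permute, hA₁, det_mul, abs_mul, abs_mul, abs_det_map_of_isUnit hW, mul_one]
      rcases Int.units_eq_one_or (Equiv.Perm.sign (Equiv.swap 0 i₀)) with h | h <;> simp [h]
    obtain ⟨A₃, hA₃⟩ : ∃ A₃ : Matrix (Fin n) (Fin n) ℝ, A₃ = of fun i j : Fin n =>
      A₂ i.succ j.succ - A₂ i.succ 0 * (A₂ 0 j.succ / A₂ 0 0) := ⟨_, rfl⟩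
    have hdet₃ : |A.det| = β * |A₃.det| := by
      rw [← hdet₂, det_eq_mul_schur A₂ hA₂ne, abs_mul, hA₂00, hA₃]
    have hA₃det : A₃.det ≠ 0 := by
      intro h
      rw [h, abs_zero, mul_zero, abs_eq_zero] at hdet₃
      exact hA hdet₃
    obtain ⟨U₃, π₃, w₃, hU₃, hw₃, hrow₃, hcol₃, hprod₃⟩ := ih A₃ hA₃det
    obtain ⟨s, hs⟩ : ∃ s : Fin n → ℝ, s = fun j => (∑ k, A₂ 0 k.succ * U₃ k j) / A₂ 0 0 := ⟨_, rfl⟩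
    obtain ⟨U₄, hU₄⟩ : ∃ U₄ : Matrix (Fin (n + 1)) (Fin (n + 1)) ℤ,
      U₄ = of (Fin.cons (Fin.cons 1 fun j => -round (s j)) fun i => Fin.cons 0 fun j => U₃ i j) := ⟨_, rfl⟩
    have hU₄det : U₄.det = U₃.det := by
      rw [det_succ_column_zero, Fin.sum_univ_succ]
      have h0 : ∀ i : Fin n, U₄ i.succ 0 = 0 := fun i => by simp [hU₄]
      have h1 : U₄ 0 0 = 1 := by simp [hU₄]
      simp only [h0, h1, mul_zero, zero_mul, Finset.sum_const_zero, add_zero, Fin.val_zero, pow_zero,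
        one_mul]
      congr 1
      ext i j
      simp [hU₄]
    have hround : ∀ j, |s j - round (s j)| ≤ 1 / 2 := fun j => abs_sub_round _
    have hB0 : ∀ i, (A₂ * U₄.map (Int.castRingHom ℝ)) i 0 = A₂ i 0 := by
      intro i
      rw [Matrix.mul_apply, Fin.sum_univ_succ]
      simp [hU₄]
    have hBs : ∀ i j, (A₂ * U₄.map (Int.castRingHom ℝ)) i (Fin.succ j) =
        -(round (s j) : ℝ) * A₂ i 0 + ∑ k, A₂ i k.succ * U₃ k j := by
      intro i j
      rw [Matrix.mul_apply, Fin.sum_univ_succ]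
      simp [hU₄]; ring
    have hs' : ∀ j, A₂ 0 0 * s j = ∑ k, A₂ 0 k.succ * U₃ k j := fun j => by
      rw [hs, mul_div_cancel₀ _ hA₂ne]
    have hB0s : ∀ j, (A₂ * U₄.map (Int.castRingHom ℝ)) 0 (Fin.succ j) =
        A₂ 0 0 * (s j - round (s j)) := by
      intro j
      rw [hBs, ← hs']; ring
    have hBss : ∀ i j, (A₂ * U₄.map (Int.castRingHom ℝ)) (Fin.succ i) (Fin.succ j) =
        (A₃ * U₃.map (Int.castRingHom ℝ)) i j + A₂ i.succ 0 * (s j - round (s j)) := by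
      intro i j
      have h1 : (A₃ * U₃.map (Int.castRingHom ℝ)) i j =
          ∑ k, A₂ i.succ k.succ * U₃ k j - A₂ i.succ 0 * s j := by
        have h2 : s j = (∑ k, A₂ 0 k.succ * U₃ k j) / A₂ 0 0 := by rw [hs]
        rw [Matrix.mul_apply, h2, Finset.sum_div, Finset.mul_sum, ← Finset.sum_sub_distrib]
        refine Finset.sum_congr rfl fun k _ => ?_
        simp [hA₃]; ring
      rw [hBs, h1]; ring
    have hsmall : ∀ i j, |A₂ i 0 * (s j - round (s j))| ≤ β / 2 := by
      intro i j
      rw [abs_mul]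
      nlinarith [hA₂0 i, hround j, abs_nonneg (A₂ i 0), abs_nonneg (s j - round (s j))]
    have hU : IsUnit (W * U₄).det := by rw [det_mul, hU₄det]; exact hW.mul hU₃
    have hAU : ∀ i j, (A * (W * U₄).map (Int.castRingHom ℝ)) (Equiv.swap 0 i₀ i) j =
        (A₂ * U₄.map (Int.castRingHom ℝ)) i j := by
      intro i j
      rw [Matrix.map_mul, ← Matrix.mul_assoc, ← hA₁, hA₂]
      rfl
    have hβw : ∀ j, β ≤ 6 * C * w₃ j := by
      intro j
      have hne : (fun k => (W * U₄) k (Fin.succ j)) ≠ 0 := by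
        intro h0
        apply hU.ne_zero
        exact det_eq_zero_of_column_eq_zero (Fin.succ j) fun i => congrFun h0 i
      have h1 := hmin _ hne
      have h2 : ‖evalInt A fun k => (W * U₄) k (Fin.succ j)‖ ≤ C * w₃ j + β / 2 := by
        have hw := hw₃ j
        refine (pi_norm_le_iff_of_nonneg (by positivity)).mpr fun i => ?_
        have h3 : evalInt A (fun k => (W * U₄) k (Fin.succ j)) i =
            (A₂ * U₄.map (Int.castRingHom ℝ)) (Equiv.swap 0 i₀ i) (Fin.succ j) := by
          rw [← hAU, Equiv.swap_apply_self]
          rfl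
        rw [h3, Real.norm_eq_abs]
        generalize Equiv.swap 0 i₀ i = i'
        induction i' using Fin.cases with
        | zero =>
          rw [hB0s]
          have : 0 ≤ C * w₃ j := by positivity
          linarith [hsmall 0 j]
        | succ i' =>
          rw [hBss]
          have h4 := hcol₃ (π₃.symm i') j
          rw [Equiv.apply_symm_apply] at h4
          exact (abs_add_le _ _).trans (add_le_add h4 (hsmall _ j))
      linarith
    refine ⟨W * U₄, Equiv.Perm.decomposeFin.symm (i₀, π₃), Fin.cons β w₃, hU, ?_, ?_, ?_, ?_⟩
    · exact Fin.cases hβ hw₃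
    · intro i j
      induction i using Fin.cases with
      | zero =>
        rw [Equiv.Perm.decomposeFin_symm_apply_zero, ← Equiv.swap_apply_left 0 i₀, hAU, Fin.cons_zero]
        induction j using Fin.cases with
        | zero => rw [hB0, hA₂00]; nlinarith
        | succ j => rw [hB0s]; nlinarith [hsmall 0 j]
      | succ i =>
        rw [Equiv.Perm.decomposeFin_symm_apply_succ, hAU, Fin.cons_succ]
        induction j using Fin.cases with
        | zero => rw [hB0]; linarith [hA₂0 (π₃ i).succ, hβw i]
        | succ j =>
          rw [hBss]
          have h1 := (abs_add_le _ _).trans (add_le_add (hrow₃ i j) (hsmall (π₃ i).succ j))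
          have := hβw i
          have := mul_pos (one_pos.trans_le hC) (hw₃ i)
          linarith
    · intro i j
      induction i using Fin.cases with
      | zero =>
        rw [Equiv.Perm.decomposeFin_symm_apply_zero, ← Equiv.swap_apply_left 0 i₀, hAU]
        induction j using Fin.cases with
        | zero => rw [hB0, hA₂00, Fin.cons_zero]; nlinarith
        | succ j => rw [hB0s, Fin.cons_succ]; linarith [hsmall 0 j, hβw j]
      | succ i =>
        rw [Equiv.Perm.decomposeFin_symm_apply_succ, hAU]
        induction j using Fin.cases with
        | zero => rw [hB0, Fin.cons_zero]; nlinarith [hA₂0 (π₃ i).succ]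
        | succ j =>
          rw [hBss, Fin.cons_succ]
          have h1 := (abs_add_le _ _).trans (add_le_add (hcol₃ i j) (hsmall (π₃ i).succ j))
          have := hβw j
          have := mul_pos (one_pos.trans_le hC) (hw₃ j)
          linarith
    · rw [Fin.prod_univ_succ, Fin.cons_zero, hdet₃]
      simp only [Fin.cons_succ]
      have := mul_le_mul_of_nonneg_left hprod₃ hβ.le
      have h2 : 0 ≤ β * (C * |A₃.det|) := by positivity
      nlinarith

end SubspaceThm

namespace SubspaceThm

open Finset Matrix

/-- The increasing enumeration of a `p`-element subset of `Fin n`. -/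
noncomputable def enum {n p : ℕ} (I : Set.powersetCard (Fin n) p) : Fin p → Fin n :=
  Set.powersetCard.ofFinEmbEquiv.symm I

lemma enum_injective {n p : ℕ} (I : Set.powersetCard (Fin n) p) : Function.Injective (enum I) :=
  (Set.powersetCard.ofFinEmbEquiv.symm I).injective

lemma mem_range_enum {n p : ℕ} {I : Set.powersetCard (Fin n) p} {i : Fin n} :
    i ∈ Set.range (enum I) ↔ i ∈ I.1 :=
  Set.powersetCard.mem_range_ofFinEmbEquiv_symm_iff_mem I i

lemma prod_enum {n p : ℕ} {M : Type*} [CommMonoid M] (I : Set.powersetCard (Fin n) p)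
    (f : Fin n → M) : ∏ k, f (enum I k) = ∏ i ∈ I.1, f i := by
  have h : I.1 = univ.image (enum I) := by
    ext i
    rw [← mem_range_enum]; simp
  rw [h, Finset.prod_image fun a _ b _ hab => enum_injective I hab]

/-- The Plücker coordinates of a `p`-tuple of vectors. -/
noncomputable def plucker {R : Type*} [CommRing R] {n p : ℕ} (v : Fin p → Fin n → R)
    (I : Set.powersetCard (Fin n) p) : R :=
  (Matrix.of fun i j => v i (enum I j)).det

/-- The `p`-th compound of a matrix. -/
noncomputable def compound {R : Type*} [CommRing R] {n : ℕ} (p : ℕ) (M : Matrix (Fin n) (Fin n) R) :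
    Matrix (Set.powersetCard (Fin n) p) (Set.powersetCard (Fin n) p) R :=
  Matrix.of fun I J => plucker (fun k i => M i (enum J k)) I

lemma plucker_eq_pairing {R : Type*} [CommRing R] {n p : ℕ} (v : Fin p → Fin n → R)
    (I : Set.powersetCard (Fin n) p) :
    plucker v I = exteriorPower.ιMultiDual R p (Pi.basisFun R (Fin n)) I
      (exteriorPower.ιMulti R p v) := by
  rw [exteriorPower.ιMultiDual_apply_ιMulti]
  rfl

/-- The Cauchy–Binet formula. -/
lemma plucker_mulVec {R : Type*} [CommRing R] {n p : ℕ} (M : Matrix (Fin n) (Fin n) R)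
    (v : Fin p → Fin n → R) :
    plucker (fun k => M *ᵥ v k) = compound p M *ᵥ plucker v := by
  ext I
  have h := ((Pi.basisFun R (Fin n)).exteriorPower p).sum_repr (exteriorPower.ιMulti R p v)
  have h2 := congrArg (fun z => exteriorPower.ιMultiDual R p (Pi.basisFun R (Fin n)) I
    (exteriorPower.map p (Matrix.toLin' M) z)) h
  simp only [map_sum, map_smul, exteriorPower.map_apply_ιMulti] at h2
  rw [plucker_eq_pairing]
  refine Eq.trans h2.symm ?_
  rw [Matrix.mulVec, dotProduct]
  refine Finset.sum_congr rfl fun J _ => ?_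
  rw [exteriorPower.basis_repr_apply, ← plucker_eq_pairing, exteriorPower.basis_apply,
    exteriorPower.map_apply_ιMulti_family, smul_eq_mul, mul_comm]
  congr 1
  rw [compound, Matrix.of_apply, plucker_eq_pairing]
  have : (fun k i => M i (enum J k)) = (Matrix.toLin' M ∘ Pi.basisFun R (Fin n)) ∘
      Set.powersetCard.ofFinEmbEquiv.symm J := by
    ext k i
    simp [enum]
  rw [this]
  rfl

lemma plucker_single {R : Type*} [CommRing R] {n p : ℕ} (J : Set.powersetCard (Fin n) p) :
    plucker (fun k => Pi.single (enum J k) (1 : R)) = Pi.single J 1 := by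
  ext I
  rw [plucker_eq_pairing]
  have : (fun k => Pi.single (enum J k) (1 : R)) =
      (Pi.basisFun R (Fin n)) ∘ Set.powersetCard.ofFinEmbEquiv.symm J := by
    ext k i; simp [enum]
  rw [this]
  change exteriorPower.ιMultiDual R p (Pi.basisFun R (Fin n)) I
    (exteriorPower.ιMulti_family R p (Pi.basisFun R (Fin n)) J) = _
  rw [← exteriorPower.basis_repr_apply, exteriorPower.basis_repr, Finsupp.single_apply,
    Pi.single_apply]
  simp only [eq_comm]

lemma compound_mul {R : Type*} [CommRing R] {n : ℕ} (p : ℕ) (M N : Matrix (Fin n) (Fin n) R) :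
    compound p (M * N) = compound p M * compound p N := by
  ext I J
  exact congrFun (plucker_mulVec M fun k i => N i (enum J k)) I

lemma compound_one {R : Type*} [CommRing R] {n : ℕ} (p : ℕ) :
    compound p (1 : Matrix (Fin n) (Fin n) R) = 1 := by
  ext I J
  have := congrFun (plucker_single (R := R) J) I
  rw [Matrix.one_apply, ← Pi.single_apply, ← this]
  rw [compound, Matrix.of_apply]
  congr 1
  ext k i
  rw [Matrix.one_apply, Pi.single_apply]

lemma isUnit_det_compound {R : Type*} [CommRing R] {n : ℕ} (p : ℕ)
    {M : Matrix (Fin n) (Fin n) R} (hM : IsUnit M.det) : IsUnit (compound p M).det := by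
  have h : compound p M * compound p M⁻¹ = 1 := by
    rw [← compound_mul, Matrix.mul_nonsing_inv _ hM, compound_one]
  exact (Matrix.isUnit_iff_isUnit_det _).mp (IsUnit.of_mul_eq_one _ h)

lemma compound_map {R S : Type*} [CommRing R] [CommRing S] (f : R →+* S) {n : ℕ} (p : ℕ)
    (M : Matrix (Fin n) (Fin n) R) : compound p (M.map f) = (compound p M).map f := by
  ext I J
  simp only [compound, plucker, Matrix.of_apply, Matrix.map_apply, RingHom.map_det]
  rfl

lemma isAlgebraic_compound {n : ℕ} (p : ℕ) {M : Matrix (Fin n) (Fin n) ℝ}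
    (hM : ∀ i j, IsAlgebraic ℚ (M i j)) (I J) : IsAlgebraic ℚ (compound p M I J) := by
  exact isAlgebraic_det fun _ _ => hM _ _

/-- A bound for a determinant in terms of bounds for its rows. -/
lemma abs_det_le_of_row {m : ℕ} (A : Matrix (Fin m) (Fin m) ℝ) (r : Fin m → ℝ)
    (h : ∀ i j, |A i j| ≤ r i) : |A.det| ≤ m.factorial * ∏ i, r i := by
  rw [← Matrix.det_transpose, Matrix.det_apply]
  refine (Finset.abs_sum_le_sum_abs _ _).trans ?_
  have : ∀ σ ∈ (univ : Finset (Equiv.Perm (Fin m))),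
      |Equiv.Perm.sign σ • ∏ i, Aᵀ (σ i) i| ≤ ∏ i, r i := by
    intro σ _
    rw [Units.smul_def, zsmul_eq_mul, abs_mul, Finset.abs_prod]
    have : |((Equiv.Perm.sign σ : ℤ) : ℝ)| = 1 := by
      rcases Int.units_eq_one_or (Equiv.Perm.sign σ) with h | h <;> simp [h]
    rw [this, one_mul]
    exact Finset.prod_le_prod (fun _ _ => abs_nonneg _) fun i _ => h _ _
  refine (Finset.sum_le_sum this).trans ?_
  simp [Fintype.card_perm]

lemma abs_compound_le_of_row {n : ℕ} (p : ℕ) {M : Matrix (Fin n) (Fin n) ℝ} {r : Fin n → ℝ}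
    (h : ∀ i j, |M i j| ≤ r i) (I J) : |compound p M I J| ≤ p.factorial * ∏ i ∈ I.1, r i := by
  rw [compound, Matrix.of_apply, plucker, ← Matrix.det_transpose, ← prod_enum]
  exact abs_det_le_of_row _ _ fun i j => h _ _

lemma abs_compound_le_of_column {n : ℕ} (p : ℕ) {M : Matrix (Fin n) (Fin n) ℝ} {r : Fin n → ℝ}
    (h : ∀ i j, |M i j| ≤ r j) (I J) : |compound p M I J| ≤ p.factorial * ∏ i ∈ J.1, r i := by
  rw [compound, Matrix.of_apply, plucker, ← prod_enum]
  exact abs_det_le_of_row _ _ fun i j => h _ _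

lemma compound_diagonal_mul {R : Type*} [CommRing R] {n : ℕ} (p : ℕ) (d : Fin n → R)
    (M : Matrix (Fin n) (Fin n) R) (I J) :
    compound p (Matrix.diagonal d * M) I J = (∏ i ∈ I.1, d i) * compound p M I J := by
  rw [compound, Matrix.of_apply, plucker, ← prod_enum, compound, Matrix.of_apply, plucker,
    ← Matrix.det_mul_row]
  simp [Matrix.diagonal_mul]

/-- All points are contained in the same number of `p`-element subsets. -/
lemma exists_sum_powersetCard (n p : ℕ) : ∃ b : ℕ, b ≤ 2 ^ n ∧ ∀ f : Fin n → ℝ,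
    ∑ I : Set.powersetCard (Fin n) p, ∑ i ∈ I.1, f i = b * ∑ i, f i := by
  rcases p with _ | p
  · refine ⟨0, by simp, fun f => ?_⟩
    rw [Finset.sum_eq_zero fun I _ => ?_]
    · simp
    · rw [Finset.card_eq_zero.mp I.2, Finset.sum_empty]
  refine ⟨(n - 1).choose p, ?_, fun f => ?_⟩
  · exact (Nat.choose_le_two_pow _ _).trans (Nat.pow_le_pow_right (by norm_num) (Nat.sub_le _ _))
  have h1 : ∑ I : Set.powersetCard (Fin n) (p + 1), ∑ i ∈ I.1, f i =
      ∑ s ∈ (univ : Finset (Fin n)).powersetCard (p + 1), ∑ i ∈ s, f i := by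
    refine (Finset.sum_subtype _ (fun s => ?_) fun s => ∑ i ∈ s, f i).symm
    rw [Finset.mem_powersetCard]
    simp [Set.powersetCard]
  rw [h1, Finset.mul_sum]
  rw [Finset.sum_comm' (t' := univ)
    (s' := fun i => (univ.powersetCard (p + 1)).filter fun s => {i} ⊆ s) (by simp)]
  refine Finset.sum_congr rfl fun i _ => ?_
  rw [Finset.sum_const, Finset.card_filter_powersetCard_subset _ _ _ (by simp) (by simp)]
  simp

end SubspaceThm

namespace SubspaceThm

open Finset Matrix

/-- The subspace theorem for the penultimate minimum, with an arbitrary distinguished column. -/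
lemma exists_penultimate_column {α : Type} [Fintype α] [DecidableEq α] (a : α)
    (L : Matrix α α ℝ) (hL : ∀ i j, IsAlgebraic ℚ (L i j)) (hdet : L.det ≠ 0)
    (c : α → ℝ) (hc : ∑ i, c i < 0) :
    ∃ (q₁ : ℝ) (T : Finset (Submodule ℚ (α → ℚ))), (∀ W ∈ T, W ≠ ⊤) ∧
      ∀ q, q₁ ≤ q → ∀ G : Matrix α α ℤ, G.det ≠ 0 →
        (∀ i j, j ≠ a → |∑ k, L i k * G k j| ≤ Real.exp (c i * q)) →
        ∃ W ∈ T, ∀ j, j ≠ a → (fun i => (G i j : ℚ)) ∈ W := by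
  classical
  obtain ⟨e, he⟩ : ∃ e : Option {y : α // y ≠ a} ≃ α, ∀ y, e (some y) = y :=
    ⟨Equiv.optionSubtypeNe a, Equiv.optionSubtypeNe_some a⟩
  obtain ⟨q₁, T, hT, h⟩ := exists_penultimate (L.submatrix e e) (fun _ _ => hL _ _)
    (by rwa [Matrix.det_submatrix_equiv_self]) (c ∘ e)
    (by rwa [← e.sum_comp] at hc)
  refine ⟨q₁, T.image fun W => W.comap (LinearMap.funLeft ℚ ℚ e), ?_, fun q hq G hG hb => ?_⟩
  · intro W hW
    obtain ⟨W, hW', rfl⟩ := Finset.mem_image.mp hW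
    intro htop
    apply hT W hW'
    rw [eq_top_iff]
    intro f _
    have : f ∘ e.symm ∈ W.comap (LinearMap.funLeft ℚ ℚ e) := htop ▸ Submodule.mem_top
    rw [Submodule.mem_comap] at this
    convert this using 1
    ext i; simp [LinearMap.funLeft]
  · obtain ⟨W, hW, hmem⟩ := h q hq (G.submatrix e e)
      (by rwa [Matrix.det_submatrix_equiv_self]) (fun i j => by
        have := hb (e i) j j.2
        rw [← e.sum_comp] at this
        simpa [he] using this)
    refine ⟨_, Finset.mem_image_of_mem _ hW, fun j hj => ?_⟩
    rw [Submodule.mem_comap]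
    have := hmem ⟨j, hj⟩
    simp only [Matrix.submatrix_apply, he] at this
    exact this

/-- The vectors all of whose exterior products lie in a given subspace. -/
noncomputable def wedgePullback {n p : ℕ} (k : Fin p)
    (H : Submodule ℚ (Set.powersetCard (Fin n) p → ℚ)) : Submodule ℚ (Fin n → ℚ) where
  carrier := {x | ∀ v : Fin p → Fin n → ℚ, plucker (Function.update v k x) ∈ H}
  zero_mem' v := by
    have : plucker (Function.update v k 0) = 0 := by
      ext I
      rw [plucker_eq_pairing, AlternatingMap.map_update_zero, map_zero]; rfl
    rw [this]; exact H.zero_mem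
  add_mem' {x y} hx hy v := by
    have : plucker (Function.update v k (x + y)) =
        plucker (Function.update v k x) + plucker (Function.update v k y) := by
      ext I
      rw [Pi.add_apply, plucker_eq_pairing, plucker_eq_pairing, plucker_eq_pairing,
        AlternatingMap.map_update_add, map_add]
    rw [this]; exact H.add_mem (hx v) (hy v)
  smul_mem' r x hx v := by
    have : plucker (Function.update v k (r • x)) = r • plucker (Function.update v k x) := by
      ext I
      rw [Pi.smul_apply, plucker_eq_pairing, plucker_eq_pairing,
        AlternatingMap.map_update_smul, map_smul]
    rw [this]; exact H.smul_mem r (hx v)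

lemma mem_wedgePullback {n p : ℕ} {k : Fin p}
    {H : Submodule ℚ (Set.powersetCard (Fin n) p → ℚ)} {x : Fin n → ℚ} :
    x ∈ wedgePullback k H ↔ ∀ v : Fin p → Fin n → ℚ, plucker (Function.update v k x) ∈ H :=
  Iff.rfl

lemma wedgePullback_ne_top {n p : ℕ} {k : Fin p}
    {H : Submodule ℚ (Set.powersetCard (Fin n) p → ℚ)} (hH : H ≠ ⊤) : wedgePullback k H ≠ ⊤ := by
  classical
  intro h
  apply hH
  rw [eq_top_iff]
  have hs : ∀ J, (Pi.single J 1 : Set.powersetCard (Fin n) p → ℚ) ∈ H := by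
    intro J
    rw [← plucker_single]
    have h1 : Pi.single (enum J k) (1 : ℚ) ∈ wedgePullback k H := h ▸ Submodule.mem_top
    have h2 := mem_wedgePullback.mp h1 fun k => Pi.single (enum J k) (1 : ℚ)
    rwa [Function.update_eq_self] at h2
  intro f _
  rw [pi_eq_sum_univ' f]
  exact H.sum_mem fun J _ => H.smul_mem _ (hs J)

/-- Lattice vectors without components outside the first group of minima lie in the pullback. -/
lemma mulVec_mem_wedgePullback {n p : ℕ} (k : Fin p) (I₀ : Set.powersetCard (Fin n) p)
    {H : Submodule ℚ (Set.powersetCard (Fin n) p → ℚ)} {U : Matrix (Fin n) (Fin n) ℤ}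
    (hU : IsUnit U.det) (hH : ∀ J, J ≠ I₀ → (fun I => ((compound p U I J : ℤ) : ℚ)) ∈ H)
    {y : Fin n → ℤ} (hy : ∀ i ∈ I₀.1, y i = 0) : (fun i => ((U *ᵥ y) i : ℚ)) ∈ wedgePullback k H := by
  rw [mem_wedgePullback]
  intro v
  obtain ⟨M, hM⟩ : ∃ M : Matrix (Fin n) (Fin n) ℚ, M = U.map (Int.castRingHom ℚ) := ⟨_, rfl⟩
  have hMu : IsUnit M.det := by
    rw [hM, ← RingHom.mapMatrix_apply, ← RingHom.map_det]
    exact hU.map _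
  obtain ⟨v', hv'⟩ : ∃ v' : Fin p → Fin n → ℚ,
      v' = Function.update (fun k => M⁻¹ *ᵥ v k) k fun i => (y i : ℚ) := ⟨_, rfl⟩
  have h1 : Function.update v k (fun i => ((U *ᵥ y) i : ℚ)) = fun l => M *ᵥ v' l := by
    ext l i
    rcases eq_or_ne l k with rfl | hl
    · simp [hv', hM, Matrix.mulVec, dotProduct]
    · rw [Function.update_of_ne hl, hv', Function.update_of_ne hl, Matrix.mulVec_mulVec,
        Matrix.mul_nonsing_inv _ hMu, Matrix.one_mulVec]
  have h0 : plucker v' I₀ = 0 := by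
    refine Matrix.det_eq_zero_of_row_eq_zero k fun j => ?_
    have : enum I₀ j ∈ I₀.1 := mem_range_enum.mp ⟨j, rfl⟩
    simp [hv', hy _ this]
  rw [h1, plucker_mulVec]
  have h2 : compound p M *ᵥ plucker v' = ∑ J, plucker v' J • fun I => ((compound p U I J : ℤ) : ℚ) := by
    ext I
    rw [Finset.sum_apply, Matrix.mulVec, dotProduct, hM, compound_map]
    refine Finset.sum_congr rfl fun J _ => ?_
    simp [mul_comm]
  rw [h2]
  refine H.sum_mem fun J _ => ?_
  rcases eq_or_ne J I₀ with rfl | hJ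
  · rw [h0, zero_smul]; exact H.zero_mem
  · exact H.smul_mem _ (hH J hJ)

lemma exists_gap {n : ℕ} (μ : Fin n → ℝ) (a : ℝ) {δ : ℝ} (hδ : 0 < δ) :
    ∃ t, a ≤ t ∧ t ≤ a + n * δ ∧ ∀ j, μ j ≤ t ∨ t + δ < μ j := by
  by_contra! h
  have h1 : ∀ k : Fin (n + 1), ∃ j, a + k * δ < μ j ∧ μ j ≤ a + k * δ + δ := by
    intro k
    have hk : (k : ℝ) ≤ n := by exact_mod_cast Nat.lt_succ_iff.mp k.2
    exact h (a + k * δ) (by nlinarith [(k : ℕ).cast_nonneg (α := ℝ)]) (by nlinarith)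
  choose f hf using h1
  obtain ⟨k, l, hkl, hfe⟩ := Fintype.exists_ne_map_eq_of_card_lt f (by simp)
  wlog hlt : k < l generalizing k l
  · exact this l k hkl.symm hfe.symm (lt_of_le_of_ne (not_lt.mp hlt) hkl.symm)
  have h2 : (k : ℝ) + 1 ≤ l := by exact_mod_cast hlt
  have h3 := (hf k).2
  have h4 := (hf l).1
  rw [← hfe] at h4
  nlinarith

lemma sum_add_le_of_gap {n : ℕ} (μ : Fin n → ℝ) {t δ : ℝ} (hδ : 0 < δ) {I₀ J : Finset (Fin n)}
    (h0 : ∀ j ∈ I₀, t + δ ≤ μ j) (h1 : ∀ j, j ∉ I₀ → μ j ≤ t) (hcard : J.card = I₀.card)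
    (hne : J ≠ I₀) : ∑ j ∈ J, μ j + δ ≤ ∑ j ∈ I₀, μ j := by
  have hs := Finset.card_sdiff_comm hcard
  have hpos : 1 ≤ (J \ I₀).card := by
    rw [Nat.one_le_iff_ne_zero, Ne, Finset.card_eq_zero, Finset.sdiff_eq_empty_iff_subset]
    exact fun h => hne (Finset.eq_of_subset_of_card_le h hcard.ge)
  have e1 := Finset.sum_inter_add_sum_sdiff J I₀ μ
  have e2 := Finset.sum_inter_add_sum_sdiff I₀ J μ
  have b1 : ∑ j ∈ J \ I₀, μ j ≤ (J \ I₀).card • t :=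
    Finset.sum_le_card_nsmul _ _ _ fun j hj => h1 j (Finset.mem_sdiff.mp hj).2
  have b2 : (I₀ \ J).card • (t + δ) ≤ ∑ j ∈ I₀ \ J, μ j :=
    Finset.card_nsmul_le_sum _ _ _ fun j hj => h0 j (Finset.mem_sdiff.mp hj).1
  rw [Finset.inter_comm] at e2
  rw [← hs, nsmul_eq_mul] at b2
  rw [nsmul_eq_mul] at b1
  have : (1 : ℝ) ≤ ((J \ I₀).card : ℝ) := by exact_mod_cast hpos
  nlinarith

/-- The parametric subspace theorem for bases with a prescribed gap in the successive minima. -/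
lemma exists_subspaces_of_gap {n : ℕ} (L : Matrix (Fin n) (Fin n) ℝ)
    (hL : ∀ i j, IsAlgebraic ℚ (L i j)) (hdet : L.det ≠ 0) (c ν : Fin n → ℝ) {C η δ : ℝ}
    (hC : 1 ≤ C) (hη : 0 < η) {I₀ : Finset (Fin n)} (hI₀ : I₀.Nonempty)
    (hneg : ∑ I : Set.powersetCard (Fin n) I₀.card, (∑ i ∈ I.1, (c i + ν i) + η) < δ) :
    ∃ (q₁ : ℝ) (T : Finset (Submodule ℚ (Fin n → ℚ))), (∀ W ∈ T, W ≠ ⊤) ∧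
      ∀ q, q₁ ≤ q → ∀ (U : Matrix (Fin n) (Fin n) ℤ) (B : Matrix (Fin n) (Fin n) ℝ) (w : Fin n → ℝ),
        IsUnit U.det → (∀ i, 0 < w i) → (∀ i, w i ≤ Real.exp (ν i * q)) →
        (∀ J : Finset (Fin n), J.card = I₀.card → J ≠ I₀ →
          ∏ i ∈ J, w i ≤ Real.exp (-δ * q) * ∏ i ∈ I₀, w i) →
        L * U.map (Int.castRingHom ℝ) = Matrix.diagonal (fun i => Real.exp (c i * q)) * B →
        (∀ i j, |B i j| ≤ C * w i) → (∀ i j, |B i j| ≤ C * w j) →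
        ∀ y : Fin n → ℤ, (∀ i ∈ I₀, y i = 0) → ∃ W ∈ T, (fun i => ((U *ᵥ y) i : ℚ)) ∈ W := by
  classical
  obtain ⟨p, hp⟩ : ∃ p, p = I₀.card := ⟨_, rfl⟩
  rw [← hp] at hneg
  obtain ⟨I, hI⟩ : ∃ I : Set.powersetCard (Fin n) p, I.1 = I₀ := ⟨⟨I₀, hp.symm⟩, rfl⟩
  obtain ⟨k⟩ : Nonempty (Fin p) := by
    rw [← Fin.pos_iff_nonempty, hp]; exact hI₀.card_pos
  obtain ⟨e, he⟩ : ∃ e : Set.powersetCard (Fin n) p → ℝ,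
    ∀ J, e J = ∑ i ∈ J.1, (c i + ν i) + η - if J = I then δ else 0 := ⟨_, fun _ => rfl⟩
  have hesum : ∑ J, e J < 0 := by
    simp only [he, Finset.sum_sub_distrib, Finset.sum_ite_eq', Finset.mem_univ, if_true]
    linarith
  obtain ⟨q₂, T, hT, h⟩ := exists_penultimate_column I (compound p L) (isAlgebraic_compound p hL)
    (isUnit_det_compound p hdet.isUnit).ne_zero e hesum
  obtain ⟨D, hD⟩ : ∃ D : ℝ, D = p.factorial * C ^ p := ⟨_, rfl⟩
  have hD1 : 1 ≤ D := by
    rw [hD]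
    exact one_le_mul_of_one_le_of_one_le (by exact_mod_cast Nat.one_le_of_lt p.factorial_pos)
      (one_le_pow₀ hC)
  refine ⟨max q₂ (Real.log D / η), T.image (wedgePullback k), ?_, ?_⟩
  · intro W hW
    obtain ⟨W, hW', rfl⟩ := Finset.mem_image.mp hW
    exact wedgePullback_ne_top (hT W hW')
  intro q hq U B w hU hw hwν hgap hLU hrow hcol y hy
  have hDq : D ≤ Real.exp (η * q) := by
    rw [← Real.log_le_iff_le_exp (by linarith), mul_comm, ← div_le_iff₀ hη]
    exact (le_max_right _ _).trans hq
  have hcb : ∀ J K, |compound p B J K| ≤ D * ∏ i ∈ J.1, w i := by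
    intro J K
    refine (abs_compound_le_of_row p hrow J K).trans (le_of_eq ?_)
    rw [Finset.prod_mul_distrib, Finset.prod_const, J.2, hD, mul_assoc]
  have hcb' : ∀ J K, |compound p B J K| ≤ D * ∏ i ∈ K.1, w i := by
    intro J K
    refine (abs_compound_le_of_column p hcol J K).trans (le_of_eq ?_)
    rw [Finset.prod_mul_distrib, Finset.prod_const, K.2, hD, mul_assoc]
  have hprod : ∀ J : Set.powersetCard (Fin n) p,
      ∏ i ∈ J.1, w i ≤ Real.exp ((∑ i ∈ J.1, ν i) * q) := by
    intro J
    rw [Finset.sum_mul, Real.exp_sum]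
    exact Finset.prod_le_prod (fun i _ => (hw i).le) fun i _ => hwν i
  have hbound : ∀ J K, K ≠ I → |compound p B J K| ≤
      Real.exp ((∑ i ∈ J.1, ν i + η - if J = I then δ else 0) * q) := by
    intro J K hK
    have hpos : 0 ≤ ∏ i ∈ J.1, w i := Finset.prod_nonneg fun i _ => (hw i).le
    have hsplit : ∀ z : ℝ, Real.exp ((∑ i ∈ J.1, ν i + η - z) * q) =
        Real.exp (η * q) * (Real.exp (-z * q) * Real.exp ((∑ i ∈ J.1, ν i) * q)) := by
      intro z
      rw [← Real.exp_add, ← Real.exp_add]; congr 1; ring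
    rw [hsplit]
    by_cases hJ : J = I
    · rw [if_pos hJ]
      refine (hcb' J K).trans ?_
      refine mul_le_mul hDq ?_ (Finset.prod_nonneg fun i _ => (hw i).le) (Real.exp_pos _).le
      refine (hgap K.1 (by rw [← hp]; exact K.2) (fun h => hK (Subtype.ext (h.trans hI.symm)))).trans ?_
      rw [← hI, ← hJ]
      exact mul_le_mul_of_nonneg_left (hprod J) (Real.exp_pos _).le
    · rw [if_neg hJ]
      refine (hcb J K).trans ?_
      refine mul_le_mul hDq ?_ hpos (Real.exp_pos _).le
      simpa using hprod J
  have hU' : (compound p U).det ≠ 0 := (isUnit_det_compound p hU).ne_zero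
  obtain ⟨W, hW, hmem⟩ := h q ((le_max_left _ _).trans hq) (compound p U) hU' (by
    intro J K hK
    have h1 : ∑ l, compound p L J l * ((compound p U l K : ℤ) : ℝ) =
        (∏ i ∈ J.1, Real.exp (c i * q)) * compound p B J K := by
      rw [← compound_diagonal_mul, ← hLU, compound_mul, compound_map, Matrix.mul_apply]
      rfl
    rw [h1, abs_mul, abs_of_nonneg (Finset.prod_nonneg fun i _ => (Real.exp_pos _).le)]
    refine (mul_le_mul_of_nonneg_left (hbound J K hK)
      (Finset.prod_nonneg fun i _ => (Real.exp_pos _).le)).trans (le_of_eq ?_)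
    rw [← Real.exp_sum, ← Real.exp_add, he, Finset.sum_add_distrib, ← Finset.sum_mul]
    congr 1; ring)
  exact ⟨_, Finset.mem_image_of_mem _ hW,
    mulVec_mem_wedgePullback k I hU hmem (fun i hi => hy i (hI ▸ hi))⟩

end SubspaceThm

namespace SubspaceThm

open Finset Matrix

/-- Cramer's rule in a basis adapted to the weights `w`. -/
lemma abs_coordinate_mul_le {n : ℕ} {B : Matrix (Fin n) (Fin n) ℝ} {C : ℝ} {w : Fin n → ℝ}
    (hC : 1 ≤ C) (hw : ∀ i, 0 < w i) (hB : ∀ i j, |B i j| ≤ C * w j) (hdet : B.det ≠ 0)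
    (hprod : ∏ i, w i ≤ C * |B.det|) {y : Fin n → ℝ} (hy : ∀ i, |(B *ᵥ y) i| ≤ 1) (j : Fin n) :
    |y j| * w j ≤ n.factorial * C ^ (n + 1) := by
  have h1 : B.cramer (B *ᵥ y) j = B.det * y j := by
    rw [Matrix.cramer_eq_adjugate_mulVec, Matrix.mulVec_mulVec, Matrix.adjugate_mul,
      Matrix.smul_mulVec, Matrix.one_mulVec]
    rfl
  have h2 : |B.cramer (B *ᵥ y) j| ≤
      n.factorial * ∏ k, Function.update (fun k => C * w k) j 1 k := by
    rw [Matrix.cramer_apply, ← Matrix.det_transpose]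
    refine abs_det_le_of_row _ _ fun k i => ?_
    rcases eq_or_ne k j with rfl | hk
    · simpa using hy i
    · simpa [hk] using hB i k
  rw [Finset.prod_update_of_mem (Finset.mem_univ j), one_mul] at h2
  have h3 : w j * ∏ k ∈ univ \ {j}, C * w k ≤ C ^ n * ∏ k, w k := by
    have h4 : C ^ n * ∏ k, w k = ∏ k, C * w k := by
      rw [Finset.prod_mul_distrib]; simp
    rw [h4, ← Finset.mul_prod_erase univ _ (Finset.mem_univ j), Finset.sdiff_singleton_eq_erase]
    refine mul_le_mul_of_nonneg_right ?_ (Finset.prod_nonneg fun k _ => ?_)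
    · nlinarith [hw j]
    · nlinarith [hw k]
  have hd : 0 < |B.det| := abs_pos.mpr hdet
  rw [h1, abs_mul] at h2
  have h5 : |B.det| * (|y j| * w j) ≤ |B.det| * (n.factorial * C ^ (n + 1)) :=
    calc |B.det| * (|y j| * w j) = |B.det| * |y j| * w j := by ring
      _ ≤ (n.factorial * ∏ k ∈ univ \ {j}, C * w k) * w j :=
          mul_le_mul_of_nonneg_right h2 (hw j).le
      _ = n.factorial * (w j * ∏ k ∈ univ \ {j}, C * w k) := by ring
      _ ≤ n.factorial * (C ^ n * (C * |B.det|)) := mul_le_mul_of_nonneg_left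
          (h3.trans (mul_le_mul_of_nonneg_left hprod (by positivity))) (by positivity)
      _ = _ := by ring
  exact le_of_mul_le_mul_left h5 hd

/-- Reduced bases for the parallelepipeds `|L i x| ≤ exp (c i * q)`, uniformly in `q`. -/
lemma exists_adapted_basis {n : ℕ} (L : Matrix (Fin n) (Fin n) ℝ) (hdet : L.det ≠ 0)
    (c : Fin n → ℝ) :
    ∃ (D : ℝ), 1 ≤ D ∧ ∀ q : ℝ, 0 ≤ q →
      ∃ (U : Matrix (Fin n) (Fin n) ℤ) (π : Equiv.Perm (Fin n)) (w : Fin n → ℝ)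
        (B : Matrix (Fin n) (Fin n) ℝ), IsUnit U.det ∧ (∀ i, 0 < w i) ∧
        L.submatrix π id * U.map (Int.castRingHom ℝ) =
          Matrix.diagonal (fun i => Real.exp (c (π i) * q)) * B ∧
        (∀ i j, |B i j| ≤ D * w i) ∧ (∀ i j, |B i j| ≤ D * w j) ∧
        ∏ i, w i ≤ D * Real.exp (-(∑ i, c i) * q) ∧ Real.exp (-(∑ i, c i) * q) ≤ D * ∏ i, w i ∧
        (∀ j, Real.exp (-(∑ i, |c i|) * q) ≤ D * w j) ∧
        ∀ y : Fin n → ℤ, (∀ i, |∑ k, L i k * (U *ᵥ y) k| ≤ Real.exp (c i * q)) →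
          ∀ j, y j ≠ 0 → w j ≤ D := by
  obtain ⟨C, hC, hred⟩ := exists_reduced_basis n
  obtain ⟨γ, hγ, hlow⟩ := exists_pos_le_norm_evalInt hdet
  have hd : 0 < |L.det| := abs_pos.mpr hdet
  have hC0 : 0 < C := by linarith
  obtain ⟨D, hD⟩ : ∃ D : ℝ, D = C + C * |L.det| + n.factorial * C ^ n / |L.det| + C / γ +
    n.factorial * C ^ (n + 1) := ⟨_, rfl⟩
  have p1 : 0 < C * |L.det| := by positivity
  have p2 : 0 < n.factorial * C ^ n / |L.det| := by positivity
  have p3 : 0 < C / γ := by positivity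
  have p4 : 0 < n.factorial * C ^ (n + 1) := by positivity
  refine ⟨D, by linarith, fun q hq => ?_⟩
  obtain ⟨A, hA⟩ : ∃ A, A = Matrix.diagonal (fun i => Real.exp (-(c i * q))) * L := ⟨_, rfl⟩
  have hAdet : A.det = Real.exp (-(∑ i, c i) * q) * L.det := by
    rw [hA, Matrix.det_mul, Matrix.det_diagonal, ← Real.exp_sum, Finset.sum_neg_distrib,
      ← Finset.sum_mul, neg_mul]
  have hA0 : A.det ≠ 0 := by rw [hAdet]; exact mul_ne_zero (Real.exp_pos _).ne' hdet
  obtain ⟨U, π, w, hU, hw, hrow, hcol, hprod⟩ := hred A hA0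
  obtain ⟨B, hB⟩ : ∃ B, B = (A * U.map (Int.castRingHom ℝ)).submatrix π id := ⟨_, rfl⟩
  have hBrow : ∀ i j, |B i j| ≤ C * w i := fun i j => by rw [hB]; exact hrow i j
  have hBcol : ∀ i j, |B i j| ≤ C * w j := fun i j => by rw [hB]; exact hcol i j
  have hBdet : |B.det| = |A.det| := by
    rw [hB, Matrix.det_permute, abs_mul, Matrix.det_mul, abs_mul, abs_det_map_of_isUnit hU]
    rcases Int.units_eq_one_or (Equiv.Perm.sign π) with h | h <;> simp [h]
  have hA' : |A.det| = Real.exp (-(∑ i, c i) * q) * |L.det| := by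
    rw [hAdet, abs_mul, abs_of_pos (Real.exp_pos _)]
  have hBentry : ∀ i j, B i j = Real.exp (-(c (π i) * q)) *
      (L * U.map (Int.castRingHom ℝ)) (π i) j := by
    intro i j
    rw [hB, hA, Matrix.mul_assoc, Matrix.submatrix_apply, Matrix.diagonal_mul]; rfl
  refine ⟨U, π, w, B, hU, hw, ?_, ?_, ?_, ?_, ?_, ?_, ?_⟩
  · ext i j
    rw [Matrix.diagonal_mul, hBentry, ← mul_assoc, ← Real.exp_add, add_neg_cancel, Real.exp_zero,
      one_mul]
    rfl
  · exact fun i j => (hBrow i j).trans (mul_le_mul_of_nonneg_right (by linarith) (hw i).le)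
  · exact fun i j => (hBcol i j).trans (mul_le_mul_of_nonneg_right (by linarith) (hw j).le)
  · calc ∏ i, w i ≤ C * |A.det| := hprod
      _ = (C * |L.det|) * Real.exp (-(∑ i, c i) * q) := by rw [hA']; ring
      _ ≤ _ := mul_le_mul_of_nonneg_right (by linarith) (Real.exp_pos _).le
  · have h1 := abs_det_le_of_row B _ hBrow
    rw [hBdet, hA', Finset.prod_mul_distrib, Finset.prod_const, Finset.card_univ, Fintype.card_fin,
      ← le_div_iff₀ hd] at h1
    calc _ ≤ _ := h1
      _ = (n.factorial * C ^ n / |L.det|) * ∏ i, w i := by ring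
      _ ≤ _ := mul_le_mul_of_nonneg_right (by linarith) (Finset.prod_nonneg fun i _ => (hw i).le)
  · intro j
    have hne : (fun i => U i j) ≠ 0 := by
      intro h
      exact hU.ne_zero (Matrix.det_eq_zero_of_column_eq_zero j fun i => congrFun h i)
    have h1 := hlow _ hne
    obtain ⟨i, hi⟩ : ∃ i, γ ≤ |(L * U.map (Int.castRingHom ℝ)) i j| := by
      by_contra! hcon
      have : ‖evalInt L fun i => U i j‖ < γ := by
        rw [pi_norm_lt_iff hγ]
        intro i
        rw [Real.norm_eq_abs]
        exact hcon i
      linarith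
    have h2 := hBcol (π.symm i) j
    rw [hBentry, Equiv.apply_symm_apply, abs_mul, abs_of_pos (Real.exp_pos _)] at h2
    have h3 : Real.exp (-(∑ i, |c i|) * q) ≤ Real.exp (-(c i * q)) := by
      apply Real.exp_le_exp.mpr
      have : c i ≤ ∑ i, |c i| := (le_abs_self _).trans
        (Finset.single_le_sum (f := fun i => |c i|) (fun i _ => abs_nonneg _) (Finset.mem_univ i))
      nlinarith
    have h4 : Real.exp (-(∑ i, |c i|) * q) * γ ≤ C * w j :=
      (mul_le_mul h3 hi hγ.le (Real.exp_pos _).le).trans h2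
    rw [← le_div_iff₀ hγ] at h4
    calc _ ≤ _ := h4
      _ = C / γ * w j := by ring
      _ ≤ _ := mul_le_mul_of_nonneg_right (by linarith) (hw j).le
  · intro y hy j hj
    have h1 := abs_coordinate_mul_le hC hw hBcol
      (by rw [← abs_pos, hBdet]; exact abs_pos.mpr hA0) (by rw [hBdet]; exact hprod)
      (y := fun i => (y i : ℝ)) (fun i => by
        have h2 : (B *ᵥ fun i => (y i : ℝ)) i = Real.exp (-(c (π i) * q)) *
            ∑ k, L (π i) k * (U *ᵥ y) k := by
          simp only [Matrix.mulVec, dotProduct, hBentry, Matrix.mul_apply, Finset.mul_sum,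
            Finset.sum_mul, Matrix.map_apply, Int.cast_sum, Int.cast_mul, Int.coe_castRingHom]
          rw [Finset.sum_comm]
          refine Finset.sum_congr rfl fun k _ => Finset.sum_congr rfl fun l _ => by ring
        rw [h2, abs_mul, abs_of_pos (Real.exp_pos _)]
        refine (mul_le_mul_of_nonneg_left (hy (π i)) (Real.exp_pos _).le).trans (le_of_eq ?_)
        rw [← Real.exp_add, neg_add_cancel, Real.exp_zero]) j
    have h3 : (1 : ℝ) ≤ |(y j : ℝ)| := by exact_mod_cast Int.one_le_abs hj
    have : 1 * w j ≤ |(y j : ℝ)| * w j := mul_le_mul_of_nonneg_right h3 (hw j).le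
    linarith

lemma card_powersetCard_le (n p : ℕ) : Fintype.card (Set.powersetCard (Fin n) p) ≤ 2 ^ n := by
  rw [← Nat.card_eq_fintype_card, Set.powersetCard.card, Nat.card_eq_fintype_card, Fintype.card_fin]
  exact Nat.choose_le_two_pow _ _

/-- The parametric subspace theorem. -/
theorem exists_parametric {n : ℕ} (L : Matrix (Fin n) (Fin n) ℝ)
    (hL : ∀ i j, IsAlgebraic ℚ (L i j)) (hdet : L.det ≠ 0) (c : Fin n → ℝ) (hc : ∑ i, c i < 0) :
    ∃ (q₁ : ℝ) (T : Finset (Submodule ℚ (Fin n → ℚ))), (∀ W ∈ T, W ≠ ⊤) ∧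
      ∀ q, q₁ ≤ q → ∀ x : Fin n → ℤ, (∀ i, |∑ k, L i k * x k| ≤ Real.exp (c i * q)) →
        ∃ W ∈ T, (fun i => (x i : ℚ)) ∈ W := by
  classical
  have hn : 0 < n := by
    rcases Nat.eq_zero_or_pos n with rfl | h
    · simp at hc
    · exact h
  obtain ⟨D, hD, hbasis⟩ := exists_adapted_basis L hdet c
  obtain ⟨s, hs⟩ : ∃ s : ℝ, s = -∑ i, c i := ⟨_, rfl⟩
  obtain ⟨K, hK⟩ : ∃ K : ℝ, K = ∑ i, |c i| := ⟨_, rfl⟩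
  have hK0 : 0 ≤ K := by rw [hK]; exact Finset.sum_nonneg fun i _ => abs_nonneg _
  have hs0 : 0 < s := by linarith
  obtain ⟨δ, hδ⟩ : ∃ δ : ℝ, δ = s / (2 * (n + 1) ^ 2) := ⟨_, rfl⟩
  obtain ⟨η, hη⟩ : ∃ η : ℝ, η = δ / (2 ^ n * (n + 3)) := ⟨_, rfl⟩
  have hδ0 : 0 < δ := by rw [hδ]; positivity
  have hη0 : 0 < η := by rw [hη]; positivity
  have hδs : 2 * (n + 1) ^ 2 * δ = s := by rw [hδ]; field_simp
  have hηδ : 2 ^ n * (n + 3) * η = δ := by rw [hη]; field_simp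
  obtain ⟨N, hN⟩ : ∃ N : ℕ, (s + η + n * (K + η)) / η + 1 ≤ N := exists_nat_ge _
  have hex : ∀ τ : Equiv.Perm (Fin n) × Finset (Fin n) × (Fin n → Finset.Icc (-(N : ℤ)) N),
      ∃ (q₁ : ℝ) (T : Finset (Submodule ℚ (Fin n → ℚ))), (∀ W ∈ T, W ≠ ⊤) ∧ (τ.2.1.Nonempty →
      ∑ I : Set.powersetCard (Fin n) τ.2.1.card,
        (∑ i ∈ I.1, (c (τ.1 i) + η * ((τ.2.2 i : ℤ) : ℝ)) + η) < δ →
      ∀ q, q₁ ≤ q → ∀ (U : Matrix (Fin n) (Fin n) ℤ) (B : Matrix (Fin n) (Fin n) ℝ) (w : Fin n → ℝ),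
        IsUnit U.det → (∀ i, 0 < w i) → (∀ i, w i ≤ Real.exp (η * ((τ.2.2 i : ℤ) : ℝ) * q)) →
        (∀ J : Finset (Fin n), J.card = τ.2.1.card → J ≠ τ.2.1 →
          ∏ i ∈ J, w i ≤ Real.exp (-δ * q) * ∏ i ∈ τ.2.1, w i) →
        L.submatrix τ.1 id * U.map (Int.castRingHom ℝ) =
          Matrix.diagonal (fun i => Real.exp (c (τ.1 i) * q)) * B →
        (∀ i j, |B i j| ≤ D * w i) → (∀ i j, |B i j| ≤ D * w j) →
        ∀ y : Fin n → ℤ, (∀ i ∈ τ.2.1, y i = 0) →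
          ∃ W ∈ T, (fun i => ((U *ᵥ y) i : ℚ)) ∈ W) := by
    intro τ
    by_cases h : τ.2.1.Nonempty ∧ ∑ I : Set.powersetCard (Fin n) τ.2.1.card,
        (∑ i ∈ I.1, (c (τ.1 i) + η * ((τ.2.2 i : ℤ) : ℝ)) + η) < δ
    · have hdet' : (L.submatrix τ.1 id).det ≠ 0 := by
        rw [Matrix.det_permute]
        refine mul_ne_zero ?_ hdet
        rcases Int.units_eq_one_or (Equiv.Perm.sign τ.1) with h | h <;> simp [h]
      obtain ⟨q₁, T, hT, hq⟩ := exists_subspaces_of_gap (L.submatrix τ.1 id) (fun _ _ => hL _ _)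
        hdet' (fun i => c (τ.1 i)) (fun i => η * ((τ.2.2 i : ℤ) : ℝ)) hD hη0 h.1 h.2
      exact ⟨q₁, T, hT, fun _ _ => hq⟩
    · exact ⟨0, ∅, by simp, fun h1 h2 => absurd ⟨h1, h2⟩ h⟩
  choose Q T hT hQ using hex
  refine ⟨max (max 1 (Real.log D / η)) (∑ τ, |Q τ|), insert ⊥ (univ.biUnion T), ?_, ?_⟩
  · intro W hW
    rcases Finset.mem_insert.mp hW with rfl | hW
    · have : Nonempty (Fin n) := ⟨⟨0, hn⟩⟩
      exact bot_ne_top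
    · obtain ⟨τ, _, hτ⟩ := Finset.mem_biUnion.mp hW
      exact hT τ W hτ
  intro q hq x hx
  have hq1 : 1 ≤ q := (le_max_left _ _).trans ((le_max_left _ _).trans hq)
  have hq0 : 0 < q := by linarith
  have hDq : D ≤ Real.exp (η * q) := by
    rw [← Real.log_le_iff_le_exp (by linarith), mul_comm, ← div_le_iff₀ hη0]
    exact (le_max_right _ _).trans ((le_max_left _ _).trans hq)
  have hQq : ∀ τ, Q τ ≤ q := fun τ => (le_abs_self _).trans
    ((Finset.single_le_sum (f := fun τ => |Q τ|) (fun _ _ => abs_nonneg _)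
      (Finset.mem_univ τ)).trans ((le_max_right _ _).trans hq))
  rcases eq_or_ne x 0 with rfl | hx0
  · refine ⟨⊥, Finset.mem_insert_self _ _, ?_⟩
    rw [Submodule.mem_bot]; ext i; simp
  obtain ⟨U, π, w, B, hU, hw, hLU, hrow, hcol, hup, hlo, hmin, hcoord⟩ := hbasis q hq0.le
  obtain ⟨y, rfl⟩ : ∃ y : Fin n → ℤ, U *ᵥ y = x := ⟨U⁻¹ *ᵥ x, by
    rw [Matrix.mulVec_mulVec, Matrix.mul_nonsing_inv _ hU, Matrix.one_mulVec]⟩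
  obtain ⟨μ, hμ⟩ : ∃ μ : Fin n → ℝ, ∀ i, w i = Real.exp (μ i * q) :=
    ⟨fun i => Real.log (w i) / q, fun i => by
      rw [div_mul_cancel₀ _ hq0.ne', Real.exp_log (hw i)]⟩
  have hprodμ : ∀ J : Finset (Fin n), ∏ i ∈ J, w i = Real.exp ((∑ i ∈ J, μ i) * q) := by
    intro J
    rw [Finset.sum_mul, Real.exp_sum]
    exact Finset.prod_congr rfl fun i _ => hμ i
  have hexp : ∀ a b : ℝ, Real.exp (a * q) ≤ D * Real.exp (b * q) → a ≤ η + b := by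
    intro a b h
    have h1 : Real.exp (a * q) ≤ Real.exp ((η + b) * q) := by
      rw [add_mul, Real.exp_add]
      exact h.trans (mul_le_mul_of_nonneg_right hDq (Real.exp_pos _).le)
    exact le_of_mul_le_mul_right (Real.exp_le_exp.mp h1) hq0
  rw [← hs, hprodμ] at hup hlo
  have hsum_le := hexp _ _ hup
  have hle_sum := hexp _ _ hlo
  have hμlo : ∀ j, -K ≤ η + μ j := fun j => hexp _ _ (by rw [← hμ, hK]; exact hmin j)
  have hμy : ∀ j, y j ≠ 0 → μ j ≤ η := fun j hj => by
    have := hexp (μ j) 0 (by rw [← hμ, zero_mul, Real.exp_zero, mul_one]; exact hcoord y hx j hj)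
    linarith
  have hμup : ∀ j, μ j ≤ s + η + n * (K + η) := by
    intro j
    have h1 : ∑ i, (μ i + (K + η)) ≤ η + s + n * (K + η) := by
      rw [Finset.sum_add_distrib]; simp; linarith
    have h2 := Finset.single_le_sum (f := fun i => μ i + (K + η))
      (fun i _ => by have := hμlo i; linarith) (Finset.mem_univ j)
    linarith
  obtain ⟨t, ht1, ht2, ht⟩ := exists_gap μ η hδ0
  obtain ⟨I₀, hI₀⟩ : ∃ I₀ : Finset (Fin n), I₀ = univ.filter fun j => t + δ < μ j := ⟨_, rfl⟩
  have hn1 : (1 : ℝ) ≤ n := by exact_mod_cast hn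
  have h2n : (1 : ℝ) ≤ 2 ^ n := one_le_pow₀ (by norm_num)
  have hne : I₀.Nonempty := by
    by_contra hcon
    rw [Finset.not_nonempty_iff_eq_empty] at hcon
    have hall : ∀ j, μ j ≤ t := by
      intro j
      rcases ht j with h | h
      · exact h
      · have : j ∈ I₀ := by rw [hI₀]; simp [h]
        simp [hcon] at this
    have h1 : ∑ i, μ i ≤ n * t := by
      have := Finset.sum_le_card_nsmul univ μ t fun j _ => hall j
      simpa using this
    have h3 : (n + 3) * η ≤ δ := by
      rw [← hηδ]; nlinarith [mul_nonneg (by linarith : (0:ℝ) ≤ n + 3) hη0.le]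
    nlinarith
  obtain ⟨ℓ, hℓ⟩ : ∃ ℓ : Fin n → ℤ, ∀ j, ℓ j = ⌈μ j / η⌉ := ⟨_, fun _ => rfl⟩
  have hℓ1 : ∀ j, μ j ≤ η * ℓ j := by
    intro j
    have := Int.le_ceil (μ j / η)
    rw [← hℓ, div_le_iff₀ hη0] at this
    linarith
  have hℓ2 : ∀ j, η * ℓ j ≤ μ j + η := by
    intro j
    have := (Int.ceil_lt_add_one (μ j / η)).le
    rw [← hℓ, ← sub_le_iff_le_add, le_div_iff₀ hη0] at this
    linarith
  rw [div_add_one hη0.ne', div_le_iff₀ hη0] at hN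
  have hℓmem : ∀ j, ℓ j ∈ Finset.Icc (-(N : ℤ)) N := by
    intro j
    rw [Finset.mem_Icc]
    have h1 : (ℓ j : ℝ) * η ≤ N * η := by linarith [hℓ2 j, hμup j]
    have h2 : (-(N : ℝ)) * η ≤ ℓ j * η := by
      have := hℓ1 j
      have := hμlo j
      nlinarith
    constructor
    · exact_mod_cast le_of_mul_le_mul_right h2 hη0
    · exact_mod_cast le_of_mul_le_mul_right h1 hη0
  have hneg : ∑ I : Set.powersetCard (Fin n) I₀.card,
      (∑ i ∈ I.1, (c (π i) + η * (ℓ i : ℝ)) + η) < δ := by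
    obtain ⟨b, hb, hbsum⟩ := exists_sum_powersetCard n I₀.card
    have hcard := card_powersetCard_le n I₀.card
    rw [Finset.sum_add_distrib, hbsum, Finset.sum_add_distrib, Equiv.sum_comp π c, Finset.sum_const,
      Finset.card_univ, nsmul_eq_mul]
    have h1 : ∑ i, η * (ℓ i : ℝ) ≤ s + η + n * η := by
      calc ∑ i, η * (ℓ i : ℝ) ≤ ∑ i, (μ i + η) := Finset.sum_le_sum fun i _ => hℓ2 i
        _ ≤ _ := by rw [Finset.sum_add_distrib]; simp; linarith
    have hb' : (b : ℝ) ≤ 2 ^ n := by exact_mod_cast hb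
    have hcard' : (Fintype.card (Set.powersetCard (Fin n) I₀.card) : ℝ) ≤ 2 ^ n := by
      exact_mod_cast hcard
    have h2 : (b : ℝ) * (∑ i, c i + ∑ i, η * (ℓ i : ℝ)) ≤ 2 ^ n * ((n + 1) * η) := by
      refine (mul_le_mul_of_nonneg_left (?_ : _ ≤ (n + 1) * η) (Nat.cast_nonneg b)).trans
        (mul_le_mul_of_nonneg_right hb' (by positivity))
      linarith
    have h3 := mul_le_mul_of_nonneg_right hcard' hη0.le
    rw [← hηδ]
    nlinarith
  obtain ⟨W, hW, hmem⟩ := hQ ⟨π, I₀, fun j => ⟨ℓ j, hℓmem j⟩⟩ hne hneg q (hQq _) U B w hU hw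
    (fun i => by
      rw [hμ]
      exact Real.exp_le_exp.mpr (mul_le_mul_of_nonneg_right (hℓ1 i) hq0.le))
    (fun J hJ hJne => by
      rw [hprodμ, hprodμ, ← Real.exp_add]
      apply Real.exp_le_exp.mpr
      have := sum_add_le_of_gap μ hδ0 (t := t) (fun j hj => by
        rw [hI₀] at hj; exact (Finset.mem_filter.mp hj).2.le) (fun j hj => by
        rcases ht j with h | h
        · exact h
        · exact absurd (by rw [hI₀]; simp [h]) hj) hJ hJne
      dsimp only
      nlinarith) hLU hrow hcol y (fun i hi => by
      by_contra hy
      have h1 := hμy i hy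
      dsimp only at hi
      rw [hI₀] at hi
      have h2 := (Finset.mem_filter.mp hi).2
      linarith)
  exact ⟨W, Finset.mem_insert_of_mem (Finset.mem_biUnion.mpr ⟨_, Finset.mem_univ _, hW⟩), hmem⟩

end SubspaceThm

namespace SubspaceThm

open Finset Matrix

lemma span_singleton_ne_top {n : ℕ} (hn : 2 ≤ n) (v : Fin n → ℚ) : Submodule.span ℚ {v} ≠ ⊤ := by
  intro h
  have h1 := finrank_span_le_card (R := ℚ) ({v} : Set (Fin n → ℚ))
  rw [h, finrank_top, Module.finrank_fin_fun] at h1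
  simp at h1
  omega

/-- Discretisation of the sizes of the values of linear forms. -/
lemma exists_discretised_exponent {a q η : ℝ} {N : ℕ} (hq : 0 < q) (hη : 0 < η)
    (hup : a ≤ Real.exp ((1 + η) * q)) (hN : 1 + 2 * η ≤ η * N) :
    ∃ k : ℤ, k ∈ Finset.Icc (-(N : ℤ)) N ∧ a ≤ Real.exp (η * k * q) ∧ η * k ≤ 1 + 2 * η ∧
      (k = -(N : ℤ) ∨ 0 < a ∧ η * k * q ≤ Real.log a + η * q) := by
  by_cases h : a ≤ Real.exp (η * ((-(N : ℤ) : ℤ) : ℝ) * q)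
  · refine ⟨-(N : ℤ), by simp, h, ?_, Or.inl rfl⟩
    push_cast
    nlinarith
  push Not at h
  have ha0 : 0 < a := (Real.exp_pos _).trans h
  obtain ⟨k, hk⟩ : ∃ k : ℤ, k = ⌈Real.log a / (η * q)⌉ := ⟨_, rfl⟩
  have hηq : 0 < η * q := by positivity
  have h1 := Int.le_ceil (Real.log a / (η * q))
  have h2 := (Int.ceil_lt_add_one (Real.log a / (η * q))).le
  rw [← hk, div_le_iff₀ hηq] at h1
  rw [← hk, ← sub_le_iff_le_add, le_div_iff₀ hηq] at h2
  have h3 : Real.log a ≤ (1 + η) * q := (Real.log_le_iff_le_exp ha0).mpr hup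
  have h4 : η * k ≤ 1 + 2 * η := by
    refine le_of_mul_le_mul_right ?_ hq
    linarith
  have h5 : η * ((-(N : ℤ) : ℤ) : ℝ) * q ≤ Real.log a := ((Real.lt_log_iff_exp_lt ha0).mpr h).le
  refine ⟨k, ?_, ?_, h4, Or.inr ⟨ha0, by linarith⟩⟩
  · rw [Finset.mem_Icc]
    constructor
    · have : ((-(N : ℤ) : ℤ) : ℝ) * (η * q) ≤ k * (η * q) := by linarith
      exact_mod_cast le_of_mul_le_mul_right this hηq
    · have : (k : ℝ) * η ≤ N * η := by linarith
      exact_mod_cast le_of_mul_le_mul_right this hη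
  · rw [← Real.log_le_iff_le_exp ha0]
    linarith

/-- The subspace theorem for real linear forms. -/
theorem exists_subspaces_real {n : ℕ} (hn : 2 ≤ n) (L : Matrix (Fin n) (Fin n) ℝ)
    (hL : ∀ i j, IsAlgebraic ℚ (L i j)) (hdet : L.det ≠ 0) {ε : ℝ} (hε : 0 < ε) :
    ∃ T : Finset (Submodule ℚ (Fin n → ℚ)), (∀ W ∈ T, W ≠ ⊤) ∧
      ∀ x : Fin n → ℤ, ∏ i, |∑ j, L i j * x j| ≤
        (((Finset.univ.sup fun j => (x j).natAbs) : ℕ) : ℝ) ^ (-ε) →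
        ∃ W ∈ T, (fun j => (x j : ℚ)) ∈ W := by
  classical
  have hn0 : (0 : ℝ) < n := by positivity
  obtain ⟨η, hη⟩ : ∃ η : ℝ, η = ε / (2 * n) := ⟨_, rfl⟩
  have hη0 : 0 < η := by rw [hη]; positivity
  have hηε : 2 * n * η = ε := by rw [hη]; field_simp
  obtain ⟨N, hN⟩ : ∃ N : ℕ, (n * (1 + 2 * η) + 1) / η ≤ N := exists_nat_ge _
  rw [div_le_iff₀ hη0] at hN
  have hn1 : (1 : ℝ) ≤ n := by exact_mod_cast (by omega : 1 ≤ n)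
  have hex : ∀ k : Fin n → Finset.Icc (-(N : ℤ)) N,
      ∃ (q₁ : ℝ) (T : Finset (Submodule ℚ (Fin n → ℚ))), (∀ W ∈ T, W ≠ ⊤) ∧
      (∑ i, η * ((k i : ℤ) : ℝ) < 0 →
      ∀ q, q₁ ≤ q → ∀ x : Fin n → ℤ,
        (∀ i, |∑ j, L i j * x j| ≤ Real.exp (η * ((k i : ℤ) : ℝ) * q)) →
        ∃ W ∈ T, (fun i => (x i : ℚ)) ∈ W) := by
    intro k
    by_cases h : ∑ i, η * ((k i : ℤ) : ℝ) < 0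
    · obtain ⟨q₁, T, hT, hq⟩ := exists_parametric L hL hdet _ h
      exact ⟨q₁, T, hT, fun _ => hq⟩
    · exact ⟨0, ∅, by simp, fun h1 => absurd h1 h⟩
  choose Q T hT hQ using hex
  obtain ⟨C, hC⟩ : ∃ C : ℝ, C = 1 + ∑ i, ∑ j, |L i j| := ⟨_, rfl⟩
  have hC1 : 1 ≤ C := by
    rw [hC]
    have := Finset.sum_nonneg fun i (_ : i ∈ univ) =>
      Finset.sum_nonneg fun j (_ : j ∈ (univ : Finset (Fin n))) => abs_nonneg (L i j)
    linarith
  obtain ⟨q₀, hq₀⟩ : ∃ q₀ : ℝ, q₀ = max (max 1 (Real.log C / η)) (∑ k, |Q k|) := ⟨_, rfl⟩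
  obtain ⟨X, hX⟩ : ∃ X : ℕ, Real.exp q₀ ≤ X := exists_nat_ge _
  refine ⟨(Fintype.piFinset fun _ : Fin n => Finset.Icc (-(X : ℤ)) X).image
    (fun x => Submodule.span ℚ {fun j => (x j : ℚ)}) ∪ univ.biUnion T, ?_, ?_⟩
  · intro W hW
    rcases Finset.mem_union.mp hW with hW | hW
    · obtain ⟨x, _, rfl⟩ := Finset.mem_image.mp hW
      exact span_singleton_ne_top hn _
    · obtain ⟨k, _, hk⟩ := Finset.mem_biUnion.mp hW
      exact hT k W hk
  intro x hx
  obtain ⟨Y, hY⟩ : ∃ Y : ℕ, Y = univ.sup fun j => (x j).natAbs := ⟨_, rfl⟩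
  rw [← hY] at hx
  have hxY : ∀ j, (x j).natAbs ≤ Y := fun j => by
    rw [hY]; exact Finset.le_sup (f := fun j => (x j).natAbs) (Finset.mem_univ j)
  rcases le_or_gt Y X with hYX | hYX
  · refine ⟨_, Finset.mem_union_left _ (Finset.mem_image_of_mem _ (Fintype.mem_piFinset.mpr
      fun j => ?_)), Submodule.mem_span_singleton_self _⟩
    rw [Finset.mem_Icc]
    have := hxY j
    omega
  have hY0 : (0 : ℝ) < Y := by exact_mod_cast (Nat.zero_le X).trans_lt hYX
  obtain ⟨q, hq⟩ : ∃ q : ℝ, q = Real.log Y := ⟨_, rfl⟩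
  have hqY : Real.exp q = Y := by rw [hq, Real.exp_log hY0]
  have hq₀q : q₀ ≤ q := by
    rw [hq, Real.le_log_iff_exp_le hY0]
    exact hX.trans (by exact_mod_cast hYX.le)
  rw [hq₀] at hq₀q
  have hq1 : 1 ≤ q := (le_max_left _ _).trans ((le_max_left _ _).trans hq₀q)
  have hq0 : 0 < q := by linarith
  have hCq : C ≤ Real.exp (η * q) := by
    rw [← Real.log_le_iff_le_exp (by linarith), mul_comm, ← div_le_iff₀ hη0]
    exact (le_max_right _ _).trans ((le_max_left _ _).trans hq₀q)
  have hQq : ∀ k, Q k ≤ q := fun k => (le_abs_self _).trans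
    ((Finset.single_le_sum (f := fun k => |Q k|) (fun _ _ => abs_nonneg _)
      (Finset.mem_univ k)).trans ((le_max_right _ _).trans hq₀q))
  have hup : ∀ i, |∑ j, L i j * x j| ≤ Real.exp ((1 + η) * q) := by
    intro i
    calc |∑ j, L i j * x j| ≤ ∑ j, |L i j * x j| := Finset.abs_sum_le_sum_abs _ _
      _ ≤ ∑ j, |L i j| * Y := by
          refine Finset.sum_le_sum fun j _ => ?_
          rw [abs_mul]
          refine mul_le_mul_of_nonneg_left ?_ (abs_nonneg _)
          rw [← Int.cast_abs, Int.abs_eq_natAbs]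
          exact_mod_cast hxY j
      _ = (∑ j, |L i j|) * Y := by rw [Finset.sum_mul]
      _ ≤ C * Y := by
          refine mul_le_mul_of_nonneg_right ?_ hY0.le
          rw [hC]
          have := Finset.single_le_sum (f := fun i => ∑ j, |L i j|)
            (fun i _ => Finset.sum_nonneg fun j _ => abs_nonneg _) (Finset.mem_univ i)
          linarith
      _ ≤ Real.exp (η * q) * Real.exp q := by rw [hqY]; gcongr
      _ = _ := by rw [← Real.exp_add]; congr 1; ring
  have hN' : 1 + 2 * η ≤ η * N := by nlinarith
  choose k hk1 hk2 hk3 hk4 using fun i =>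
    exists_discretised_exponent hq0 hη0 (hup i) hN'
  have hneg : ∑ i, η * (k i : ℝ) < 0 := by
    by_cases hcase : ∃ i, k i = -(N : ℤ)
    · obtain ⟨i, hi⟩ := hcase
      rw [← Finset.add_sum_erase univ _ (Finset.mem_univ i), hi]
      have h1 := Finset.sum_le_card_nsmul (univ.erase i) (fun i => η * (k i : ℝ)) _
        fun j _ => hk3 j
      rw [Finset.card_erase_of_mem (Finset.mem_univ i), Finset.card_univ, Fintype.card_fin,
        nsmul_eq_mul, Nat.cast_sub (by omega)] at h1
      push_cast at h1 ⊢
      nlinarith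
    · push Not at hcase
      have h1 : ∀ i, 0 < |∑ j, L i j * x j| ∧
          η * k i * q ≤ Real.log |∑ j, L i j * x j| + η * q := fun i =>
        (hk4 i).resolve_left (hcase i)
      have h2 : Real.log (∏ i, |∑ j, L i j * x j|) ≤ -ε * q := by
        rw [Real.log_le_iff_le_exp (Finset.prod_pos fun i _ => (h1 i).1)]
        rw [Real.rpow_def_of_pos hY0, ← hq] at hx
        rwa [mul_comm] at hx
      rw [Real.log_prod fun i _ => (h1 i).1.ne'] at h2
      have h3 : (∑ i, η * (k i : ℝ)) * q ≤ -ε * q + n * (η * q) := by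
        rw [Finset.sum_mul]
        refine (Finset.sum_le_sum fun i _ => (h1 i).2).trans ?_
        rw [Finset.sum_add_distrib]
        simp only [Finset.sum_const, Finset.card_univ, Fintype.card_fin, nsmul_eq_mul]
        linarith
      have h4 : -ε * q + n * (η * q) < 0 := by
        rw [← hηε]
        have : 0 < n * η * q := by positivity
        nlinarith
      by_contra hcon
      push Not at hcon
      nlinarith [mul_nonneg hcon hq0.le]
  obtain ⟨W, hW, hmem⟩ := hQ (fun i => ⟨k i, hk1 i⟩) hneg q (hQq _) x hk2
  exact ⟨W, Finset.mem_union_right _ (Finset.mem_biUnion.mpr ⟨_, Finset.mem_univ _, hW⟩), hmem⟩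

lemma isAlgebraic_re {z : ℂ} (hz : IsAlgebraic ℚ z) : IsAlgebraic ℚ z.re := by
  have h1 : IsAlgebraic ℚ (starRingEnd ℂ z) :=
    hz.algHom ((Complex.conjAe.restrictScalars ℚ : ℂ ≃ₐ[ℚ] ℂ) : ℂ →ₐ[ℚ] ℂ)
  have h2 : IsAlgebraic ℚ ((z.re : ℝ) : ℂ) := by
    rw [Complex.re_eq_add_conj]
    exact (hz.add h1).mul (isAlgebraic_algebraMap (2 : ℚ)).inv
  exact (isAlgebraic_algebraMap_iff (FaithfulSMul.algebraMap_injective ℝ ℂ)).mp h2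

lemma isAlgebraic_im {z : ℂ} (hz : IsAlgebraic ℚ z) : IsAlgebraic ℚ z.im := by
  have hI : IsAlgebraic ℚ Complex.I :=
    ⟨Polynomial.X ^ 2 + 1, by
      intro h
      have := congrArg (Polynomial.eval 0) h
      simp at this, by simp⟩
  have : z.im = -(Complex.I * z).re := by simp
  rw [this]
  exact (isAlgebraic_re (hI.mul hz)).neg

/-- A nonsingular complex matrix remains nonsingular after replacing every row by its real or its
imaginary part, suitably chosen. -/
lemma exists_re_or_im_det_ne_zero {n : ℕ} {A : Matrix (Fin n) (Fin n) ℂ} (hA : A.det ≠ 0) :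
    ∃ S : Finset (Fin n),
      (Matrix.of fun i j => if i ∈ S then (A i j).re else (A i j).im).det ≠ 0 := by
  classical
  have h := (Matrix.detRowAlternating (n := Fin n) (R := ℂ)).toMultilinearMap.map_add_univ
    (fun i j => ((A i j).re : ℂ)) (fun i j => Complex.I * ((A i j).im : ℂ))
  by_contra! hcon
  apply hA
  have h0 : A = fun i j => ((A i j).re : ℂ) + Complex.I * ((A i j).im : ℂ) := by
    ext i j
    rw [mul_comm, Complex.re_add_im]
  rw [h0]
  refine h.trans (Finset.sum_eq_zero fun S _ => ?_)
  have h1 : S.piecewise (fun i j => ((A i j).re : ℂ)) (fun i j => Complex.I * ((A i j).im : ℂ)) =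
      Matrix.of fun i j => (if i ∈ S then 1 else Complex.I) *
        (Matrix.of fun i j => if i ∈ S then (A i j).re else (A i j).im).map Complex.ofRealHom i j := by
    ext i j
    by_cases hi : i ∈ S <;> simp [hi]
  rw [h1]
  change Matrix.det _ = 0
  rw [Matrix.det_mul_column, ← RingHom.mapMatrix_apply, ← RingHom.map_det, hcon S, map_zero,
    mul_zero]

end SubspaceThm

/-- **Schmidt's Subspace Theorem (simplified form).** Let `L₁, …, L_m` be linearly
independent linear forms in `m ≥ 2` variables with algebraic coefficients
(`L i x = ∑ j, c i j * x j`), and let `ε > 0`. Then the set of integer points `x`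
with `|L₁(x) ⋯ L_m(x)| ≤ |x|^{-ε}` (where `|x| = max |x_i|`) is contained in
finitely many proper subspaces of `ℚ^m`. -/
theorem schmidt_subspace_theorem
    (m : ℕ) (hm : 2 ≤ m)
    (c : Fin m → Fin m → ℂ)
    (halg : ∀ i j, IsAlgebraic ℚ (c i j))
    (hind : LinearIndependent ℂ c)
    (ε : ℝ) (hε : 0 < ε) :
    ∃ T : Finset (Submodule ℚ (Fin m → ℚ)),
      (∀ W ∈ T, W ≠ ⊤) ∧
      ∀ x : Fin m → ℤ,
        ‖∏ i, ∑ j, c i j * (x j : ℂ)‖ ≤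
          (((Finset.univ.sup fun j => (x j).natAbs) : ℕ) : ℝ) ^ (-ε) →
        ∃ W ∈ T, (fun j => (x j : ℚ)) ∈ W := by
  have hdet : (Matrix.of c).det ≠ 0 := by
    have h1 : IsUnit (Matrix.of c) := Matrix.linearIndependent_rows_iff_isUnit.mp hind
    exact ((Matrix.isUnit_iff_isUnit_det _).mp h1).ne_zero
  obtain ⟨S, hS⟩ := SubspaceThm.exists_re_or_im_det_ne_zero hdet
  obtain ⟨T, hT, h⟩ := SubspaceThm.exists_subspaces_real hm _ (fun i j => by
    rw [Matrix.of_apply]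
    split_ifs
    · exact SubspaceThm.isAlgebraic_re (halg i j)
    · exact SubspaceThm.isAlgebraic_im (halg i j)) hS hε
  refine ⟨T, hT, fun x hx => h x (le_trans ?_ hx)⟩
  rw [norm_prod]
  refine Finset.prod_le_prod (fun i _ => abs_nonneg _) fun i _ => ?_
  by_cases hi : i ∈ S
  · refine le_trans (le_of_eq ?_) (Complex.abs_re_le_norm _)
    simp [hi]
  · refine le_trans (le_of_eq ?_) (Complex.abs_im_le_norm _)
    simp [hi]
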